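/- arXiv:1007.1489 — 2 statements merged into one kernel-verified Lean document; each statement's English description precedes it below -/
import Mathlib

section
/- For every prime p there exists a group Δ which is finitely generated and such that every element of Δ has finite order equal to a power of p, Δ is residually finite, and every finite-index subgroup of Δ (including Δ itself) is just-infinite; that is, Δ is a finitely generated hereditarily just-infinite p-torsion group. -/
/-- A group is residually finite if every nontrivial element avoids some
finite-index normal subgroup. -/
def ResiduallyFinite (G : Type*) [Group G] : Prop :=
  ∀ g : G, g ≠ 1 → ∃ N : Subgroup G, N.Normal ∧ N.FiniteIndex ∧ g ∉ N

/-- A group is just-infinite if it is infinite and every nontrivial normal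
subgroup has finite index. -/
def JustInfinite (G : Type*) [Group G] : Prop :=
  Infinite G ∧ ∀ N : Subgroup G, N.Normal → N ≠ ⊥ → N.FiniteIndex

/-- A group is hereditarily just-infinite if it is residually finite and every
finite-index subgroup (including the group itself) is just-infinite. -/
def HereditarilyJustInfinite (G : Type*) [Group G] : Prop :=
  ResiduallyFinite G ∧ ∀ H : Subgroup G, H.FiniteIndex → JustInfinite H


section Piece1
open scoped Classical

/-! Linear algebra for the Golod-Shafarevich inequality -/

theorem gs_numeric {Y R : Type} [Fintype Y] [Fintype R] (dY : Y → ℕ) (dR : R → ℕ) (τ : ℝ)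
    (h0 : 0 < τ) (h1 : τ < 1) (c : ℕ → ℕ) (c0 : c 0 = 0) (B : ℕ) (hB : ∀ n, c n ≤ B)
    (hineq : ∀ n, 1 ≤ n → (∑ y, c (n - dY y)) + 1 ≤ (∑ r, c (n - dR r)) + c n)
    (hdef : 0 < (∑ y, τ ^ dY y) - 1 - ∑ r, τ ^ dR r) : False := by
  have hs : ∀ d, Summable (fun n => τ ^ n * (c (n - d) : ℝ)) := by
    intro d
    refine Summable.of_nonneg_of_le (fun n => by positivity) (fun n => ?_)
      ((summable_geometric_of_lt_one h0.le h1).mul_right (B : ℝ))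
    have : (c (n - d) : ℝ) ≤ B := by exact_mod_cast hB _
    gcongr
  set Ω := ∑' n, τ ^ n * (c n : ℝ) with hΩ
  have hΩ0 : 0 ≤ Ω := tsum_nonneg (fun n => by positivity)
  have hshift : ∀ d, ∑' n, τ ^ n * (c (n - d) : ℝ) = τ ^ d * Ω := by
    intro d
    rw [← (hs d).sum_add_tsum_nat_add d, hΩ, ← tsum_mul_left]
    rw [Finset.sum_eq_zero, zero_add]
    · refine tsum_congr fun n => ?_
      rw [Nat.add_sub_cancel, pow_add]; ring
    · intro i hi
      have : i - d = 0 := by simp at hi; omega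
      simp [this, c0]
  have key : ∀ n, (∑ y, τ ^ n * (c (n - dY y) : ℝ)) + (if n = 1 then τ else 0) ≤
      (∑ r, τ ^ n * (c (n - dR r) : ℝ)) + τ ^ n * (c n : ℝ) := by
    intro n
    rcases Nat.eq_zero_or_pos n with rfl | hn
    · simp [c0]
    · have := hineq n hn
      have h2 : (∑ y, (c (n - dY y) : ℝ)) + 1 ≤ (∑ r, (c (n - dR r) : ℝ)) + c n := by
        exact_mod_cast this
      rw [← Finset.mul_sum, ← Finset.mul_sum, ← mul_add]
      have h3 : (if n = 1 then τ else 0) ≤ τ ^ n * 1 := by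
        split_ifs with h
        · simp [h]
        · positivity
      calc _ ≤ τ ^ n * (∑ y, (c (n - dY y) : ℝ)) + τ ^ n * 1 := by gcongr
        _ = τ ^ n * ((∑ y, (c (n - dY y) : ℝ)) + 1) := by ring
        _ ≤ _ := by gcongr
  have hsi : Summable (fun n : ℕ => (if n = 1 then τ else 0)) :=
    summable_of_ne_finset_zero (s := {1}) (by intro b hb; simp at hb; simp [hb])
  have hsY : Summable (fun n => ∑ y, τ ^ n * (c (n - dY y) : ℝ)) :=
    summable_sum (fun y _ => hs (dY y))
  have hsR : Summable (fun n => ∑ r, τ ^ n * (c (n - dR r) : ℝ)) :=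
    summable_sum (fun y _ => hs (dR y))
  have hs0 : Summable (fun n => τ ^ n * (c n : ℝ)) := by simpa using hs 0
  have := Summable.tsum_le_tsum key (hsY.add hsi) (hsR.add hs0)
  rw [hsY.tsum_add hsi, hsR.tsum_add hs0, Summable.tsum_finsetSum (fun y _ => hs (dY y)),
    Summable.tsum_finsetSum (fun y _ => hs (dR y)), tsum_ite_eq] at this
  simp only [hshift, ← Finset.sum_mul, ← hΩ] at this
  nlinarith

section
variable {K M : Type} [Field K] [AddCommGroup M] [Module K M] {Y R : Type} [Fintype Y] [Fintype R]

theorem gs_linear (P : ℕ → Submodule K M) (P0 : P 0 = ⊤) (anti : Antitone P) (u : M)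
    (hu : u ∉ P 1) (hspan : ∀ x, ∃ c : K, x - c • u ∈ P 1)
    (dY : Y → ℕ) (dR : R → ℕ) (hdY : ∀ y, 1 ≤ dY y)
    (f : Y → M →ₗ[K] M) (hf : ∀ y m x, x ∈ P m → f y x ∈ P (m + dY y))
    (g : R → Y → M →ₗ[K] M) (hg : ∀ r y m x, x ∈ P m → g r y x ∈ P (m + (dR r - dY y)))
    (gen : ∀ n x, x ∈ P (n + 1) → ∃ c : Y → M, (∀ y, c y ∈ P (n + 1 - dY y)) ∧ x = ∑ y, f y (c y))
    (rel : ∀ c : Y → M, ∑ y, f y (c y) = 0 → ∃ b : R → M, ∀ y, c y = ∑ r, g r y (b r)) :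
    (∀ n, Module.Finite K (M ⧸ P n)) ∧
    ∀ n, 1 ≤ n → (∑ y, Module.finrank K (M ⧸ P (n - dY y))) + 1 ≤
      (∑ r, Module.finrank K (M ⧸ P (n - dR r))) + Module.finrank K (M ⧸ P n) := by
  have hfq : ∀ n y, P (n - dY y) ≤ (P n).comap (f y) := fun n y x hx =>
    anti (by omega) (hf y _ x hx)
  have hgq : ∀ n r y, P (n - dR r) ≤ (P (n - dY y)).comap (g r y) := fun n r y x hx =>
    anti (by omega) (hg r y _ x hx)
  let F : ∀ n, (∀ y, M ⧸ P (n - dY y)) →ₗ[K] M ⧸ P n := fun n =>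
    ∑ y, (Submodule.mapQ (P (n - dY y)) (P n) (f y) (hfq n y)) ∘ₗ LinearMap.proj y
  have hF : ∀ n (c : Y → M), F n (fun y => Submodule.Quotient.mk (c y)) =
      Submodule.Quotient.mk (∑ y, f y (c y)) := by
    intro n c
    simp only [F, LinearMap.sum_apply, LinearMap.comp_apply, LinearMap.proj_apply,
      Submodule.mapQ_apply]
    exact (map_sum (P n).mkQ _ _).symm
  have hFs : ∀ n (z : ∀ y, M ⧸ P (n - dY y)), ∃ c : Y → M,
      z = fun y => Submodule.Quotient.mk (c y) := by
    intro n z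
    refine ⟨fun y => (z y).out, ?_⟩
    ext y; simp
  have hfin : ∀ n, Module.Finite K (M ⧸ P n) := by
    intro n
    induction n using Nat.strong_induction_on with
    | _ n ih =>
    rcases n with _ | n
    · rw [P0]; infer_instance
    · have : ∀ y, Module.Finite K (M ⧸ P (n + 1 - dY y)) := fun y => ih _ (by
        have := hdY y; omega)
      let G : (K × (∀ y, M ⧸ P (n + 1 - dY y))) →ₗ[K] M ⧸ P (n + 1) :=
        LinearMap.coprod (LinearMap.toSpanSingleton K _ (Submodule.Quotient.mk u)) (F (n + 1))
      refine Module.Finite.of_surjective G ?_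
      intro z
      obtain ⟨x, rfl⟩ := Submodule.Quotient.mk_surjective _ z
      obtain ⟨c, hc⟩ := hspan x
      obtain ⟨d, -, hd⟩ := gen 0 _ hc
      refine ⟨(c, fun y => Submodule.Quotient.mk (d y)), ?_⟩
      simp only [G, LinearMap.coprod_apply, LinearMap.toSpanSingleton_apply]
      rw [hF, ← hd, ← Submodule.Quotient.mk_smul, ← Submodule.Quotient.mk_add]
      congr 1; abel
  refine ⟨hfin, ?_⟩
  intro n hn
  have := hfin
  let G : (∀ r, M ⧸ P (n - dR r)) →ₗ[K] (∀ y, M ⧸ P (n - dY y)) :=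
    LinearMap.pi fun y => ∑ r,
      (Submodule.mapQ (P (n - dR r)) (P (n - dY y)) (g r y) (hgq n r y)) ∘ₗ LinearMap.proj r
  have hker : LinearMap.ker (F n) ≤ LinearMap.range G := by
    intro z hz
    obtain ⟨c, rfl⟩ := hFs n z
    rw [LinearMap.mem_ker, hF, Submodule.Quotient.mk_eq_zero] at hz
    obtain ⟨n, rfl⟩ : ∃ m, n = m + 1 := ⟨n - 1, by omega⟩
    obtain ⟨d, hd, hd2⟩ := gen n _ hz
    obtain ⟨b, hb⟩ := rel (fun y => c y - d y) (by simp [hd2])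
    refine ⟨fun r => Submodule.Quotient.mk (b r), ?_⟩
    ext y
    simp only [G, LinearMap.pi_apply, LinearMap.sum_apply, LinearMap.comp_apply,
      LinearMap.proj_apply, Submodule.mapQ_apply]
    have : (Submodule.Quotient.mk (c y) : M ⧸ P (n + 1 - dY y)) =
        Submodule.Quotient.mk (c y - d y) := by
      rw [Submodule.Quotient.eq]; simpa using hd y
    rw [this, hb]
    exact (map_sum (P _).mkQ _ _).symm
  have hrange : LinearMap.range (F n) ≠ ⊤ := by
    intro h
    have : (Submodule.Quotient.mk u : M ⧸ P n) ∈ LinearMap.range (F n) := by rw [h]; trivial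
    obtain ⟨z, hz⟩ := this
    obtain ⟨c, rfl⟩ := hFs n z
    rw [hF, Submodule.Quotient.eq] at hz
    apply hu
    have h1 : (∑ y, f y (c y)) ∈ P 1 := Submodule.sum_mem _ fun y _ => by
      have := hf y 0 (c y) (by rw [P0]; trivial)
      exact anti (by have := hdY y; omega) this
    have := Submodule.sub_mem _ h1 (anti hn hz)
    simpa using this
  have e1 := LinearMap.finrank_range_add_finrank_ker (F n)
  have e2 := Submodule.finrank_lt hrange
  have e3 := Submodule.finrank_mono hker
  have e4 := LinearMap.finrank_range_le G
  rw [Module.finrank_pi_fintype] at e1 e4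
  omega
end

end Piece1

section Piece2
open scoped Classical commutatorElement

abbrev GA (p : ℕ) (Γ : Type) [Group Γ] := MonoidAlgebra (ZMod p) Γ

section
variable (p : ℕ) {Γ : Type} [Group Γ]

noncomputable def e : Γ →* GA p Γ := MonoidAlgebra.of (ZMod p) Γ

noncomputable def AV (V : Subgroup Γ) : Submodule (ZMod p) (GA p Γ) := Submodule.span _ ((e p) '' V)

noncomputable def IV (V : Subgroup Γ) : Submodule (ZMod p) (GA p Γ) :=
  Submodule.span _ {x | ∃ g ∈ V, x = e p g - 1}

variable {p}

theorem span_mul_mem {S T : Set (GA p Γ)} {P : Submodule (ZMod p) (GA p Γ)}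
    (h : ∀ s ∈ S, ∀ t ∈ T, s * t ∈ P) {x y : GA p Γ} (hx : x ∈ Submodule.span (ZMod p) S)
    (hy : y ∈ Submodule.span (ZMod p) T) : x * y ∈ P := by
  have h2 : Submodule.span (ZMod p) S * Submodule.span (ZMod p) T ≤ P := by
    rw [Submodule.span_mul_span, Submodule.span_le]
    rintro _ ⟨s, hs, t, ht, rfl⟩
    exact h s hs t ht
  exact h2 (Submodule.mul_mem_mul hx hy)

theorem span_lin {Γ' : Type} [Group Γ'] {S : Set (GA p Γ)} {P : Submodule (ZMod p) (GA p Γ')}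
    (f : GA p Γ →ₗ[ZMod p] GA p Γ') (h : ∀ s ∈ S, f s ∈ P) {x : GA p Γ}
    (hx : x ∈ Submodule.span (ZMod p) S) : f x ∈ P := by
  have h2 : Submodule.span (ZMod p) S ≤ P.comap f := by
    rw [Submodule.span_le]; exact h
  exact h2 hx

theorem span_mulR {S : Set (GA p Γ)} {P : Submodule (ZMod p) (GA p Γ)} (a : GA p Γ)
    (h : ∀ s ∈ S, s * a ∈ P) {x : GA p Γ}
    (hx : x ∈ Submodule.span (ZMod p) S) : x * a ∈ P :=
  span_lin (LinearMap.mulRight (ZMod p) a) (by simpa using h) hx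

theorem span_mulL {S : Set (GA p Γ)} {P : Submodule (ZMod p) (GA p Γ)} (a : GA p Γ)
    (h : ∀ s ∈ S, a * s ∈ P) {x : GA p Γ}
    (hx : x ∈ Submodule.span (ZMod p) S) : a * x ∈ P :=
  span_lin (LinearMap.mulLeft (ZMod p) a) (by simpa using h) hx

theorem e_mem_AV {V : Subgroup Γ} {g : Γ} (hg : g ∈ V) : e p g ∈ AV p V :=
  Submodule.subset_span ⟨g, hg, rfl⟩

theorem one_mem_AV (V : Subgroup Γ) : (1 : GA p Γ) ∈ AV p V := by
  have := e_mem_AV (p := p) V.one_mem; rwa [map_one] at this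

theorem AV_mono {V W : Subgroup Γ} (h : V ≤ W) : AV p V ≤ AV p W :=
  Submodule.span_mono (Set.image_mono h)

theorem IV_mono {V W : Subgroup Γ} (h : V ≤ W) : IV p V ≤ IV p W :=
  Submodule.span_mono (by rintro _ ⟨g, hg, rfl⟩; exact ⟨g, h hg, rfl⟩)

theorem AV_mul {V : Subgroup Γ} {x y : GA p Γ} (hx : x ∈ AV p V) (hy : y ∈ AV p V) :
    x * y ∈ AV p V := by
  refine span_mul_mem ?_ hx hy
  rintro _ ⟨g, hg, rfl⟩ _ ⟨h, hh, rfl⟩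
  rw [← map_mul]
  exact e_mem_AV (V.mul_mem hg hh)

theorem AV_pow {V : Subgroup Γ} {x : GA p Γ} (hx : x ∈ AV p V) (n : ℕ) :
    x ^ n ∈ AV p V := by
  induction n with
  | zero => simpa using one_mem_AV V
  | succ n ih => rw [pow_succ]; exact AV_mul ih hx

theorem AV_conj {V : Subgroup Γ} [V.Normal] (g : Γ) {x : GA p Γ} (hx : x ∈ AV p V) :
    e p g * x * e p g⁻¹ ∈ AV p V := by
  refine span_lin ((LinearMap.mulRight (ZMod p) (e p g⁻¹)).comp (LinearMap.mulLeft (ZMod p) (e p g)))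
    ?_ hx
  rintro _ ⟨h, hh, rfl⟩
  simp only [LinearMap.comp_apply, LinearMap.mulLeft_apply, LinearMap.mulRight_apply]
  rw [← map_mul, ← map_mul]
  exact e_mem_AV (Subgroup.Normal.conj_mem ‹_› _ hh g)

theorem sub_mem_IV {V : Subgroup Γ} {g : Γ} (hg : g ∈ V) : e p g - 1 ∈ IV p V :=
  Submodule.subset_span ⟨g, hg, rfl⟩

theorem IV_le_AV (V : Subgroup Γ) : IV p V ≤ AV p V := by
  refine Submodule.span_le.2 ?_
  rintro _ ⟨g, hg, rfl⟩
  exact Submodule.sub_mem _ (e_mem_AV hg) (one_mem_AV V)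

theorem e_inv_mul (g : Γ) : e p g⁻¹ * e p g = 1 := by rw [← map_mul]; simp
theorem e_mul_inv (g : Γ) : e p g * e p g⁻¹ = 1 := by rw [← map_mul]; simp
theorem e_inv_mul_assoc (g : Γ) (x : GA p Γ) : e p g⁻¹ * (e p g * x) = x := by
  rw [← mul_assoc, e_inv_mul, one_mul]
theorem e_mul_inv_assoc (g : Γ) (x : GA p Γ) : e p g * (e p g⁻¹ * x) = x := by
  rw [← mul_assoc, e_mul_inv, one_mul]

theorem e_inj [Fact p.Prime] : Function.Injective (e p (Γ := Γ)) := MonoidAlgebra.of_injective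

theorem one_notMem_IV [Fact p.Prime] (V : Subgroup Γ) : (1 : GA p Γ) ∉ IV p V := by
  intro h
  let ε : GA p Γ →ₐ[ZMod p] ZMod p := MonoidAlgebra.lift (ZMod p) (ZMod p) Γ 1
  have h2 : IV p V ≤ LinearMap.ker ε.toLinearMap := by
    refine Submodule.span_le.2 ?_
    rintro _ ⟨g, hg, rfl⟩
    simp [ε, e]
  have := h2 h
  simp at this

theorem AV_sub_IV (V : Subgroup Γ) {x : GA p Γ} (hx : x ∈ AV p V) :
    ∃ c : ZMod p, x - c • 1 ∈ IV p V := by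
  refine Submodule.span_induction ?_ ?_ ?_ ?_ hx
  · rintro _ ⟨g, hg, rfl⟩
    exact ⟨1, by rw [one_smul]; exact sub_mem_IV hg⟩
  · exact ⟨0, by simp⟩
  · rintro x y - - ⟨c, hc⟩ ⟨d, hd⟩
    refine ⟨c + d, ?_⟩
    have := Submodule.add_mem _ hc hd
    rw [add_smul]; convert this using 1; abel
  · rintro a x - ⟨c, hc⟩
    refine ⟨a * c, ?_⟩
    have := Submodule.smul_mem _ a hc
    rwa [smul_sub, smul_smul] at this

theorem e_sub_pow [Fact p.Prime] (g : Γ) (m : ℕ) :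
    e p (g ^ p ^ m) - 1 = (e p g - 1) ^ p ^ m := by
  have : CharP (GA p Γ) p := by
    refine charP_of_injective_algebraMap (R := ZMod p) ?_ p
    exact (algebraMap (ZMod p) (GA p Γ)).injective
  rw [sub_pow_char_pow_of_commute _ _ (Commute.one_right _), map_pow, one_pow]

theorem e_comm (g h : Γ) : e p ⁅g, h⁆ - 1 =
    ((e p g - 1) * (e p h - 1) - (e p h - 1) * (e p g - 1)) * (e p g⁻¹ * e p h⁻¹) := by
  have h1 : (e p g - 1) * (e p h - 1) - (e p h - 1) * (e p g - 1) = e p g * e p h - e p h * e p g := by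
    noncomm_ring
  rw [h1, commutatorElement_def, sub_mul, map_mul, map_mul, map_mul]
  congr 1
  · simp only [mul_assoc]
  · simp only [mul_assoc]
    rw [e_mul_inv_assoc, e_mul_inv]

variable (p) in
structure Fil (V : Subgroup Γ) (J : ℕ → Submodule (ZMod p) (GA p Γ)) : Prop where
  zero : J 0 = AV p V
  one : J 1 = IV p V
  anti : Antitone J
  mul : ∀ {m n x y}, x ∈ J m → y ∈ J n → x * y ∈ J (m + n)
  conj : ∀ (g : Γ) {n x}, x ∈ J n → e p g * x * e p g⁻¹ ∈ J n
  gen : ∀ n, J (n + 1) ≤ Submodule.span (ZMod p) {z | ∃ b s g t, b ∈ J s ∧ g ∈ V ∧ e p g - 1 ∈ J t ∧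
    1 ≤ t ∧ n + 1 ≤ s + t ∧ z = b * (e p g - 1)}

variable (p) in
structure Cx (J : ℕ → Submodule (ZMod p) (GA p Γ)) where
  Y : Type
  R : Type
  fY : Fintype Y
  fR : Fintype R
  dY : Y → ℕ
  dR : R → ℕ
  dY1 : ∀ y, 1 ≤ dY y
  a : Y → GA p Γ
  ha : ∀ y, a y ∈ J (dY y)
  gen : ∀ n x, x ∈ J (n + 1) → ∃ c : Y → GA p Γ, (∀ y, c y ∈ J (n + 1 - dY y)) ∧ x = ∑ y, c y * a y
  ρ : R → Y → GA p Γ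
  hρ : ∀ r y, ρ r y ∈ J (dR r - dY y)
  rel : ∀ c : Y → GA p Γ, (∀ y, c y ∈ J 0) → ∑ y, c y * a y = 0 →
    ∃ b : R → GA p Γ, (∀ r, b r ∈ J 0) ∧ ∀ y, c y = ∑ r, b r * ρ r y

attribute [instance] Cx.fY Cx.fR

noncomputable def Cx.df {J : ℕ → Submodule (ZMod p) (GA p Γ)} (C : Cx p J) : ℝ :=
  (∑ y, (3 / 4 : ℝ) ^ C.dY y) - 1 - ∑ r, (3 / 4 : ℝ) ^ C.dR r

namespace Fil
variable {V : Subgroup Γ} {J : ℕ → Submodule (ZMod p) (GA p Γ)} (hJ : Fil p V J)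
include hJ

theorem e_mem {g : Γ} (hg : g ∈ V) : e p g ∈ J 0 := by rw [hJ.zero]; exact e_mem_AV hg

theorem one_mem : (1 : GA p Γ) ∈ J 0 := by rw [hJ.zero]; exact one_mem_AV V

theorem sub_mem {g : Γ} (hg : g ∈ V) : e p g - 1 ∈ J 1 := by rw [hJ.one]; exact sub_mem_IV hg

theorem mulL {n} {x y : GA p Γ} (hx : x ∈ J 0) (hy : y ∈ J n) : x * y ∈ J n := by
  have := hJ.mul hx hy; rwa [zero_add] at this

theorem mulR {n} {x y : GA p Γ} (hx : x ∈ J n) (hy : y ∈ J 0) : x * y ∈ J n := hJ.mul hx hy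

theorem le0 (n) : J n ≤ J 0 := hJ.anti (Nat.zero_le n)

theorem pow {n} {x : GA p Γ} (hx : x ∈ J n) (k : ℕ) : x ^ k ∈ J (k * n) := by
  induction k with
  | zero => simpa using hJ.one_mem
  | succ k ih => rw [pow_succ, Nat.succ_mul]; exact hJ.mul ih hx

def D (n : ℕ) : Subgroup Γ where
  carrier := {g | g ∈ V ∧ e p g - 1 ∈ J n}
  one_mem' := ⟨V.one_mem, by simp⟩
  mul_mem' := by
    rintro g h ⟨hg, hg'⟩ ⟨hh, hh'⟩
    refine ⟨V.mul_mem hg hh, ?_⟩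
    have : e p (g * h) - 1 = (e p g - 1) * e p h + (e p h - 1) := by
      rw [map_mul]; noncomm_ring
    rw [this]
    exact Submodule.add_mem _ (hJ.mulR hg' (hJ.e_mem hh)) hh'
  inv_mem' := by
    rintro g ⟨hg, hg'⟩
    refine ⟨V.inv_mem hg, ?_⟩
    have : e p g⁻¹ - 1 = - ((e p g - 1) * e p g⁻¹) := by
      rw [sub_mul, e_mul_inv]; noncomm_ring
    rw [this]
    exact Submodule.neg_mem _ (hJ.mulR hg' (hJ.e_mem (V.inv_mem hg)))

theorem mem_D {n} {g : Γ} : g ∈ hJ.D n ↔ g ∈ V ∧ e p g - 1 ∈ J n := Iff.rfl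

theorem D_normal [hV : V.Normal] (n) : (hJ.D n).Normal := by
  constructor
  rintro h ⟨hh, hh'⟩ g
  refine ⟨hV.conj_mem _ hh g, ?_⟩
  have := hJ.conj g hh'
  rw [mul_sub, sub_mul, mul_one, e_mul_inv, ← map_mul, ← map_mul] at this
  exact this

theorem D_anti : Antitone hJ.D := fun _ _ h _ hg => ⟨hg.1, hJ.anti h hg.2⟩

theorem D_one : hJ.D 1 = V := by
  ext g; exact ⟨fun h => h.1, fun h => ⟨h, hJ.sub_mem h⟩⟩

theorem D_le (n) : hJ.D n ≤ V := fun _ h => h.1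

theorem D_comm {m n} {g h : Γ} (hg : g ∈ hJ.D m) (hh : h ∈ hJ.D n) : ⁅g, h⁆ ∈ hJ.D (m + n) := by
  refine ⟨?_, ?_⟩
  · rw [commutatorElement_def]
    exact V.mul_mem (V.mul_mem (V.mul_mem hg.1 hh.1) (V.inv_mem hg.1)) (V.inv_mem hh.1)
  · rw [e_comm]
    refine hJ.mulR (Submodule.sub_mem _ (hJ.mul hg.2 hh.2) ?_)
      (hJ.mulL (hJ.e_mem (V.inv_mem hg.1)) (hJ.e_mem (V.inv_mem hh.1)))
    rw [add_comm]; exact hJ.mul hh.2 hg.2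

theorem D_pow [Fact p.Prime] {n} {g : Γ} (hg : g ∈ hJ.D n) (m : ℕ) : g ^ p ^ m ∈ hJ.D (p ^ m * n) := by
  refine ⟨V.pow_mem hg.1 _, ?_⟩
  rw [e_sub_pow]
  exact hJ.pow hg.2 _

theorem gs [Fact p.Prime] (C : Cx p J) (hC : 0 < C.df) :
    (∀ n, (hJ.D n).relIndex V ≠ 0) ∧ ∀ B : ℕ, ∃ n, B < (hJ.D n).relIndex V := by
  let M := ↥(J 0)
  let P : ℕ → Submodule (ZMod p) M := fun n => (J n).comap (J 0).subtype
  have mulr : ∀ a ∈ J 0, ∃ f : M →ₗ[ZMod p] M, ∀ x : M, (f x : GA p Γ) = x * a := by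
    intro a ha
    exact ⟨LinearMap.restrict (LinearMap.mulRight (ZMod p) a) (fun x hx => hJ.mulR hx ha),
      fun x => rfl⟩
  choose f hf using fun y => mulr (C.a y) (hJ.le0 _ (C.ha y))
  choose g hg using fun r y => mulr (C.ρ r y) (hJ.le0 _ (C.hρ r y))
  have hsum : ∀ c : C.Y → M, ((∑ y, f y (c y) : M) : GA p Γ) = ∑ y, (c y : GA p Γ) * C.a y := by
    intro c; rw [AddSubmonoidClass.coe_finsetSum]; simp [hf]
  obtain ⟨hfin, hineq⟩ := gs_linear P (eq_top_iff.2 fun x _ => x.2) (fun m n h x hx => hJ.anti h hx)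
    ⟨1, hJ.one_mem⟩ (by
      intro h
      have : (1 : GA p Γ) ∈ J 1 := h
      rw [hJ.one] at this
      exact one_notMem_IV V this) (by
      rintro ⟨x, hx⟩
      rw [hJ.zero] at hx
      obtain ⟨c, hc⟩ := AV_sub_IV V hx
      exact ⟨c, by change _ ∈ J 1; rw [hJ.one]; exact hc⟩) C.dY C.dR C.dY1 f
    (by intro y m x hx; change (f y x : GA p Γ) ∈ J _; rw [hf]
        exact hJ.mul hx (C.ha y)) g
    (by intro r y m x hx; change (g r y x : GA p Γ) ∈ J _; rw [hg]
        exact hJ.mul hx (C.hρ r y))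
    (by intro n x hx
        obtain ⟨c, hc, hx⟩ := C.gen n _ hx
        refine ⟨fun y => ⟨c y, hJ.le0 _ (hc y)⟩, hc, ?_⟩
        apply Subtype.ext
        rw [hsum]; exact hx)
    (by intro c hc
        obtain ⟨b, hb, hbc⟩ := C.rel (fun y => c y) (fun y => (c y).2) (by rw [← hsum, hc]; rfl)
        refine ⟨fun r => ⟨b r, hb r⟩, fun y => ?_⟩
        apply Subtype.ext
        rw [AddSubmonoidClass.coe_finsetSum, hbc]; simp [hg])
  have hfinite : ∀ n, Finite (M ⧸ P n) := fun n => by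
    have := hfin n
    exact Module.finite_of_finite (ZMod p)
  let φ : ∀ n, V → M ⧸ P n := fun n v => Submodule.Quotient.mk ⟨e p v, hJ.e_mem v.2⟩
  have hφ : ∀ n (v w : V), φ n v = φ n w ↔ v⁻¹ * w ∈ (hJ.D n).subgroupOf V := by
    intro n v w
    rw [Submodule.Quotient.eq]
    change e p (v : Γ) - e p (w : Γ) ∈ J n ↔ _ ∧ _
    simp only [Subgroup.coe_subtype, Subgroup.coe_mul, Subgroup.coe_inv]
    have hv := v.2
    have hw := w.2
    constructor
    · intro h
      refine ⟨V.mul_mem (V.inv_mem hv) hw, ?_⟩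
      have h2 := hJ.mulL (hJ.e_mem (V.inv_mem hv)) (Submodule.neg_mem _ h)
      rwa [neg_sub, mul_sub, e_inv_mul, ← map_mul] at h2
    · rintro ⟨-, h⟩
      have h2 := hJ.mulL (hJ.e_mem hv) (Submodule.neg_mem _ h)
      rwa [neg_sub, mul_sub, ← map_mul, mul_inv_cancel_left, mul_one] at h2
  let ψ : ∀ n, V ⧸ (hJ.D n).subgroupOf V → M ⧸ P n := fun n =>
    Quotient.lift (φ n) (fun a b h => (hφ n a b).2 (QuotientGroup.leftRel_apply.1 h))
  have hψ : ∀ n, Function.Injective (ψ n) := by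
    intro n a b
    induction a using Quotient.inductionOn with | _ a => ?_
    induction b using Quotient.inductionOn with | _ b => ?_
    intro h
    exact Quotient.sound (QuotientGroup.leftRel_apply.2 ((hφ n a b).1 h))
  have hF : ∀ n, Finite (V ⧸ (hJ.D n).subgroupOf V) := fun n => Finite.of_injective _ (hψ n)
  have hrk : ∀ n, Module.finrank (ZMod p) (M ⧸ P n) ≤ (hJ.D n).relIndex V := by
    intro n
    have := Fintype.ofFinite (V ⧸ (hJ.D n).subgroupOf V)
    have hs : Submodule.span (ZMod p) (Set.range (ψ n)) = ⊤ := by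
      rw [eq_top_iff]
      rintro z -
      obtain ⟨⟨x, hx⟩, rfl⟩ := Submodule.Quotient.mk_surjective _ z
      have hx' := hx
      rw [hJ.zero] at hx'
      have key : ∀ x ∈ AV p V, ∃ hx : x ∈ J 0, (Submodule.Quotient.mk ⟨x, hx⟩ : M ⧸ P n) ∈
          Submodule.span (ZMod p) (Set.range (ψ n)) := by
        intro x hx
        refine Submodule.span_induction ?_ ?_ ?_ ?_ hx
        · rintro _ ⟨g, hg, rfl⟩
          exact ⟨hJ.e_mem hg, Submodule.subset_span ⟨Quotient.mk _ ⟨g, hg⟩, rfl⟩⟩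
        · exact ⟨Submodule.zero_mem _, Submodule.zero_mem _⟩
        · rintro x y - - ⟨hx, hx'⟩ ⟨hy, hy'⟩
          exact ⟨Submodule.add_mem _ hx hy, Submodule.add_mem _ hx' hy'⟩
        · rintro a x - ⟨hx, hx'⟩
          exact ⟨Submodule.smul_mem _ a hx, Submodule.smul_mem _ a hx'⟩
      exact (key x hx').2
    have h2 := finrank_range_le_card (R := ZMod p) (ψ n)
    rw [Set.finrank, hs, finrank_top] at h2
    rwa [Subgroup.relIndex, Subgroup.index, Nat.card_eq_fintype_card]
  refine ⟨fun n => ?_, fun B => ?_⟩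
  · have := hF n
    exact Subgroup.index_ne_zero_of_finite
  · by_contra! hcon
    refine gs_numeric C.dY C.dR (3 / 4) (by norm_num) (by norm_num)
      (fun n => Module.finrank (ZMod p) (M ⧸ P n)) ?_ B (fun n => (hrk n).trans (hcon n)) hineq hC
    have : Subsingleton (M ⧸ P 0) := Submodule.Quotient.subsingleton_iff.2 (eq_top_iff.2 fun x _ => x.2)
    exact Module.finrank_zero_of_subsingleton
end Fil
end

end Piece2

section Piece3
open scoped Classical commutatorElement

section
variable {p : ℕ}

theorem fox_rel [Fact p.Prime] (c : Fin 2 → GA p (FreeGroup (Fin 2)))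
    (hc : ∑ y, c y * (e p (FreeGroup.of y) - 1) = 0) : ∀ y, c y = 0 := by
  intro z
  let mk : Fin 2 → (Matrix (Fin 2) (Fin 2) (GA p (FreeGroup (Fin 2))))ˣ := fun y =>
    ⟨!![e p (FreeGroup.of y), if y = z then 1 else 0; 0, 1],
     !![e p (FreeGroup.of y)⁻¹, - (e p (FreeGroup.of y)⁻¹ * if y = z then 1 else 0); 0, 1],
     by rw [Matrix.mul_fin_two, Matrix.one_fin_two]; simp [e_mul_inv, e_mul_inv_assoc],
     by rw [Matrix.mul_fin_two, Matrix.one_fin_two]; simp [e_inv_mul]⟩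
  let h : FreeGroup (Fin 2) →* Matrix (Fin 2) (Fin 2) (GA p (FreeGroup (Fin 2))) :=
    (Units.coeHom _).comp (FreeGroup.lift mk)
  let φ : GA p (FreeGroup (Fin 2)) →ₐ[ZMod p] Matrix (Fin 2) (Fin 2) (GA p (FreeGroup (Fin 2))) := MonoidAlgebra.lift (ZMod p) _ _ h
  have hφ : ∀ g, φ (e p g) = h g := fun g => by simp [φ, e]
  have hg : ∀ g, h g 0 0 = e p g ∧ h g 1 0 = 0 := by
    intro g
    induction g using FreeGroup.induction_on with
    | C1 => simp [Matrix.one_fin_two]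
    | of y => simp [h, mk]
    | inv_of y => simp [h, mk]
    | mul x y hx hy => 
      rw [map_mul, Matrix.mul_apply, Matrix.mul_apply]; simp [hx, hy]
  have hφ0 : ∀ x, φ x 0 0 = x ∧ φ x 1 0 = 0 := by
    intro x
    induction x using MonoidAlgebra.induction_on with
    | of g => have := hφ g; rw [e] at this; rw [this]; exact hg g
    | add x y hx hy => simp [hx, hy]
    | smul r x hx => simp [hx]
  have h3 : φ (∑ y, c y * (e p (FreeGroup.of y) - 1)) 0 1 = c z := by
    rw [map_sum, Matrix.sum_apply, Finset.sum_eq_single z]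
    · rw [map_mul, Matrix.mul_apply]; simp [hφ0, hφ, h, mk]
    · intro y _ hy
      rw [map_mul, Matrix.mul_apply]; simp [hφ0, hφ, h, mk, hy]
    · simp
  rw [hc] at h3
  simpa using h3.symm

theorem base_exists (p : ℕ) [Fact p.Prime] : ∃ J, Fil p (⊤ : Subgroup (FreeGroup (Fin 2))) J ∧
    ∃ C : Cx p J, 0 < C.df := by
  let B := AV p (⊤ : Subgroup (FreeGroup (Fin 2)))
  let I := IV p (⊤ : Subgroup (FreeGroup (Fin 2)))
  have BB : B * B = B := by
    refine le_antisymm (Submodule.mul_le.2 fun x hx y hy => AV_mul hx hy) ?_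
    intro x hx
    have := Submodule.mul_mem_mul (one_mem_AV (p := p) (⊤ : Subgroup (FreeGroup (Fin 2)))) hx
    rwa [one_mul] at this
  have le1 : ∀ P : Submodule (ZMod p) (GA p (FreeGroup (Fin 2))), P ≤ B * P := by
    intro P x hx
    have := Submodule.mul_mem_mul (one_mem_AV (p := p) (⊤ : Subgroup (FreeGroup (Fin 2)))) hx
    rwa [one_mul] at this
  have BI : B * I ≤ I := by
    refine Submodule.mul_le.2 fun x hx y hy => span_mul_mem ?_ hx hy
    rintro _ ⟨g, -, rfl⟩ _ ⟨h, -, rfl⟩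
    have : e p g * (e p h - 1) = (e p (g * h) - 1) - (e p g - 1) := by
      rw [map_mul]; noncomm_ring
    rw [this]
    exact Submodule.sub_mem _ (sub_mem_IV (Subgroup.mem_top _)) (sub_mem_IV (Subgroup.mem_top _))
  have IB : I * B ≤ I := by
    refine Submodule.mul_le.2 fun x hx y hy => span_mul_mem ?_ hx hy
    rintro _ ⟨h, -, rfl⟩ _ ⟨g, -, rfl⟩
    have : (e p h - 1) * e p g = (e p (h * g) - 1) - (e p g - 1) := by
      rw [map_mul]; noncomm_ring
    rw [this]
    exact Submodule.sub_mem _ (sub_mem_IV (Subgroup.mem_top _)) (sub_mem_IV (Subgroup.mem_top _))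
  let J : ℕ → Submodule (ZMod p) (GA p (FreeGroup (Fin 2))) := fun n => B * I ^ n
  have IpB : ∀ m, I ^ m * B ≤ B * I ^ m := by
    intro m
    cases m with
    | zero => simp
    | succ m =>
      rw [pow_succ, mul_assoc]
      exact (mul_le_mul' le_rfl IB).trans (le1 _)
  have Jmul : ∀ m n, J m * J n ≤ J (m + n) := by
    intro m n
    calc B * I ^ m * (B * I ^ n) = B * (I ^ m * B) * I ^ n := by simp only [mul_assoc]
      _ ≤ B * (B * I ^ m) * I ^ n := mul_le_mul' (mul_le_mul' le_rfl (IpB m)) le_rfl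
      _ = B * I ^ (m + n) := by rw [← mul_assoc, BB, pow_add, mul_assoc]
  have J0 : J 0 = B := by simp [J]
  have J1 : J 1 = I := by simpa [J] using le_antisymm BI (le1 _)
  have hmul : ∀ {m n x y}, x ∈ J m → y ∈ J n → x * y ∈ J (m + n) := fun hx hy =>
    Jmul _ _ (Submodule.mul_mem_mul hx hy)
  have hmem : ∀ g, e p g ∈ J 0 := fun g => by rw [J0]; exact e_mem_AV (Subgroup.mem_top _)
  have Jsucc : ∀ n, J (n + 1) = J n * I := by intro n; simp only [J]; rw [pow_succ, mul_assoc]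
  have hF : Fil p (⊤ : Subgroup (FreeGroup (Fin 2))) J := by
    refine ⟨J0, J1, antitone_nat_of_succ_le fun n => ?_, hmul, ?_, ?_⟩
    · simp only [J]; rw [pow_succ', ← mul_assoc]
      exact mul_le_mul' (BI.trans (IV_le_AV _)) le_rfl
    · intro g n x hx
      have := hmul (hmul (hmem g) hx) (hmem g⁻¹)
      rwa [zero_add, add_zero] at this
    · intro n
      rw [Jsucc]
      refine Submodule.mul_le.2 fun b hb y hy => span_mulL b ?_ hy
      rintro _ ⟨g, -, rfl⟩
      refine Submodule.subset_span ⟨b, n, g, 1, hb, Subgroup.mem_top _, ?_, le_rfl, le_rfl, rfl⟩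
      rw [J1]; exact sub_mem_IV (Subgroup.mem_top _)
  have topJ : ∀ x, x ∈ J 0 := by
    intro x
    rw [J0]
    induction x using MonoidAlgebra.induction_on with
    | of g => exact e_mem_AV (Subgroup.mem_top _)
    | add x y hx hy => exact Submodule.add_mem _ hx hy
    | smul r x hx => exact Submodule.smul_mem _ r hx
  have hgen : ∀ g, ∃ c : Fin 2 → GA p (FreeGroup (Fin 2)),
      e p g - 1 = ∑ y, c y * (e p (FreeGroup.of y) - 1) := by
    have hinv : ∀ g, (∃ c : Fin 2 → GA p (FreeGroup (Fin 2)),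
      e p g - 1 = ∑ y, c y * (e p (FreeGroup.of y) - 1)) → (∃ c : Fin 2 → GA p (FreeGroup (Fin 2)),
      e p g⁻¹ - 1 = ∑ y, c y * (e p (FreeGroup.of y) - 1)) := by
      rintro g ⟨c, hc⟩
      refine ⟨fun y => - e p g⁻¹ * c y, ?_⟩
      simp only [mul_assoc]
      rw [← Finset.mul_sum, ← hc, mul_sub, neg_mul, e_inv_mul]; noncomm_ring
    have hof : ∀ z : Fin 2, ∃ c : Fin 2 → GA p (FreeGroup (Fin 2)),
      e p (FreeGroup.of z) - 1 = ∑ y, c y * (e p (FreeGroup.of y) - 1) := fun z =>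
      ⟨fun y => if y = z then 1 else 0, by simp⟩
    intro g
    induction g using FreeGroup.induction_on with
    | C1 => exact ⟨0, by simp⟩
    | of y => exact hof y
    | inv_of y h => exact hinv _ h
    | mul x y hx hy =>
      obtain ⟨c, hc⟩ := hx
      obtain ⟨d, hd⟩ := hy
      refine ⟨fun z => e p x * d z + c z, ?_⟩
      simp only [add_mul, mul_assoc]
      rw [Finset.sum_add_distrib, ← Finset.mul_sum, ← hc, ← hd, map_mul]; noncomm_ring
  refine ⟨J, hF, ⟨⟨Fin 2, Empty, inferInstance, inferInstance, fun _ => 1, Empty.elim,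
    fun _ => le_rfl, fun y => e p (FreeGroup.of y) - 1, fun y => hF.sub_mem (Subgroup.mem_top _), ?_,
    fun r => r.elim, fun r => r.elim, ?_⟩, ?_⟩⟩
  · intro n x hx
    simp only [Nat.add_sub_cancel]
    have h2 : ∀ x ∈ J n * I, ∃ c : Fin 2 → GA p (FreeGroup (Fin 2)), (∀ y, c y ∈ J n) ∧
        x = ∑ y, c y * (e p (FreeGroup.of y) - 1) := by
      have hadd : ∀ x y, (∃ c : Fin 2 → GA p (FreeGroup (Fin 2)), (∀ y, c y ∈ J n) ∧
        x = ∑ y, c y * (e p (FreeGroup.of y) - 1)) → (∃ c : Fin 2 → GA p (FreeGroup (Fin 2)),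
        (∀ y, c y ∈ J n) ∧ y = ∑ y, c y * (e p (FreeGroup.of y) - 1)) →
        (∃ c : Fin 2 → GA p (FreeGroup (Fin 2)), (∀ y, c y ∈ J n) ∧
        x + y = ∑ y, c y * (e p (FreeGroup.of y) - 1)) := by
        rintro x y ⟨c, hc, rfl⟩ ⟨d, hd, rfl⟩
        exact ⟨fun y => c y + d y, fun y => Submodule.add_mem _ (hc y) (hd y), by
          simp only [add_mul, Finset.sum_add_distrib]⟩
      intro x hx
      refine Submodule.mul_induction_on hx ?_ (fun x y => hadd x y)
      intro b hb z hz
      refine Submodule.span_induction (p := fun z _ => ∃ c : Fin 2 → GA p (FreeGroup (Fin 2)),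
        (∀ y, c y ∈ J n) ∧ b * z = ∑ y, c y * (e p (FreeGroup.of y) - 1)) ?_ ?_ ?_ ?_ hz
      · rintro _ ⟨g, -, rfl⟩
        obtain ⟨c, hc⟩ := hgen g
        refine ⟨fun y => b * c y, fun y => hF.mulR hb (topJ _), ?_⟩
        rw [hc, Finset.mul_sum]; simp only [mul_assoc]
      · exact ⟨0, fun y => Submodule.zero_mem _, by simp⟩
      · intro x y _ _ hx hy
        rw [mul_add]; exact hadd _ _ hx hy
      · rintro r x _ ⟨c, hc, h⟩
        refine ⟨fun y => r • c y, fun y => Submodule.smul_mem _ r (hc y), ?_⟩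
        rw [mul_smul_comm, h, Finset.smul_sum]; simp only [smul_mul_assoc]
    rw [Jsucc] at hx
    exact h2 x hx
  · intro c _ hc
    exact ⟨fun r => r.elim, fun r => r.elim, fun y => by simpa using fox_rel c hc y⟩
  · simp only [Cx.df]
    simp
    norm_num
end

end Piece3

section Piece4
open scoped Classical commutatorElement

section
variable {p : ℕ} {Γ Γ' : Type} [Group Γ] [Group Γ']

variable (p) in
noncomputable def pi (q : Γ →* Γ') : GA p Γ →ₐ[ZMod p] GA p Γ' :=
  MonoidAlgebra.lift (ZMod p) _ Γ ((e p).comp q)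

theorem pi_e (q : Γ →* Γ') (g : Γ) : pi p q (e p g) = e p (q g) := by
  simp only [pi]
  exact MonoidAlgebra.lift_of _ _

theorem exists_section (s : Γ' → Γ) : ∃ r : GA p Γ' →ₗ[ZMod p] GA p Γ, ∀ g, r (e p g) = e p (s g) := by
  refine ⟨(MonoidAlgebra.coeffLinearEquiv (ZMod p)).symm.toLinearMap.comp
    ((Finsupp.lmapDomain (ZMod p) (ZMod p) s).comp
      (MonoidAlgebra.coeffLinearEquiv (ZMod p)).toLinearMap), fun g => ?_⟩
  simp [e]

theorem ker_pi (q : Γ →* Γ') (hq : Function.Surjective q) {V : Subgroup Γ} (hV : q.ker ≤ V)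
    {z : GA p Γ} (hz : z ∈ AV p V) (h0 : pi p q z = 0) :
    z ∈ Submodule.span (ZMod p) {x | ∃ v ∈ V, ∃ n ∈ q.ker, x = e p v * (e p n - 1)} := by
  obtain ⟨r, hr⟩ := exists_section (p := p) (Function.surjInv hq)
  have h1 : z - r (pi p q z) ∈
      Submodule.span (ZMod p) {x | ∃ v ∈ V, ∃ n ∈ q.ker, x = e p v * (e p n - 1)} := by
    refine span_lin (LinearMap.id - r.comp (pi p q).toLinearMap) ?_ hz
    rintro _ ⟨v, hv, rfl⟩
    simp only [LinearMap.sub_apply, LinearMap.id_apply, LinearMap.comp_apply,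
      AlgHom.toLinearMap_apply, pi_e, hr]
    set w := Function.surjInv hq (q v) with hw
    have hw2 : q w = q v := Function.surjInv_eq hq _
    have hk : w⁻¹ * v ∈ q.ker := by rw [MonoidHom.mem_ker]; simp [hw2]
    have hwV : w ∈ V := by
      have := V.mul_mem hv (V.inv_mem (hV hk))
      simpa using this
    refine Submodule.subset_span ⟨w, hwV, w⁻¹ * v, hk, ?_⟩
    rw [mul_sub, ← map_mul, mul_inv_cancel_left, mul_one]
  rwa [h0, map_zero, sub_zero] at h1

theorem kill [Fact p.Prime] {V : Subgroup Γ} [hVn : V.Normal] [V.FiniteIndex]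
    {J : ℕ → Submodule (ZMod p) (GA p Γ)} (hJ : Fil p V J) (C : Cx p J)
    {S : Type} [Fintype S] (s : S → Γ) (d : S → ℕ) (hd : ∀ i, 1 ≤ d i) (hs : ∀ i, s i ∈ hJ.D (d i))
    (q : Γ →* Γ') (hq : Function.Surjective q) (hk : q.ker = Subgroup.normalClosure (Set.range s)) :
    ∃ J', Fil p (V.map q) J' ∧ ∃ C' : Cx p J',
      C'.df = C.df - V.index * ∑ i, (3 / 4 : ℝ) ^ d i := by
  let π := pi p q
  let J' : ℕ → Submodule (ZMod p) (GA p Γ') := fun n => (J n).map π.toLinearMap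
  have hJ' : ∀ {n x}, x ∈ J n → π x ∈ J' n := fun hx => ⟨_, hx, rfl⟩
  have hkV : q.ker ≤ V := by
    rw [hk]
    refine Subgroup.normalClosure_le_normal ?_
    rintro _ ⟨i, rfl⟩
    exact (hs i).1
  have hF : Fil p (V.map q) J' := by
    refine ⟨?_, ?_, fun m n h => Submodule.map_mono (hJ.anti h), ?_, ?_, ?_⟩
    · simp only [J']
      rw [hJ.zero, AV, AV, Submodule.map_span]
      congr 1
      ext x
      constructor
      · rintro ⟨_, ⟨g, hg, rfl⟩, rfl⟩
        exact ⟨q g, ⟨g, hg, rfl⟩, (pi_e q g).symm⟩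
      · rintro ⟨_, ⟨g, hg, rfl⟩, rfl⟩
        exact ⟨_, ⟨g, hg, rfl⟩, pi_e q g⟩
    · simp only [J']
      rw [hJ.one, IV, IV, Submodule.map_span]
      congr 1
      ext x
      constructor
      · rintro ⟨_, ⟨g, hg, rfl⟩, rfl⟩
        exact ⟨q g, ⟨g, hg, rfl⟩, by simp [π, pi_e]⟩
      · rintro ⟨_, ⟨g, hg, rfl⟩, rfl⟩
        exact ⟨_, ⟨g, hg, rfl⟩, by simp [π, pi_e]⟩
    · rintro m n _ _ ⟨x, hx, rfl⟩ ⟨y, hy, rfl⟩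
      refine ⟨x * y, hJ.mul hx hy, by simp⟩
    · rintro g n _ ⟨x, hx, rfl⟩
      obtain ⟨h, rfl⟩ := hq g
      refine ⟨_, hJ.conj h hx, by simp [π, pi_e]⟩
    · rintro n _ ⟨x, hx, rfl⟩
      refine span_lin π.toLinearMap ?_ (hJ.gen n hx)
      rintro _ ⟨b, m, g, t, hb, hg, hgt, ht, hn, rfl⟩
      refine Submodule.subset_span ⟨π b, m, q g, t, hJ' hb, ⟨g, hg, rfl⟩, ?_, ht, hn, ?_⟩
      · have := hJ' hgt
        simpa [π, pi_e] using this
      · simp [π, pi_e]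
  refine ⟨J', hF, ?_⟩
  have : Fintype (Γ ⧸ V) := Fintype.ofFinite _
  let w : S × (Γ ⧸ V) → Γ := fun it => it.2.out * s it.1 * it.2.out⁻¹
  have hw : ∀ it, w it ∈ hJ.D (d it.1) := fun it => (hJ.D_normal _).conj_mem _ (hs _) _
  have hσ : ∀ it : S × (Γ ⧸ V), ∃ c : C.Y → GA p Γ, (∀ y, c y ∈ J (d it.1 - C.dY y)) ∧
      e p (w it) - 1 = ∑ y, c y * C.a y := by
    intro it
    have h1 := C.gen (d it.1 - 1) (e p (w it) - 1)
    rw [Nat.sub_add_cancel (hd _)] at h1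
    exact h1 (hw it).2
  choose σ hσ1 hσ2 using hσ
  let K : Submodule (ZMod p) (GA p Γ) := Submodule.span _ ({x | ∃ b ∈ J 0, ∃ it, x = b * (e p (w it) - 1)} ∪
    {x | ∃ n ∈ J 0, π n = 0 ∧ ∃ y, x = n * C.a y})
  have hKmul : ∀ b ∈ J 0, ∀ x ∈ K, b * x ∈ K := by
    intro b hb x hx
    refine span_mulL b ?_ hx
    rintro _ (⟨c, hc, it, rfl⟩ | ⟨n, hn, hn0, y, rfl⟩)
    · exact Submodule.subset_span (Or.inl ⟨b * c, hJ.mulL hb hc, it, by rw [mul_assoc]⟩)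
    · exact Submodule.subset_span (Or.inr ⟨b * n, hJ.mulL hb hn, by simp [hn0], y, by rw [mul_assoc]⟩)
  have hKM : ∀ m ∈ q.ker, e p m - 1 ∈ K := by
    intro m hm
    rw [hk, Subgroup.normalClosure] at hm
    refine (Subgroup.closure_induction (p := fun m _ => m ∈ q.ker ∧ e p m - 1 ∈ K) ?_ ?_ ?_ ?_ hm).2
    · intro x hx
      obtain ⟨_, ⟨i, rfl⟩, hc⟩ := Group.mem_conjugatesOfSet_iff.1 hx
      obtain ⟨g, rfl⟩ := isConj_iff.1 hc
      set t : Γ ⧸ V := QuotientGroup.mk g with ht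
      have hv : g * t.out⁻¹ ∈ V := by
        have h1 : (QuotientGroup.mk t.out : Γ ⧸ V) = QuotientGroup.mk g := by
          rw [QuotientGroup.out_eq']
        have h2 := QuotientGroup.eq.1 h1
        exact hVn.mem_comm h2
      set v := g * t.out⁻¹ with hvd
      have hm : w (i, t) ∈ q.ker := by
        have h1 : s i ∈ q.ker := by
          rw [hk]; exact Subgroup.subset_normalClosure ⟨i, rfl⟩
        exact (MonoidHom.normal_ker q).conj_mem _ h1 _
      have hwK : e p (w (i, t)) - 1 ∈ K :=
        Submodule.subset_span (Or.inl ⟨1, hJ.one_mem, (i, t), by rw [one_mul]⟩)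
      have hg : g * s i * g⁻¹ = v * w (i, t) * v⁻¹ := by
        simp only [w, hvd]; group
      rw [hg]
      refine ⟨(MonoidHom.normal_ker q).conj_mem _ hm _, ?_⟩
      have h3 : e p (v * w (i, t) * v⁻¹) - 1 =
          e p v * (e p (w (i, t)) - 1) * (e p v⁻¹ - 1) + e p v * (e p (w (i, t)) - 1) := by
        rw [map_mul, map_mul, mul_sub, mul_sub, sub_mul, mul_one, mul_one, e_mul_inv]
        abel
      rw [h3]
      refine Submodule.add_mem _ ?_ (hKmul _ (hJ.e_mem hv) _ hwK)
      obtain ⟨c, hc, hc2⟩ := C.gen 0 (e p v⁻¹ - 1) (hJ.sub_mem (V.inv_mem hv))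
      rw [hc2, Finset.mul_sum]
      refine Submodule.sum_mem _ fun y _ => Submodule.subset_span (Or.inr
        ⟨e p v * (e p (w (i, t)) - 1) * c y, ?_, ?_, y, by simp only [mul_assoc]⟩)
      · exact hJ.mulL (hJ.mulL (hJ.e_mem hv) (hJ.le0 _ (hw (i, t)).2)) (hJ.le0 _ (hc y))
      · simp [π, pi_e, MonoidHom.mem_ker.1 hm]
    · exact ⟨q.ker.one_mem, by simp⟩
    · rintro x y - - ⟨hx, hx'⟩ ⟨hy, hy'⟩
      refine ⟨q.ker.mul_mem hx hy, ?_⟩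
      have : e p (x * y) - 1 = e p x * (e p y - 1) + (e p x - 1) := by
        rw [map_mul]; noncomm_ring
      rw [this]
      exact Submodule.add_mem _ (hKmul _ (hJ.e_mem (hkV hx)) _ hy') hx'
    · rintro x - ⟨hx, hx'⟩
      refine ⟨q.ker.inv_mem hx, ?_⟩
      have : e p x⁻¹ - 1 = - (e p x⁻¹ * (e p x - 1)) := by
        rw [mul_sub, e_inv_mul]; noncomm_ring
      rw [this]
      exact Submodule.neg_mem _ (hKmul _ (hJ.e_mem (V.inv_mem (hkV hx))) _ hx')
  have hKrep : ∀ x ∈ K, ∃ (b : S × (Γ ⧸ V) → GA p Γ) (n : C.Y → GA p Γ), (∀ it, b it ∈ J 0) ∧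
      (∀ y, n y ∈ J 0 ∧ π (n y) = 0) ∧
      x = ∑ it, b it * (e p (w it) - 1) + ∑ y, n y * C.a y := by
    intro x hx
    refine Submodule.span_induction ?_ ?_ ?_ ?_ hx
    · rintro _ (⟨c, hc, it, rfl⟩ | ⟨n, hn, hn0, y, rfl⟩)
      · refine ⟨fun j => if j = it then c else 0, 0, fun j => ?_, fun y => ?_, by simp⟩
        · dsimp only; split_ifs; exacts [hc, Submodule.zero_mem _]
        · simp
      · refine ⟨0, fun j => if j = y then n else 0, fun j => ?_, fun y => ?_, by simp⟩
        · simp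
        · dsimp only; split_ifs; exacts [⟨hn, hn0⟩, ⟨Submodule.zero_mem _, map_zero _⟩]
    · exact ⟨0, 0, fun j => by simp, fun y => by simp, by simp⟩
    · rintro x y - - ⟨b, n, hb, hn, rfl⟩ ⟨b', n', hb', hn', rfl⟩
      refine ⟨fun i => b i + b' i, fun i => n i + n' i, fun i => Submodule.add_mem _ (hb i) (hb' i),
        fun i => ⟨Submodule.add_mem _ (hn i).1 (hn' i).1, by simp [hn, hn']⟩, ?_⟩
      simp only [add_mul, Finset.sum_add_distrib]; abel
    · rintro r x - ⟨b, n, hb, hn, rfl⟩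
      refine ⟨fun i => r • b i, fun i => r • n i, fun i => Submodule.smul_mem _ r (hb i),
        fun i => ⟨Submodule.smul_mem _ r (hn i).1, by simp [hn]⟩, ?_⟩
      simp only [smul_mul_assoc, ← Finset.smul_sum, smul_add]
  refine ⟨⟨C.Y, C.R ⊕ (S × (Γ ⧸ V)), inferInstance, inferInstance, C.dY,
    Sum.elim C.dR (fun it => d it.1), C.dY1, fun y => π (C.a y), fun y => hJ' (C.ha y), ?_,
    fun r y => π (Sum.elim (fun r => C.ρ r y) (fun it => σ it y) r), ?_, ?_⟩, ?_⟩
  · rintro n _ ⟨x, hx, rfl⟩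
    obtain ⟨c, hc, rfl⟩ := C.gen n x hx
    exact ⟨fun y => π (c y), fun y => hJ' (hc y), by simp⟩
  · rintro (r | it) y
    · exact hJ' (C.hρ r y)
    · exact hJ' (hσ1 it y)
  · intro c' hc' hsum
    choose c hc hcc using hc'
    have hc2 : ∀ y, c' y = π (c y) := fun y => (hcc y).symm
    have hz0 : ∑ y, c y * C.a y ∈ AV p V := by
      rw [← hJ.zero]
      exact Submodule.sum_mem _ fun y _ => hJ.mulR (hc y) (hJ.le0 _ (C.ha y))
    have hz1 := ker_pi q hq hkV hz0 (by
      rw [← hsum, map_sum]; simp only [map_mul, hc2]; rfl)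
    have hz2 : ∑ y, c y * C.a y ∈ K := by
      refine Submodule.span_le.2 ?_ hz1
      rintro _ ⟨v, hv, n, hn, rfl⟩
      exact hKmul _ (hJ.e_mem hv) _ (hKM n hn)
    obtain ⟨b, n, hb, hn, hbn⟩ := hKrep _ hz2
    obtain ⟨β, hβ, hβ2⟩ := C.rel (fun y => c y - (∑ it, b it * σ it y) - n y) (fun y =>
      Submodule.sub_mem _ (Submodule.sub_mem _ (hc y) (Submodule.sum_mem _ fun it _ =>
        hJ.mulR (hb it) (hJ.le0 _ (hσ1 it y)))) (hn y).1) (by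
      simp only [sub_mul, Finset.sum_sub_distrib, hbn, hσ2, Finset.mul_sum, Finset.sum_mul]
      rw [Finset.sum_comm]; simp only [mul_assoc]; abel)
    refine ⟨fun r => π (Sum.elim β b r), ?_, ?_⟩
    · rintro (r | it)
      · exact hJ' (hβ r)
      · exact hJ' (hb it)
    · intro y
      have h5 := congrArg π (hβ2 y)
      simp only [map_sub, (hn y).2, sub_zero, map_sum, map_mul] at h5
      rw [Fintype.sum_sum_type]
      simp only [Sum.elim_inl, Sum.elim_inr]
      rw [← h5, hc2]; abel
  · simp only [Cx.df]
    rw [Fintype.sum_sum_type, Fintype.sum_prod_type]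
    simp only [Sum.elim_inl, Sum.elim_inr, Finset.sum_const, Finset.card_univ, nsmul_eq_mul]
    rw [← Finset.mul_sum, Subgroup.index, Nat.card_eq_fintype_card]
    ring
end

end Piece4

section Piece5
open scoped Classical commutatorElement

section
variable {p : ℕ} {Γ : Type} [Group Γ]

noncomputable def RepS {Y : Type} [Fintype Y] (P : Y → Submodule (ZMod p) (GA p Γ)) (a : Y → GA p Γ) :
    Submodule (ZMod p) (GA p Γ) where
  carrier := {x | ∃ c : Y → GA p Γ, (∀ y, c y ∈ P y) ∧ x = ∑ y, c y * a y}
  add_mem' := by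
    rintro x y ⟨c, hc, rfl⟩ ⟨d, hd, rfl⟩
    exact ⟨fun y => c y + d y, fun y => Submodule.add_mem _ (hc y) (hd y), by
      simp only [add_mul, Finset.sum_add_distrib]⟩
  zero_mem' := ⟨0, fun y => Submodule.zero_mem _, by simp⟩
  smul_mem' := by
    rintro r x ⟨c, hc, rfl⟩
    exact ⟨fun y => r • c y, fun y => Submodule.smul_mem _ r (hc y), by
      simp only [smul_mul_assoc, Finset.smul_sum]⟩

inductive ScP (J : ℕ → Submodule (ZMod p) (GA p Γ)) (k : ℕ) : ℕ → GA p Γ → Prop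
  | nil {b} : b ∈ J 0 → ScP J k 0 b
  | cons {m x s y} : ScP J k m x → 1 ≤ s → y ∈ J s → ScP J k (m + s + k) (x * y)

theorem scale {V : Subgroup Γ} {J : ℕ → Submodule (ZMod p) (GA p Γ)} (hJ : Fil p V J) (C : Cx p J)
    (k : ℕ) : ∃ J', Fil p V J' ∧ (∀ n, 1 ≤ n → J n ≤ J' (n + k)) ∧ ∃ C' : Cx p J',
      C'.df = (3 / 4 : ℝ) ^ k * (1 + C.df) - 1 := by
  let J' : ℕ → Submodule (ZMod p) (GA p Γ) := fun n =>
    Submodule.span (ZMod p) {x | ∃ m, n ≤ m ∧ ScP J k m x}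
  have sub : ∀ {n m x}, n ≤ m → ScP J k m x → x ∈ J' n := fun h hx =>
    Submodule.subset_span ⟨_, h, hx⟩
  have S0 : ∀ {m x}, ScP J k m x → x ∈ J 0 := by
    intro m x hx
    induction hx with
    | nil h => exact h
    | cons _ _ h ih => exact hJ.mulR ih (hJ.le0 _ h)
  have S1 : ∀ {m x}, ScP J k m x → 1 ≤ m → x ∈ J 1 := by
    intro m x hx hm
    cases hx with
    | nil h => omega
    | cons h1 h2 h3 => exact hJ.mulL (S0 h1) (hJ.anti h2 h3)
  have Smul0 : ∀ {m x b}, ScP J k m x → b ∈ J 0 → ScP J k m (x * b) := by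
    intro m x b hx hb
    cases hx with
    | nil h => exact ScP.nil (hJ.mulL h hb)
    | cons h1 h2 h3 => rw [mul_assoc]; exact ScP.cons h1 h2 (hJ.mulR h3 hb)
  have Smul : ∀ {m x n y}, ScP J k m x → ScP J k n y → ScP J k (m + n) (x * y) := by
    intro m x n y hx hy
    induction hy with
    | nil h => exact Smul0 hx h
    | cons _ h2 h3 ih => 
      have := ScP.cons ih h2 h3
      rw [mul_assoc] at this
      convert this using 1; ring
  have Sconj : ∀ g {m x}, ScP J k m x → ScP J k m (e p g * x * e p g⁻¹) := by
    intro g m x hx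
    induction hx with
    | nil h => exact ScP.nil (hJ.conj g h)
    | @cons m x s y _ h2 h3 ih =>
      have := ScP.cons ih h2 (hJ.conj g h3)
      convert this using 1
      simp only [mul_assoc, e_inv_mul_assoc]
  have Sone : ∀ {s y}, 1 ≤ s → y ∈ J s → ScP J k (s + k) y := by
    intro s y hs hy
    have := ScP.cons (k := k) (ScP.nil hJ.one_mem) hs hy
    rwa [one_mul, zero_add] at this
  have JJ : ∀ n, 1 ≤ n → J n ≤ J' (n + k) := fun n hn x hx => sub le_rfl (Sone hn hx)
  have J0 : J' 0 = J 0 := by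
    refine le_antisymm (Submodule.span_le.2 ?_) fun x hx => sub le_rfl (ScP.nil hx)
    rintro x ⟨m, -, hx⟩; exact S0 hx
  have Janti : Antitone J' := fun m n h =>
    Submodule.span_mono (by rintro x ⟨l, hl, hx⟩; exact ⟨l, h.trans hl, hx⟩)
  have JJ' : ∀ n, J n ≤ J' n := by
    intro n
    rcases Nat.eq_zero_or_pos n with rfl | hn
    · rw [J0]
    · exact (JJ n hn).trans (Janti (by omega))
  have Jmul : ∀ {m n x y}, x ∈ J' m → y ∈ J' n → x * y ∈ J' (m + n) := by
    intro m n x y hx hy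
    refine span_mul_mem ?_ hx hy
    rintro x ⟨m', hm, hx⟩ y ⟨n', hn, hy⟩
    exact sub (by omega) (Smul hx hy)
  have hF : Fil p V J' := by
    refine ⟨J0.trans hJ.zero, ?_, Janti, Jmul, ?_, ?_⟩
    · rw [← hJ.one]
      refine le_antisymm (Submodule.span_le.2 ?_) (JJ' 1)
      rintro x ⟨m, hm, hx⟩; exact S1 hx hm
    · intro g n x hx
      refine span_lin ((LinearMap.mulRight (ZMod p) (e p g⁻¹)).comp
        (LinearMap.mulLeft (ZMod p) (e p g))) ?_ hx
      rintro x ⟨m, hm, hx⟩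
      exact sub hm (Sconj g hx)
    · intro n
      refine Submodule.span_le.2 ?_
      rintro x ⟨m, hm, hx⟩
      cases hx with
      | nil h => omega
      | @cons m x s y h1 h2 h3 =>
        have h4 := hJ.gen (s - 1)
        rw [Nat.sub_add_cancel h2] at h4
        refine span_mulL x ?_ (h4 h3)
        rintro _ ⟨b, s', g, t, hb, hg, hgt, ht, hst, rfl⟩
        rw [← mul_assoc]
        rcases Nat.eq_zero_or_pos s' with rfl | hs'
        · exact Submodule.subset_span ⟨x * b, m, g, t + k, sub le_rfl (Smul0 h1 hb), hg, JJ t ht hgt,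
            by omega, by omega, rfl⟩
        · exact Submodule.subset_span ⟨x * b, m + s' + k, g, t + k, sub le_rfl (ScP.cons h1 hs' hb), hg,
            JJ t ht hgt, by omega, by omega, rfl⟩
  refine ⟨J', hF, JJ, ⟨C.Y, C.R, inferInstance, inferInstance, fun y => C.dY y + k,
    fun r => C.dR r + k, fun y => (C.dY1 y).trans (Nat.le_add_right _ _), C.a,
    fun y => JJ _ (C.dY1 y) (C.ha y), ?_, C.ρ, ?_, ?_⟩, ?_⟩
  · intro n x hx
    have : J' (n + 1) ≤ RepS (fun y => J' (n + 1 - (C.dY y + k))) C.a := by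
      refine Submodule.span_le.2 ?_
      rintro x ⟨m, hm, hx⟩
      cases hx with
      | nil h => omega
      | @cons m x s y h1 h2 h3 =>
        have h4 := C.gen (s - 1)
        rw [Nat.sub_add_cancel h2] at h4
        obtain ⟨c, hc, rfl⟩ := h4 _ h3
        refine ⟨fun y => x * c y, fun y => ?_, ?_⟩
        · have h5 := Jmul (sub le_rfl h1) (JJ' _ (hc y))
          exact Janti (by omega) h5
        · rw [Finset.mul_sum]; simp only [mul_assoc]
    exact this hx
  · intro r y
    rw [Nat.add_sub_add_right]
    exact JJ' _ (C.hρ r y)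
  · rw [J0]; exact C.rel
  · simp only [Cx.df, pow_add, ← Finset.sum_mul]
    ring
end

end Piece5

section Piece6
open scoped Classical commutatorElement

section
variable {p : ℕ} {Γ : Type} [Group Γ]

noncomputable def prj (p : ℕ) (S : Set Γ) : GA p Γ →ₗ[ZMod p] GA p Γ :=
  (Finsupp.linearCombination (ZMod p) (fun g => if g ∈ S then e p g else 0)).comp
    (MonoidAlgebra.coeffLinearEquiv (ZMod p)).toLinearMap

theorem prj_e (S : Set Γ) (g : Γ) : prj p S (e p g) = if g ∈ S then e p g else 0 := by
  simp [prj, e]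

variable (p) in
structure Sch (V V' : Subgroup Γ) (J : ℕ → Submodule (ZMod p) (GA p Γ)) (u : Γ) (a : ℕ) : Prop where
  hJ : Fil p V J
  le : V' ≤ V
  nor : V'.Normal
  hu : u ∈ V
  cos : ∀ g ∈ V, ∃ g' ∈ V', ∃ c : ℕ, g = g' * u ^ c
  unq : ∀ j, 0 < j → j < p → u ^ j ∉ V'
  upow : u ^ p ∈ V'
  a1 : 1 ≤ a
  ha : ∀ g ∈ V, e p g - 1 ∈ J a
  hD : ∀ g ∈ V, e p g - 1 ∈ J (a + 1) → g ∈ V'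

noncomputable def eta (p : ℕ) (u : Γ) : GA p Γ := e p u - 1

/-- filtration by cosets -/
noncomputable def FC (p : ℕ) (V' : Subgroup Γ) (u : Γ) (i : ℕ) : Submodule (ZMod p) (GA p Γ) :=
  Submodule.span (ZMod p) {x | ∃ v ∈ V', ∃ j < i, x = e p (v * u ^ j)}

theorem FC_mono (V' : Subgroup Γ) (u : Γ) {i j : ℕ} (h : i ≤ j) : FC p V' u i ≤ FC p V' u j :=
  Submodule.span_mono (by rintro x ⟨v, hv, k, hk, rfl⟩; exact ⟨v, hv, k, hk.trans_le h, rfl⟩)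

theorem FC_eta (V' : Subgroup Γ) (u : Γ) {i : ℕ} {x : GA p Γ} (hx : x ∈ FC p V' u i) :
    x * eta p u ∈ FC p V' u (i + 1) := by
  refine span_mulR _ ?_ hx
  rintro x ⟨v, hv, j, hj, rfl⟩
  rw [eta, mul_sub, mul_one, ← map_mul, mul_assoc, ← pow_succ]
  exact Submodule.sub_mem _ (Submodule.subset_span ⟨v, hv, j + 1, by omega, rfl⟩)
    (Submodule.subset_span ⟨v, hv, j, by omega, rfl⟩)

theorem FC_lead (V' : Subgroup Γ) (u : Γ) {q : GA p Γ} (hq : q ∈ AV p V') (i : ℕ) :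
    q * eta p u ^ i - q * e p u ^ i ∈ FC p V' u i := by
  induction i with
  | zero => simp
  | succ i ih =>
    have h1 := FC_eta V' u ih
    have h2 : q * e p u ^ i ∈ FC p V' u (i + 1) := by
      refine span_mulR _ ?_ hq
      rintro _ ⟨v, hv, rfl⟩
      rw [← map_pow, ← map_mul]
      exact Submodule.subset_span ⟨v, hv, i, by omega, rfl⟩
    have h3 := Submodule.sub_mem _ h1 h2
    convert h3 using 1
    rw [pow_succ, pow_succ]; simp only [eta]; noncomm_ring

namespace Sch
variable {V V' : Subgroup Γ} {J : ℕ → Submodule (ZMod p) (GA p Γ)} {u : Γ} {a : ℕ}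
  (hS : Sch p V V' J u a)
include hS

theorem indep {q : ℕ → GA p Γ} (hq : ∀ j, q j ∈ AV p V') (m : ℕ) (hm : m ≤ p)
    (h : ∑ j ∈ Finset.range m, q j * eta p u ^ j = 0) : ∀ j < m, q j = 0 := by
  induction m with
  | zero => intro j hj; omega
  | succ m ih =>
    rw [Finset.sum_range_succ] at h
    have h1 : ∑ j ∈ Finset.range m, q j * eta p u ^ j ∈ FC p V' u m := by
      refine Submodule.sum_mem _ fun j hj => ?_
      have h2 := FC_mono V' u (Finset.mem_range.1 hj).le (FC_lead V' u (hq j) j)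
      have h3 : q j * e p u ^ j ∈ FC p V' u m := by
        refine span_mulR _ ?_ (hq j)
        rintro _ ⟨v, hv, rfl⟩
        rw [← map_pow, ← map_mul]
        exact Submodule.subset_span ⟨v, hv, j, Finset.mem_range.1 hj, rfl⟩
      have := Submodule.add_mem _ h2 h3
      rwa [sub_add_cancel] at this
    have h2 : q m * e p u ^ m ∈ FC p V' u m := by
      have h3 := Submodule.neg_mem _ (Submodule.add_mem _ h1 (FC_lead V' u (hq m) m))
      convert h3 using 1
      rw [← sub_eq_zero]
      calc _ = (∑ j ∈ Finset.range m, q j * eta p u ^ j) + q m * eta p u ^ m := by abel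
        _ = 0 := h
    let S : Set Γ := {g | g * (u ^ m)⁻¹ ∈ V'}
    have h3 : prj p S (q m * e p u ^ m) = 0 := by
      have : prj p S (q m * e p u ^ m) ∈ (⊥ : Submodule (ZMod p) (GA p Γ)) := by
        refine span_lin _ ?_ h2
        rintro _ ⟨v, hv, j, hj, rfl⟩
        rw [prj_e, if_neg]
        · exact Submodule.zero_mem _
        · intro h4
          have h5 : (v * u ^ j * (u ^ m)⁻¹)⁻¹ * v ∈ V' := V'.mul_mem (V'.inv_mem h4) hv
          have h6 : (v * u ^ j * (u ^ m)⁻¹)⁻¹ * v = u ^ (m - j) := by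
            rw [pow_sub _ hj.le]; group
          exact hS.unq (m - j) (by omega) (by omega) (h6 ▸ h5)
      simpa using this
    have h4 : prj p S (q m * e p u ^ m) = q m * e p u ^ m := by
      rw [← sub_eq_zero]
      have : ((prj p S).comp (LinearMap.mulRight (ZMod p) (e p u ^ m)) -
          LinearMap.mulRight (ZMod p) (e p u ^ m)) (q m) ∈ (⊥ : Submodule (ZMod p) (GA p Γ)) := by
        refine span_lin _ ?_ (hq m)
        rintro _ ⟨v, hv, rfl⟩
        simp only [LinearMap.sub_apply, LinearMap.comp_apply, LinearMap.mulRight_apply]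
        rw [← map_pow, ← map_mul, prj_e, if_pos]
        · simp
        · change _ ∈ V'; simpa using hv
      simpa using this
    rw [h3] at h4
    have h5 : q m = 0 := by
      have h6 := congrArg (· * e p (u ^ m)⁻¹) h4
      simp only [zero_mul] at h6
      rw [← map_pow, mul_assoc, e_mul_inv, mul_one] at h6
      exact h6.symm
    intro j hj
    rcases Nat.lt_succ_iff_lt_or_eq.1 hj with h7 | rfl
    · refine ih (by omega) ?_ j h7
      rwa [h5, zero_mul, add_zero] at h
    · exact h5

omit hS in
variable (p V' J) in
noncomputable def Q (n : ℕ) : Submodule (ZMod p) (GA p Γ) :=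
  Submodule.span (ZMod p) ({z | ∃ b s g t, b ∈ J s ∧ b ∈ AV p V' ∧ g ∈ V' ∧ e p g - 1 ∈ J t ∧
    1 ≤ t ∧ n ≤ s + t ∧ z = b * (e p g - 1)} ∪ {z | n = 0 ∧ ∃ g ∈ V', z = e p g})

theorem mkQ {n b s g t} (h1 : b ∈ J s) (h2 : b ∈ AV p V') (h3 : g ∈ V') (h4 : e p g - 1 ∈ J t)
    (h5 : 1 ≤ t) (h6 : n ≤ s + t) : b * (e p g - 1) ∈ Q p V' J n :=
  Submodule.subset_span (Or.inl ⟨b, s, g, t, h1, h2, h3, h4, h5, h6, rfl⟩)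

theorem mkQ0 {g} (h3 : g ∈ V') : e p g ∈ Q p V' J 0 :=
  Submodule.subset_span (Or.inr ⟨rfl, g, h3, rfl⟩)

theorem Q1 {g t} (h3 : g ∈ V') (h4 : e p g - 1 ∈ J t) (ht : 1 ≤ t) : e p g - 1 ∈ Q p V' J t := by
  have := hS.mkQ (n := t) hS.hJ.one_mem (one_mem_AV V') h3 h4 ht (by omega)
  rwa [one_mul] at this

theorem Q_le (n) : Q p V' J n ≤ J n ⊓ AV p V' := by
  refine Submodule.span_le.2 ?_
  rintro _ (⟨b, s, g, t, h1, h2, h3, h4, h5, h6, rfl⟩ | ⟨rfl, g, hg, rfl⟩)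
  · exact ⟨hS.hJ.anti h6 (hS.hJ.mul h1 h4), AV_mul h2 (Submodule.sub_mem _ (e_mem_AV h3) (one_mem_AV _))⟩
  · exact ⟨hS.hJ.e_mem (hS.le hg), e_mem_AV hg⟩

theorem Q_anti : Antitone (Q p V' J) := by
  intro m n h
  refine Submodule.span_le.2 ?_
  rintro _ (⟨b, s, g, t, h1, h2, h3, h4, h5, h6, rfl⟩ | ⟨rfl, g, hg, rfl⟩)
  · exact hS.mkQ h1 h2 h3 h4 h5 (h.trans h6)
  · obtain rfl : m = 0 := by omega
    exact hS.mkQ0 hg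

theorem conjE {n} (g : Γ) {h : Γ} (hh : e p h - 1 ∈ J n) : e p (g * h * g⁻¹) - 1 ∈ J n := by
  have := hS.hJ.conj g hh
  rwa [mul_sub, sub_mul, mul_one, e_mul_inv, ← map_mul, ← map_mul] at this

theorem Q_mul {m n x y} (hx : x ∈ Q p V' J m) (hy : y ∈ Q p V' J n) : x * y ∈ Q p V' J (m + n) := by
  have hx' := hS.Q_le m hx
  refine span_mulL _ ?_ hy
  rintro _ (⟨b, s, g, t, h1, h2, h3, h4, h5, h6, rfl⟩ | ⟨rfl, g, hg, rfl⟩)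
  · rw [← mul_assoc]
    exact hS.mkQ (hS.hJ.mul hx'.1 h1) (AV_mul hx'.2 h2) h3 h4 h5 (by omega)
  · refine span_mulR _ ?_ hx
    rintro _ (⟨b, s, h, t, h1, h2, h3, h4, h5, h6, rfl⟩ | ⟨rfl, h, hh, rfl⟩)
    · have : b * (e p h - 1) * e p g = b * e p g * (e p (g⁻¹ * h * g⁻¹⁻¹) - 1) := by
        rw [map_mul, map_mul, inv_inv, mul_sub, mul_sub, sub_mul]
        simp only [mul_assoc, e_mul_inv_assoc, mul_one]
      rw [this]
      exact hS.mkQ (hS.hJ.mulR h1 (hS.hJ.e_mem (hS.le hg))) (AV_mul h2 (e_mem_AV hg))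
        (hS.nor.conj_mem _ h3 _) (hS.conjE _ h4) h5 (by omega)
    · rw [← map_mul]; exact hS.mkQ0 (V'.mul_mem hh hg)

theorem Q_conj {m x} (g : Γ) (hx : x ∈ Q p V' J m) : e p g * x * e p g⁻¹ ∈ Q p V' J m := by
  have := hS.nor
  refine span_lin ((LinearMap.mulRight (ZMod p) (e p g⁻¹)).comp (LinearMap.mulLeft (ZMod p) (e p g)))
    ?_ hx
  rintro _ (⟨b, s, h, t, h1, h2, h3, h4, h5, h6, rfl⟩ | ⟨rfl, h, hh, rfl⟩)
  · have : e p g * (b * (e p h - 1)) * e p g⁻¹ =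
        (e p g * b * e p g⁻¹) * (e p (g * h * g⁻¹) - 1) := by
      rw [map_mul, map_mul, mul_sub, mul_sub, mul_sub, sub_mul]
      simp only [mul_assoc, e_inv_mul_assoc, mul_one]
    change e p g * (b * (e p h - 1)) * e p g⁻¹ ∈ _
    rw [this]
    exact hS.mkQ (hS.hJ.conj g h1) (AV_conj g h2) (hS.nor.conj_mem _ h3 _) (hS.conjE _ h4) h5 h6
  · change e p g * e p h * e p g⁻¹ ∈ _
    rw [← map_mul, ← map_mul]
    exact hS.mkQ0 (hS.nor.conj_mem _ hh _)

theorem comm_mem {g t} (hg : g ∈ V') (ht : e p g - 1 ∈ J t) :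
    ⁅u, g⁆ ∈ V' ∧ e p ⁅u, g⁆ - 1 ∈ J (a + t) := by
  refine ⟨?_, (hS.hJ.D_comm (m := a) (n := t) ⟨hS.hu, hS.ha _ hS.hu⟩ ⟨hS.le hg, ht⟩).2⟩
  rw [commutatorElement_def]
  exact V'.mul_mem (hS.nor.conj_mem _ hg _) (V'.inv_mem hg)

theorem Q_theta {m x} (hx : x ∈ Q p V' J m) : e p u * x * e p u⁻¹ - x ∈ Q p V' J (m + a) := by
  have := hS.nor
  have hcomm : ∀ g : Γ, e p (u * g * u⁻¹) - e p g = (e p ⁅u, g⁆ - 1) * e p g := by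
    intro g; rw [sub_mul, one_mul, ← map_mul, commutatorElement_def]; simp
  refine span_lin ((LinearMap.mulRight (ZMod p) (e p u⁻¹)).comp (LinearMap.mulLeft (ZMod p) (e p u))
    - LinearMap.id) ?_ hx
  simp only [LinearMap.sub_apply, LinearMap.comp_apply, LinearMap.mulRight_apply,
    LinearMap.mulLeft_apply, LinearMap.id_apply]
  rintro _ (⟨b, s, g, t, h1, h2, h3, h4, h5, h6, rfl⟩ | ⟨rfl, g, hg, rfl⟩)
  · have e1 : e p u * (b * (e p g - 1)) * e p u⁻¹ - b * (e p g - 1) =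
        (e p u * b * e p u⁻¹ - b) * (e p (u * g * u⁻¹) - 1) + b * (e p ⁅u, g⁆ - 1) * e p g := by
      rw [mul_assoc b, ← hcomm, map_mul, map_mul]
      simp only [mul_sub, sub_mul, mul_assoc, e_inv_mul_assoc, mul_one, one_mul]
      abel
    rw [e1]
    refine Submodule.add_mem _ ?_ ?_
    · refine hS.mkQ (s := a + s) ?_ ?_ (hS.nor.conj_mem _ h3 _) (hS.conjE _ h4) h5 (by omega)
      · have e2 : e p u * b * e p u⁻¹ - b = ((e p u - 1) * b - b * (e p u - 1)) * e p u⁻¹ := by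
          simp only [mul_sub, sub_mul, mul_assoc, e_mul_inv, mul_one, one_mul]; abel
        rw [e2]
        refine hS.hJ.mulR (Submodule.sub_mem _ (hS.hJ.mul (hS.ha _ hS.hu) h1) ?_)
          (hS.hJ.e_mem (V.inv_mem hS.hu))
        rw [add_comm]; exact hS.hJ.mul h1 (hS.ha _ hS.hu)
      · exact Submodule.sub_mem _ (AV_conj u h2) h2
    · obtain ⟨c1, c2⟩ := hS.comm_mem h3 h4
      have := hS.Q_mul (hS.mkQ (n := m + a) h1 h2 c1 c2 (by omega) (by omega)) (hS.mkQ0 h3)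
      exact this
  · rw [← map_mul, ← map_mul, hcomm]
    obtain ⟨c1, c2⟩ := hS.comm_mem hg (hS.hJ.sub_mem (hS.le hg))
    have := hS.Q_mul (hS.Q_anti (Nat.le_add_right a 1) (hS.Q1 c1 c2 (by omega))) (hS.mkQ0 hg)
    rwa [zero_add]

omit hS in
variable (p V' J u a) in
noncomputable def LL (n : ℕ) : Submodule (ZMod p) (GA p Γ) :=
  Submodule.span (ZMod p) {z | ∃ q m j, q ∈ Q p V' J m ∧ n ≤ m + j * a ∧ z = q * eta p u ^ j}

theorem mkL {n q m j} (h1 : q ∈ Q p V' J m) (h2 : n ≤ m + j * a) :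
    q * eta p u ^ j ∈ LL p V' J u a n := Submodule.subset_span ⟨q, m, j, h1, h2, rfl⟩

theorem Q_le_L (n) : Q p V' J n ≤ LL p V' J u a n := by
  intro x hx
  have := hS.mkL (n := n) (j := 0) hx (by omega)
  simpa using this

theorem L_anti : Antitone (LL p V' J u a) := by
  intro m n h
  refine Submodule.span_mono ?_
  rintro _ ⟨q, m', j, h1, h2, rfl⟩
  exact ⟨q, m', j, h1, h.trans h2, rfl⟩

theorem one_Q : (1 : GA p Γ) ∈ Q p V' J 0 := by
  have := hS.mkQ0 V'.one_mem; rwa [map_one] at this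

theorem eta_L : eta p u ∈ LL p V' J u a a := by
  have := hS.mkL (n := a) (j := 1) hS.one_Q (by omega)
  simpa using this

theorem eta_mul_L {n x} (hx : x ∈ LL p V' J u a n) : eta p u * x ∈ LL p V' J u a (n + a) := by
  refine span_mulL _ ?_ hx
  rintro _ ⟨q, m', j, h1, h2, rfl⟩
  have : eta p u * (q * eta p u ^ j) = (e p u * q * e p u⁻¹) * eta p u ^ (j + 1) +
      (e p u * q * e p u⁻¹ - q) * eta p u ^ j := by
    rw [pow_succ', ← mul_assoc, ← mul_assoc, ← add_mul]
    congr 1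
    simp only [eta, mul_sub, sub_mul, mul_assoc, e_inv_mul, mul_one, one_mul]; abel
  rw [this]
  refine Submodule.add_mem _ (hS.mkL (hS.Q_conj u h1) ?_) (hS.mkL (hS.Q_theta h1) (by omega))
  rw [add_mul]; omega

theorem L_mul {m n x y} (hx : x ∈ LL p V' J u a m) (hy : y ∈ LL p V' J u a n) :
    x * y ∈ LL p V' J u a (m + n) := by
  refine span_mulR _ ?_ hx
  rintro _ ⟨q, m', j, h1, h2, rfl⟩
  have h3 : ∀ j, eta p u ^ j * y ∈ LL p V' J u a (n + j * a) := by
    intro j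
    induction j with
    | zero => simpa using hy
    | succ j ih =>
      have := hS.eta_mul_L ih
      have e1 : n + (j + 1) * a = n + j * a + a := by ring
      rw [pow_succ', mul_assoc, e1]
      exact this
  rw [mul_assoc]
  refine span_mulL _ ?_ (h3 j)
  rintro _ ⟨q', m'', i, h4, h5, rfl⟩
  rw [← mul_assoc]
  exact hS.mkL (hS.Q_mul h1 h4) (by omega)

theorem e_pow_L (c : ℕ) : e p (u ^ c) ∈ LL p V' J u a 0 := by
  induction c with
  | zero => rw [pow_zero, map_one]; exact hS.Q_le_L 0 hS.one_Q
  | succ c ih =>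
    rw [pow_succ, map_mul]
    have h : e p u = eta p u + 1 := by simp [eta]
    rw [h]
    have h2 : eta p u + 1 ∈ LL p V' J u a 0 := Submodule.add_mem _
      (hS.L_anti (Nat.zero_le a) hS.eta_L) (hS.Q_le_L 0 hS.one_Q)
    have h3 := hS.L_mul ih h2
    rwa [add_zero] at h3

theorem e_sub_L (c : ℕ) : e p (u ^ c) - 1 ∈ LL p V' J u a a := by
  induction c with
  | zero => simp
  | succ c ih =>
    have : e p (u ^ (c + 1)) - 1 = e p (u ^ c) * eta p u + (e p (u ^ c) - 1) := by
      rw [pow_succ, map_mul, eta]; noncomm_ring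
    rw [this]
    refine Submodule.add_mem _ ?_ ih
    have := hS.L_mul (hS.e_pow_L c) hS.eta_L
    rwa [zero_add] at this

theorem V_sub_L {g} (hg : g ∈ V) : e p g - 1 ∈ LL p V' J u a a := by
  obtain ⟨g', hg', c, rfl⟩ := hS.cos g hg
  have : e p (g' * u ^ c) - 1 = e p g' * (e p (u ^ c) - 1) + (e p g' - 1) := by
    rw [map_mul]; noncomm_ring
  rw [this]
  refine Submodule.add_mem _ ?_ (hS.Q_le_L a (hS.Q1 hg' (hS.ha _ (hS.le hg')) hS.a1))
  have := hS.L_mul (hS.Q_le_L 0 (hS.mkQ0 hg')) (hS.e_sub_L c)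
  rwa [zero_add] at this

theorem J_le_L (n) : J n ≤ LL p V' J u a n := by
  induction n using Nat.strong_induction_on with
  | _ n ih =>
  rcases n with _ | n
  · rw [hS.hJ.zero]
    refine Submodule.span_le.2 ?_
    rintro _ ⟨g, hg, rfl⟩
    have := Submodule.add_mem _ (hS.L_anti (Nat.zero_le a) (hS.V_sub_L hg)) (hS.Q_le_L 0 hS.one_Q)
    simpa using this
  · refine (hS.hJ.gen n).trans (Submodule.span_le.2 ?_)
    rintro _ ⟨b, s, g, t, hb, hg, hgt, ht, hst, rfl⟩
    have hb' : b ∈ LL p V' J u a (min s n) :=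
      ih _ (by omega) (hS.hJ.anti (min_le_left _ _) hb)
    have hg' : e p g - 1 ∈ LL p V' J u a t := by
      by_cases h : g ∈ V'
      · exact hS.Q_le_L t (hS.Q1 h hgt ht)
      · have : t ≤ a := by
          by_contra h2
          exact h (hS.hD g hg (hS.hJ.anti (by omega) hgt))
        exact hS.L_anti this (hS.V_sub_L hg)
    exact hS.L_anti (by omega) (hS.L_mul hb' hg')

theorem eta_p [Fact p.Prime] : eta p u ^ p ∈ Q p V' J (p * a) := by
  have h1 := e_sub_pow (p := p) u 1
  rw [pow_one] at h1
  have h2 : e p (u ^ p) - 1 ∈ J (p * a) := by rw [h1]; exact hS.hJ.pow (hS.ha _ hS.hu) p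
  rw [eta, ← h1]
  exact hS.Q1 hS.upow h2 (Nat.mul_pos (Fact.out : p.Prime).pos hS.a1)

theorem L_le [Fact p.Prime] (n) : LL p V' J u a n ≤
    RepS (fun j : Fin p => Q p V' J (n - j * a)) (fun j : Fin p => eta p u ^ (j : ℕ)) := by
  refine Submodule.span_le.2 ?_
  rintro _ ⟨q, m, j, h1, h2, rfl⟩
  induction j using Nat.strong_induction_on generalizing q m with
  | _ j ih =>
  by_cases hj : j < p
  · refine ⟨fun i => if i = ⟨j, hj⟩ then q else 0, fun i => ?_, ?_⟩
    · dsimp only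
      split_ifs with h
      · subst h; exact hS.Q_anti (by simp only; omega) h1
      · exact Submodule.zero_mem _
    · simp
  · have e1 : q * eta p u ^ j = (q * eta p u ^ p) * eta p u ^ (j - p) := by
      rw [mul_assoc, ← pow_add]; congr 2; omega
    rw [e1]
    have hp := (Fact.out : p.Prime).pos
    refine ih (j - p) (by omega) _ _ (hS.Q_mul h1 hS.eta_p) ?_
    have : j * a = p * a + (j - p) * a := by rw [← add_mul]; congr 1; omega
    omega

theorem exists_coord [Fact p.Prime] (n) {x} (hx : x ∈ J n) :
    ∃ c : Fin p → GA p Γ, (∀ j : Fin p, c j ∈ J (n - j * a) ⊓ AV p V') ∧ x = ∑ j, c j * eta p u ^ (j : ℕ) := by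
  obtain ⟨c, hc, hx⟩ := hS.L_le n (hS.J_le_L n hx)
  exact ⟨c, fun j => hS.Q_le _ (hc j), hx⟩

theorem indep' {q r : Fin p → GA p Γ} (hq : ∀ j, q j ∈ AV p V') (hr : ∀ j, r j ∈ AV p V')
    (h : ∑ j, q j * eta p u ^ (j : ℕ) = ∑ j, r j * eta p u ^ (j : ℕ)) : q = r := by
  have := hS.indep (q := fun j => if h : j < p then q ⟨j, h⟩ - r ⟨j, h⟩ else 0)
    (by intro j; split_ifs
        · exact Submodule.sub_mem _ (hq _) (hr _)
        · exact Submodule.zero_mem _) p le_rfl (by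
      rw [Finset.sum_range]
      simp only [Fin.is_lt, dite_true, sub_mul, Finset.sum_sub_distrib]
      rw [h, sub_self])
  ext1 j
  have h2 := this j j.2
  simpa [sub_eq_zero] using h2

theorem fil [Fact p.Prime] : Fil p V' (fun n => J n ⊓ AV p V') := by
  have := hS.nor
  refine ⟨?_, ?_, ?_, ?_, ?_, ?_⟩
  · rw [hS.hJ.zero]; exact inf_eq_right.2 (AV_mono hS.le)
  · refine le_antisymm ?_ (le_inf ?_ (IV_le_AV V'))
    · rintro x ⟨h1, h2⟩
      obtain ⟨c, hc⟩ := AV_sub_IV V' h2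
      rw [hS.hJ.one] at h1
      have h3 := Submodule.sub_mem _ h1 (IV_mono hS.le hc)
      rw [sub_sub_cancel] at h3
      have h4 : c = 0 := by
        by_contra h5
        have h6 := Submodule.smul_mem _ c⁻¹ h3
        rw [smul_smul, inv_mul_cancel₀ h5, one_smul] at h6
        exact one_notMem_IV V h6
      simpa [h4] using hc
    · rw [hS.hJ.one]; exact IV_mono hS.le
  · intro m n h; exact inf_le_inf_right _ (hS.hJ.anti h)
  · rintro m n x y ⟨h1, h2⟩ ⟨h3, h4⟩; exact ⟨hS.hJ.mul h1 h3, AV_mul h2 h4⟩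
  · rintro g n x ⟨h1, h2⟩; exact ⟨hS.hJ.conj g h1, AV_conj g h2⟩
  · rintro n x ⟨h1, h2⟩
    obtain ⟨c, hc, hx⟩ := hS.L_le _ (hS.J_le_L _ h1)
    have hp := (Fact.out : p.Prime).pos
    have h3 := hS.indep' (q := c) (r := fun i => if i = ⟨0, hp⟩ then x else 0)
      (fun j => (hS.Q_le _ (hc j)).2)
      (by intro j; split_ifs
          · exact h2
          · exact Submodule.zero_mem _) (by rw [← hx]; simp only [ite_mul, zero_mul, Finset.sum_ite_eq', Finset.mem_univ, if_true, pow_zero, mul_one])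
    have h4 := hc ⟨0, hp⟩
    rw [h3] at h4
    simp only [if_true, zero_mul, Nat.sub_zero] at h4
    refine Submodule.span_mono ?_ h4
    rintro _ (⟨b, s, g, t, h1, h2, h3, h4, h5, h6, rfl⟩ | ⟨h, -⟩)
    · exact ⟨b, s, g, t, ⟨h1, h2⟩, h3, ⟨h4, Submodule.sub_mem _ (e_mem_AV h3) (one_mem_AV _)⟩,
        h5, h6, rfl⟩
    · omega

end Sch
end

end Piece6

section Piece7
open scoped Classical commutatorElement

section
variable {p : ℕ} {Γ : Type} [Group Γ]

noncomputable def TT (p a : ℕ) : ℝ := ∑ j : Fin p, (3 / 4 : ℝ) ^ ((j : ℕ) * a)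

theorem Sch.cx [Fact p.Prime] {V V' : Subgroup Γ} {J : ℕ → Submodule (ZMod p) (GA p Γ)} {u : Γ} {a : ℕ}
    (hS : Sch p V V' J u a) (C : Cx p J) :
    ∃ C' : Cx p (fun n => J n ⊓ AV p V'), C'.df = C.df * TT p a := by
  have hp := (Fact.out : p.Prime).pos
  let z : Fin p := ⟨0, hp⟩
  have hF := hS.fil
  have hAV : AV p V' ≤ J 0 := by rw [hS.hJ.zero]; exact AV_mono hS.le
  have hη : ∀ l : ℕ, eta p u ^ l ∈ J (l * a) := fun l => hS.hJ.pow (hS.ha _ hS.hu) l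
  have hη0 : ∀ l : ℕ, eta p u ^ l ∈ J 0 := fun l => hS.hJ.le0 _ (hη l)
  -- coordinates
  have hex : ∀ x : GA p Γ, ∃ c : Fin p → GA p Γ, x ∈ J 0 → (∀ j, c j ∈ AV p V') ∧
      x = ∑ j, c j * eta p u ^ (j : ℕ) := by
    intro x
    by_cases hx : x ∈ J 0
    · obtain ⟨c, hc, h⟩ := hS.exists_coord 0 hx
      exact ⟨c, fun _ => ⟨fun j => (hc j).2, h⟩⟩
    · exact ⟨0, fun h => absurd h hx⟩
  choose κ hκ using hex
  have κu : ∀ {x : GA p Γ} {c : Fin p → GA p Γ}, (∀ j, c j ∈ AV p V') →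
      x = ∑ j, c j * eta p u ^ (j : ℕ) → κ x = c := by
    intro x c hc hx
    have hx0 : x ∈ J 0 := by
      rw [hx]; exact Submodule.sum_mem _ fun j _ => hS.hJ.mulL (hAV (hc j)) (hη0 _)
    exact hS.indep' (hκ x hx0).1 hc (by rw [← (hκ x hx0).2, hx])
  have κJ : ∀ {n x}, x ∈ J n → ∀ j : Fin p, κ x j ∈ J (n - j * a) ⊓ AV p V' := by
    intro n x hx j
    obtain ⟨c, hc, h⟩ := hS.exists_coord n hx
    rw [κu (fun j => (hc j).2) h]; exact hc j
  have κlin : ∀ {ι : Type} [Fintype ι] (b x : ι → GA p Γ), (∀ i, b i ∈ AV p V') → (∀ i, x i ∈ J 0) →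
      ∀ j, κ (∑ i, b i * x i) j = ∑ i, b i * κ (x i) j := by
    intro ι _ b x hb hx j
    refine congrFun (κu (c := fun j => ∑ i, b i * κ (x i) j) ?_ ?_) j
    · intro j; exact Submodule.sum_mem _ fun i _ => AV_mul (hb i) ((hκ _ (hx i)).1 j)
    · simp only [Finset.sum_mul]
      rw [Finset.sum_comm]
      refine Finset.sum_congr rfl fun i _ => ?_
      conv_lhs => rw [(hκ _ (hx i)).2]
      rw [Finset.mul_sum]; simp only [mul_assoc]
  have κ0 : ∀ {x}, x ∈ AV p V' → κ x z = x := by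
    intro x hx
    rw [κu (c := fun i => if i = z then x else 0)]
    · simp
    · intro j; split_ifs
      · exact hx
      · exact Submodule.zero_mem _
    · simp only [ite_mul, zero_mul, Finset.sum_ite_eq', Finset.mem_univ, if_true, z, pow_zero, mul_one]
  have hξ : ∀ l : {l : Fin p // l ≠ z}, ∃ ξ : C.Y → GA p Γ, (∀ y, ξ y ∈ J (l * a - C.dY y)) ∧
      eta p u ^ (l : ℕ) = ∑ y, ξ y * C.a y := by
    intro l
    have h1 : 1 ≤ (l : ℕ) * a := by
      refine Nat.mul_pos (Nat.pos_of_ne_zero fun h => l.2 (Fin.ext h)) hS.a1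
    have := C.gen (l * a - 1) (eta p u ^ (l : ℕ))
    rw [Nat.sub_add_cancel h1] at this
    exact this (hη _)
  choose ξ hξ1 hξ2 using hξ
  have ha0 : ∀ y, C.a y ∈ J 0 := fun y => hS.hJ.le0 _ (C.ha y)
  have hηa : ∀ (j : ℕ) y, eta p u ^ j * C.a y ∈ J 0 := fun j y => hS.hJ.mulL (hη0 j) (ha0 y)
  have key : ∀ c : C.Y → Fin p → GA p Γ, (∀ y j, c y j ∈ AV p V') →
      ∑ yj : C.Y × Fin p, c yj.1 yj.2 * κ (eta p u ^ (yj.2 : ℕ) * C.a yj.1) z =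
      κ (∑ y, (∑ j, c y j * eta p u ^ (j : ℕ)) * C.a y) z := by
    intro c hc
    rw [← κlin (fun yj : C.Y × Fin p => c yj.1 yj.2) (fun yj => eta p u ^ (yj.2 : ℕ) * C.a yj.1)
      (fun _ => hc _ _) (fun _ => hηa _ _) z]
    refine congrArg (fun w => κ w z) ?_
    rw [Fintype.sum_prod_type]
    simp only [Finset.sum_mul, mul_assoc]
  refine ⟨⟨C.Y × Fin p, (C.R × Fin p) ⊕ {l : Fin p // l ≠ z}, inferInstance, inferInstance,
    fun yj => C.dY yj.1 + yj.2 * a, Sum.elim (fun ri => C.dR ri.1 + ri.2 * a) (fun l => l * a),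
    fun yj => (C.dY1 _).trans (Nat.le_add_right _ _),
    fun yj => κ (eta p u ^ (yj.2 : ℕ) * C.a yj.1) z, ?_, ?_,
    fun r yj => Sum.elim (fun ri : C.R × Fin p => κ (eta p u ^ (ri.2 : ℕ) * C.ρ ri.1 yj.1) yj.2)
      (fun l => κ (ξ l yj.1) yj.2) r, ?_, ?_⟩, ?_⟩
  · rintro ⟨y, j⟩
    have := κJ (hS.hJ.mul (hη j) (C.ha y)) z
    simp only [z, zero_mul, Nat.sub_zero] at this
    rw [add_comm] at this
    exact this
  · rintro n x ⟨hx1, hx2⟩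
    obtain ⟨c, hc, hx⟩ := C.gen n x hx1
    refine ⟨fun yj => κ (c yj.1) yj.2, ?_, ?_⟩
    · rintro ⟨y, j⟩
      have := κJ (hc y) j
      rwa [Nat.sub_sub] at this
    · rw [key (fun y j => κ (c y) j) (fun y j => (κJ (hc y) j).2)]
      have : ∀ y, ∑ j, κ (c y) j * eta p u ^ (j : ℕ) = c y := fun y =>
        ((hκ _ (hS.hJ.le0 _ (hc y))).2).symm
      simp only [this]
      rw [← hx, κ0 hx2]
  · rintro (⟨r, i⟩ | l) ⟨y, j⟩
    · have := κJ (hS.hJ.mul (hη i) (C.hρ r y)) j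
      refine hF.anti (?_ : _ ≤ (i : ℕ) * a + (C.dR r - C.dY y) - (j : ℕ) * a) this
      simp only [Sum.elim_inl]; omega
    · have := κJ (hξ1 l y) j
      rw [Nat.sub_sub] at this
      exact this
  · intro c hc hsum
    have hc' : ∀ y j, c (y, j) ∈ AV p V' := fun y j => (hc (y, j)).2
    let cc : C.Y → GA p Γ := fun y => ∑ j, c (y, j) * eta p u ^ (j : ℕ)
    have hcc : ∀ y, cc y ∈ J 0 := fun y =>
      Submodule.sum_mem _ fun j _ => hS.hJ.mulL (hAV (hc' y j)) (hη0 _)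
    let Z : GA p Γ := ∑ y, cc y * C.a y
    have hZ : Z ∈ J 0 := Submodule.sum_mem _ fun y _ => hS.hJ.mulL (hcc y) (ha0 y)
    have hZ0 : κ Z z = 0 := by
      rw [← hsum]; exact (key (fun y j => c (y, j)) hc').symm
    have hZ1 : Z = ∑ l : {l : Fin p // l ≠ z}, κ Z l * ∑ y, ξ l y * C.a y := by
      conv_lhs => rw [(hκ Z hZ).2]
      rw [Fintype.sum_eq_add_sum_subtype_ne _ z, hZ0, zero_mul, zero_add]
      simp only [hξ2]
    have hrel := C.rel (fun y => cc y - ∑ l : {l : Fin p // l ≠ z}, κ Z l * ξ l y)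
      (fun y => Submodule.sub_mem _ (hcc y) (Submodule.sum_mem _ fun l _ =>
        hS.hJ.mulL (hAV ((hκ Z hZ).1 l)) (hS.hJ.le0 _ (hξ1 l y)))) (by
      simp only [sub_mul, Finset.sum_sub_distrib]
      rw [sub_eq_zero]
      refine hZ1.trans ?_
      simp only [Finset.sum_mul, Finset.mul_sum, mul_assoc]
      rw [Finset.sum_comm])
    obtain ⟨β, hβ, hβ2⟩ := hrel
    refine ⟨Sum.elim (fun ri => κ (β ri.1) ri.2) (fun l => κ Z l), ?_, ?_⟩
    · rintro (⟨r, i⟩ | l)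
      · have := (hκ _ (hβ r)).1 i
        exact ⟨hAV this, this⟩
      · have := (hκ _ hZ).1 l
        exact ⟨hAV this, this⟩
    · rintro ⟨y, j⟩
      have e1 : κ (cc y) j = c (y, j) := congrFun (κu (c := fun j => c (y, j)) (hc' y) rfl) j
      have e2 : cc y = ∑ s : (C.R × Fin p) ⊕ {l : Fin p // l ≠ z},
          (Sum.elim (fun ri : C.R × Fin p => κ (β ri.1) ri.2) (fun l : {l : Fin p // l ≠ z} => κ Z l) s) *
          (Sum.elim (fun ri : C.R × Fin p => eta p u ^ (ri.2 : ℕ) * C.ρ ri.1 y) (fun l : {l : Fin p // l ≠ z} => ξ l y) s) := by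
        rw [Fintype.sum_sum_type]
        simp only [Sum.elim_inl, Sum.elim_inr]
        rw [← sub_eq_iff_eq_add, hβ2 y, Fintype.sum_prod_type]
        refine Finset.sum_congr rfl fun r _ => ?_
        conv_lhs => rw [(hκ _ (hβ r)).2]
        simp only [Finset.sum_mul, mul_assoc]
      rw [← e1, e2, κlin]
      · refine Finset.sum_congr rfl ?_
        rintro (⟨r, i⟩ | l) -
        · rfl
        · rfl
      · rintro (⟨r, i⟩ | l)
        · exact (hκ _ (hβ r)).1 i
        · exact (hκ _ hZ).1 l
      · rintro (⟨r, i⟩ | l)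
        · exact hS.hJ.mulL (hη0 _) (hS.hJ.le0 _ (C.hρ r y))
        · exact hS.hJ.le0 _ (hξ1 l y)
  · have hT : TT p a = 1 + ∑ l : {l : Fin p // l ≠ z}, (3 / 4 : ℝ) ^ ((l : Fin p) * a : ℕ) := by
      rw [TT, Fintype.sum_eq_add_sum_subtype_ne _ z]; simp [z]
    have e1 : ∀ {ι : Type} [Fintype ι] (d : ι → ℕ), ∑ x : ι × Fin p, (3 / 4 : ℝ) ^ (d x.1 + x.2 * a) =
        (∑ i, (3 / 4 : ℝ) ^ d i) * TT p a := by
      intro ι _ d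
      rw [Fintype.sum_prod_type, TT, Finset.sum_mul_sum]
      simp only [pow_add]
    simp only [Cx.df]
    rw [Fintype.sum_sum_type]
    simp only [Sum.elim_inl, Sum.elim_inr]
    rw [e1, e1]
    have hT' : ∑ l : {l : Fin p // l ≠ z}, (3 / 4 : ℝ) ^ ((l : Fin p) * a : ℕ) = TT p a - 1 := by
      rw [hT]; ring
    rw [hT']; ring
end

end Piece7

section Piece8
open scoped Classical commutatorElement

section
variable {p : ℕ} {Γ : Type} [Group Γ]

theorem central_elt [Fact p.Prime] {M V : Subgroup Γ} [M.Normal] [V.Normal] [M.FiniteIndex] (hMV : M ≤ V)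
    (hne : M ≠ V) (hp : ∀ g : Γ, ∃ k, g ^ p ^ k ∈ M) :
    ∃ u ∈ V, u ∉ M ∧ ∀ g, g * u * g⁻¹ * u⁻¹ ∈ M := by
  have hG : IsPGroup p (Γ ⧸ M) := by
    intro g
    obtain ⟨g, rfl⟩ := QuotientGroup.mk_surjective g
    obtain ⟨k, hk⟩ := hp g
    exact ⟨k, by rw [← QuotientGroup.mk_pow]; exact (QuotientGroup.eq_one_iff _).2 hk⟩
  let K : Subgroup (Γ ⧸ M) := V.map (QuotientGroup.mk' M)
  have hKn : K.Normal := Subgroup.Normal.map inferInstance _ (QuotientGroup.mk'_surjective M)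
  obtain ⟨v, hv, hvM⟩ : ∃ v ∈ V, v ∉ M := by
    by_contra! h
    exact hne (le_antisymm hMV h)
  have hnt : Nontrivial K := by
    refine ⟨⟨⟨QuotientGroup.mk' M v, Subgroup.mem_map_of_mem _ hv⟩, 1, ?_⟩⟩
    intro h
    exact hvM ((QuotientGroup.eq_one_iff _).1 (congrArg Subtype.val h))
  have hdvd : p ∣ Nat.card K := by
    obtain ⟨n, hn0, hn⟩ := (hG.to_subgroup K).nontrivial_iff_card.mp inferInstance
    exact hn.symm ▸ dvd_pow_self _ (ne_of_gt hn0)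
  obtain ⟨b, hb, hb1⟩ := (hG.of_equiv ConjAct.toConjAct).exists_fixed_point_of_prime_dvd_card_of_fixed_point
    K hdvd (a := 1) (by intro g; exact smul_one g)
  obtain ⟨⟨b, hbK⟩, rfl⟩ : ∃ c : K, c = b := ⟨b, rfl⟩
  obtain ⟨u, hu, rfl⟩ := hbK
  refine ⟨u, hu, ?_, ?_⟩
  · intro h
    apply hb1
    apply Subtype.ext
    exact ((QuotientGroup.eq_one_iff _).2 h).symm
  · intro g
    have h1 := hb (ConjAct.toConjAct (QuotientGroup.mk' M g))
    have h2 := congrArg Subtype.val h1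
    rw [ConjAct.Subgroup.val_conj_smul, ConjAct.toConjAct_smul] at h2
    rw [← QuotientGroup.eq_one_iff]
    change QuotientGroup.mk' M _ = 1
    rw [map_mul, map_mul, map_mul, map_inv, map_inv, h2, mul_inv_cancel]

theorem max_normal [hpp : Fact p.Prime] {W V : Subgroup Γ} [W.Normal] [V.Normal] [W.FiniteIndex] (hWV : W ≤ V)
    (hne : W ≠ V) (hp : ∀ g : Γ, ∃ k, g ^ p ^ k ∈ W) :
    ∃ (V' : Subgroup Γ) (u : Γ), W ≤ V' ∧ V' ≤ V ∧ V'.Normal ∧ u ∈ V ∧ u ^ p ∈ V' ∧ u ∉ V' ∧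
      (∀ g ∈ V, ∃ g' ∈ V', ∃ c : ℕ, g = g' * u ^ c) ∧ ∀ j, 0 < j → j < p → u ^ j ∉ V' := by
  -- choose with minimal index
  have hex : ∃ n, ∃ M : Subgroup Γ, W ≤ M ∧ M ≤ V ∧ M ≠ V ∧ M.Normal ∧ M.index = n :=
    ⟨_, W, le_rfl, hWV, hne, inferInstance, rfl⟩
  obtain ⟨M, hWM, hMV, hMne, hMn, hMi⟩ := Nat.find_spec hex
  have hmin := fun k hk => Nat.find_min hex (m := k) hk
  rw [← hMi] at hmin
  have hMf : M.FiniteIndex := Subgroup.finiteIndex_of_le hWM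
  obtain ⟨u0, hu0, hu0M, hc0⟩ := central_elt hMV hMne (fun g => (hp g).imp fun k h => hWM h)
  -- last power not in M
  obtain ⟨k, hk1, hk2⟩ : ∃ k, u0 ^ p ^ k ∉ M ∧ u0 ^ p ^ (k + 1) ∈ M := by
    by_contra! hcon
    obtain ⟨k, hk⟩ := hp u0
    have : ∀ k, u0 ^ p ^ k ∉ M := by
      intro k
      induction k with
      | zero => simpa using hu0M
      | succ k ih => exact hcon k ih
    exact this k (hWM hk)
  have hconj : ∀ g x, (∀ g, g * x * g⁻¹ * x⁻¹ ∈ M) → ∀ n : ℕ, g * x ^ n * g⁻¹ * (x ^ n)⁻¹ ∈ M := by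
    intro g x hx n
    have h1 : QuotientGroup.mk' M (g * x * g⁻¹ * x⁻¹) = 1 := (QuotientGroup.eq_one_iff _).2 (hx g)
    refine (QuotientGroup.eq_one_iff _).1 (?_ : QuotientGroup.mk' M _ = 1)
    rw [map_mul, map_inv, mul_inv_eq_one] at h1 ⊢
    rw [← conj_pow, map_pow, h1, map_pow]
  set u := u0 ^ p ^ k with hu
  have huV : u ∈ V := V.pow_mem hu0 _
  have hup : u ^ p ∈ M := by rw [hu, ← pow_mul, ← pow_succ]; exact hk2
  have huc : ∀ g, g * u * g⁻¹ * u⁻¹ ∈ M := fun g => hconj g u0 hc0 _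
  have hp0 := hpp.out.pos
  -- the subgroup generated
  let M' : Subgroup Γ := M ⊔ Subgroup.zpowers u
  have hM'n : M'.Normal := by
    constructor
    intro x hx g
    change _ ∈ M ⊔ Subgroup.zpowers u
    obtain ⟨m, hm, z, hz, rfl⟩ := Subgroup.mem_sup_of_normal_left.1 hx
    obtain ⟨i, rfl⟩ := Subgroup.mem_zpowers_iff.1 hz
    have h1 : g * u * g⁻¹ ∈ M ⊔ Subgroup.zpowers u := by
      have := Subgroup.mul_mem_sup (huc g) (Subgroup.mem_zpowers u)
      simpa using this
    have h2 : g * (m * u ^ i) * g⁻¹ = (g * m * g⁻¹) * (g * u * g⁻¹) ^ i := by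
      rw [conj_zpow]; group
    rw [h2]
    exact Subgroup.mul_mem _ (Subgroup.mem_sup_left (hMn.conj_mem _ hm g)) (Subgroup.zpow_mem _ h1 i)
  have huM' : u ∈ M' := Subgroup.mem_sup_right (Subgroup.mem_zpowers u)
  have hMM' : M < M' := lt_of_le_of_ne le_sup_left fun h => hk1 (h ▸ huM')
  have hM'V : M' = V := by
    by_contra hne'
    refine hmin M'.index ?_ ⟨M', hWM.trans hMM'.le, sup_le hMV (by simpa using huV), hne', hM'n, rfl⟩
    exact Subgroup.index_strictAnti hMM'
  refine ⟨M, u, hWM, hMV, hMn, huV, hup, hk1, ?_, ?_⟩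
  · intro g hg
    rw [← hM'V] at hg
    obtain ⟨m, hm, z, hz, rfl⟩ := Subgroup.mem_sup_of_normal_left.1 hg
    obtain ⟨i, rfl⟩ := Subgroup.mem_zpowers_iff.1 hz
    have h1 : (i % p).toNat = i % p := Int.toNat_of_nonneg (Int.emod_nonneg _ (by exact_mod_cast hp0.ne'))
    refine ⟨m * (u ^ p) ^ (i / p), M.mul_mem hm (M.zpow_mem hup _), (i % p).toNat, ?_⟩
    rw [mul_assoc, ← zpow_natCast u (Int.toNat _), h1, ← zpow_natCast u p, ← zpow_mul, ← zpow_add,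
      Int.mul_ediv_add_emod]
  · intro j hj0 hjp hj
    apply hk1
    have hcop : Nat.Coprime j p :=
      (Nat.coprime_of_lt_prime hj0.ne' hjp hpp.out).symm
    have := Int.gcd_eq_gcd_ab j p
    rw [Int.gcd_natCast_natCast, hcop] at this
    have h2 : u = (u ^ j) ^ (Int.gcdA j p) * (u ^ p) ^ (Int.gcdB j p) := by
      rw [← zpow_natCast u j, ← zpow_natCast u p, ← zpow_mul, ← zpow_mul, ← zpow_add, ← this]
      simp
    rw [h2]
    exact M.mul_mem (M.zpow_mem hj _) (M.zpow_mem hup _)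

theorem step [hpp : Fact p.Prime] {V : Subgroup Γ} [V.Normal] [V.FiniteIndex]
    (hp : ∀ g : Γ, ∃ k, g ^ p ^ k ∈ V) {J} (hJ : Fil p V J) (C : Cx p J) (hC : 0 < C.df) :
    ∃ V' u a, Sch p V V' J u a ∧ V'.FiniteIndex ∧ ∀ g : Γ, ∃ k, g ^ p ^ k ∈ V' := by
  obtain ⟨hfin, hunb⟩ := hJ.gs C hC
  have hex : ∃ n, ¬ V ≤ hJ.D n := by
    obtain ⟨n, hn⟩ := hunb 1
    refine ⟨n, fun h => ?_⟩
    rw [Subgroup.relIndex_eq_one.2 h] at hn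
    omega
  have h0 : Nat.find hex ≠ 0 := by
    intro h
    apply Nat.find_spec hex
    rw [h]
    intro g hg
    exact ⟨hg, hJ.le0 1 (hJ.sub_mem hg)⟩
  have h1 : Nat.find hex ≠ 1 := by
    intro h
    apply Nat.find_spec hex
    rw [h, hJ.D_one]
  obtain ⟨a, ha⟩ : ∃ a, Nat.find hex = a + 1 := ⟨Nat.find hex - 1, by omega⟩
  have hn := Nat.find_spec hex
  rw [ha] at hn
  have hVa : V ≤ hJ.D a := by
    by_contra h; exact Nat.find_min hex (by omega) h
  have hWf : (hJ.D (a + 1)).FiniteIndex := ⟨by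
    rw [← Subgroup.relIndex_mul_index (hJ.D_le (a + 1))]
    exact Nat.mul_ne_zero (hfin _) Subgroup.FiniteIndex.index_ne_zero⟩
  have := hJ.D_normal (a + 1)
  have hpW : ∀ g : Γ, ∃ k, g ^ p ^ k ∈ hJ.D (a + 1) := by
    intro g
    obtain ⟨k, hk⟩ := hp g
    rw [← hJ.D_one] at hk
    have h3 := hJ.D_pow hk (a + 1)
    refine ⟨k + (a + 1), ?_⟩
    rw [pow_add, pow_mul]
    refine hJ.D_anti ?_ h3
    rw [mul_one]
    exact (Nat.lt_pow_self hpp.out.one_lt).le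
  obtain ⟨V', u, h1', h2, h3, h4, h5, h6, h7, h8⟩ := max_normal (hJ.D_le (a + 1))
    (fun h => hn h.ge) hpW
  exact ⟨V', u, a, ⟨hJ, h2, h3, h4, h7, h8, h5, by omega, fun g hg => (hVa hg).2,
    fun g hg hg' => h1' ⟨hg, hg'⟩⟩, Subgroup.finiteIndex_of_le h1', fun g => (hpW g).imp fun k hk => h1' hk⟩
end

end Piece8

section Piece9
open scoped Classical commutatorElement

structure Stg (p : ℕ) (Γ : Type) [Group Γ] where
  V : Subgroup Γ
  J : ℕ → Submodule (ZMod p) (GA p Γ)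
  nor : V.Normal
  fin : V.FiniteIndex
  pq : ∀ g : Γ, ∃ k, g ^ p ^ k ∈ V
  fil : Fil p V J
  C : Cx p J
  hC : 0 < C.df

attribute [instance] Stg.nor Stg.fin

section
variable {p : ℕ} {Γ : Type} [Group Γ]

structure Lnk (S S' : Stg p Γ) (u : Γ) (a : ℕ) : Prop where
  sch : Sch p S.V S'.V S.J u a
  J : ∀ n, S'.J n = S.J n ⊓ AV p S'.V
  df : S'.C.df = S.C.df * TT p a

theorem TT_ge (hp : 2 ≤ p) (a : ℕ) : 1 + (3 / 4 : ℝ) ^ a ≤ TT p a := by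
  obtain ⟨q, rfl⟩ : ∃ q, p = q + 2 := ⟨p - 2, by omega⟩
  rw [TT, Fin.sum_univ_succ, Fin.sum_univ_succ]
  have : 0 ≤ ∑ i : Fin q, (3 / 4 : ℝ) ^ ((i.succ.succ : Fin (q + 2)).val * a) := by positivity
  simp only [Fin.val_zero, zero_mul, pow_zero, Fin.val_succ, zero_add, one_mul] at this ⊢
  linarith

theorem TT_one (hp : 2 ≤ p) (a : ℕ) : 1 ≤ TT p a := by
  have := TT_ge hp a
  have : (0 : ℝ) ≤ (3 / 4) ^ a := by positivity
  linarith

theorem exists_lnk [hp : Fact p.Prime] (S : Stg p Γ) : ∃ S' u a, Lnk S S' u a := by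
  obtain ⟨V', u, a, h1, h2, h3⟩ := step S.pq S.fil S.C S.hC
  obtain ⟨C', hC'⟩ := h1.cx S.C
  refine ⟨⟨V', _, h1.nor, h2, h3, h1.fil, C', ?_⟩, u, a, h1, fun n => rfl, hC'⟩
  rw [hC']
  exact mul_pos S.hC (by linarith [TT_one hp.out.two_le a])

theorem exists_chain [hp : Fact p.Prime] (S0 : Stg p Γ) : ∃ (S : ℕ → Stg p Γ) (u : ℕ → Γ) (a : ℕ → ℕ),
    S 0 = S0 ∧ ∀ i, Lnk (S i) (S (i + 1)) (u i) (a i) := by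
  choose F u a h using exists_lnk (p := p) (Γ := Γ)
  refine ⟨fun i => F^[i] S0, fun i => u (F^[i] S0), fun i => a (F^[i] S0), rfl, fun i => ?_⟩
  dsimp only
  rw [Function.iterate_succ_apply']
  exact h _

structure Chn (S : ℕ → Stg p Γ) (u : ℕ → Γ) (a : ℕ → ℕ) : Prop where
  l : ∀ i, Lnk (S i) (S (i + 1)) (u i) (a i)

namespace Chn
variable {S : ℕ → Stg p Γ} {u : ℕ → Γ} {a : ℕ → ℕ} (h : Chn S u a)
include h

theorem anti : Antitone (fun i => (S i).V) := antitone_nat_of_succ_le fun i => (h.l i).sch.le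

theorem J0 (i n) : (S i).J n = (S 0).J n ⊓ AV p (S i).V := by
  induction i with
  | zero =>
    rw [eq_comm, inf_eq_left, ← (S 0).fil.zero]; exact (S 0).fil.le0 n
  | succ i ih =>
    rw [(h.l i).J, ih, inf_assoc, inf_eq_right.2 (AV_mono ((h.l i).sch.le))]

theorem D_iff {i n g} (hg : g ∈ (S i).V) : e p g - 1 ∈ (S i).J n ↔ e p g - 1 ∈ (S 0).J n := by
  rw [h.J0 i, Submodule.mem_inf]
  exact and_iff_left (Submodule.sub_mem _ (e_mem_AV hg) (one_mem_AV _))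

theorem V0 {i g} (hg : g ∈ (S i).V) : g ∈ (S 0).V := h.anti (Nat.zero_le i) hg

theorem D_a {i g} (hg : g ∈ (S i).V) : g ∈ (S 0).fil.D (a i) :=
  ⟨h.V0 hg, (h.D_iff hg).1 ((h.l i).sch.ha g hg)⟩

theorem D_succ {i g} (hg : g ∈ (S i).V) (hg' : g ∈ (S 0).fil.D (a i + 1)) : g ∈ (S (i + 1)).V :=
  (h.l i).sch.hD g hg ((h.D_iff hg).2 hg'.2)

theorem u_mem (i) : u i ∈ (S i).V := (h.l i).sch.hu

theorem u_notMem [hp : Fact p.Prime] (i) : u i ∉ (S (i + 1)).V := by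
  have := (h.l i).sch.unq 1 one_pos hp.out.one_lt
  rwa [pow_one] at this

theorem a_mono [Fact p.Prime] : Monotone a := by
  refine monotone_nat_of_le_succ fun i => ?_
  by_contra! hlt
  refine h.u_notMem (i + 1) (h.D_succ (h.u_mem _) ?_)
  exact (S 0).fil.D_anti hlt (h.D_a ((h.l i).sch.le (h.u_mem _)))

theorem a_unb [Fact p.Prime] (B : ℕ) : ∃ i, B < a i := by
  by_contra! hB
  have h1 : ∀ i, (S 0).fil.D (B + 1) ≤ (S i).V := by
    intro i
    induction i with
    | zero => exact (S 0).fil.D_le _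
    | succ i ih =>
      intro g hg
      exact h.D_succ (ih hg) ((S 0).fil.D_anti (by have := hB i; omega) hg)
  have hWf : ((S 0).fil.D (B + 1)).FiniteIndex := ⟨by
    rw [← Subgroup.relIndex_mul_index ((S 0).fil.D_le (B + 1))]
    exact Nat.mul_ne_zero (((S 0).fil.gs (S 0).C (S 0).hC).1 _) Subgroup.FiniteIndex.index_ne_zero⟩
  have h2 : ∀ i, i ≤ (S i).V.index := by
    intro i
    induction i with
    | zero => omega
    | succ i ih =>
      have : (S (i + 1)).V < (S i).V := lt_of_le_of_ne (h.l i).sch.le fun h3 =>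
        h.u_notMem i (h3 ▸ h.u_mem i)
      have := Subgroup.index_strictAnti this
      omega
  have h3 := Subgroup.index_antitone (h1 (((S 0).fil.D (B + 1)).index + 1))
  have h4 := h2 (((S 0).fil.D (B + 1)).index + 1)
  omega

theorem df_eq (k) : (S k).C.df = (S 0).C.df * ∏ i ∈ Finset.range k, TT p (a i) := by
  induction k with
  | zero => simp
  | succ k ih => rw [(h.l k).df, ih, Finset.prod_range_succ, mul_assoc]

end Chn

theorem mkStg [Fact p.Prime] {V : Subgroup Γ} [V.Normal] [V.FiniteIndex] (hp : ∀ g : Γ, ∃ k, g ^ p ^ k ∈ V)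
    {J} (hJ : Fil p V J) (C : Cx p J) {ι : Type} [Fintype ι] (s : ι → Γ) (d : ι → ℕ) (hd : ∀ i, 1 ≤ d i)
    (hs : ∀ i, s i ∈ hJ.D (d i)) (hcost : V.index * ∑ i, (3 / 4 : ℝ) ^ d i < C.df) :
    Nonempty (Stg p (Γ ⧸ Subgroup.normalClosure (Set.range s))) := by
  obtain ⟨J', hJ', C', hC'⟩ := kill hJ C s d hd hs (QuotientGroup.mk' (Subgroup.normalClosure (Set.range s)))
    (QuotientGroup.mk'_surjective _) (QuotientGroup.ker_mk' _)
  refine ⟨⟨_, J', Subgroup.Normal.map inferInstance _ (QuotientGroup.mk'_surjective _), ?_, ?_, hJ', C', ?_⟩⟩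
  · exact ⟨Nat.pos_of_ne_zero (fun h0 => by
      have := Subgroup.index_map_dvd V (QuotientGroup.mk'_surjective (Subgroup.normalClosure (Set.range s)))
      rw [h0, zero_dvd_iff] at this
      exact Subgroup.FiniteIndex.index_ne_zero this) |>.ne'⟩
  · intro g
    obtain ⟨g, rfl⟩ := QuotientGroup.mk'_surjective _ g
    obtain ⟨k, hk⟩ := hp g
    exact ⟨k, by rw [← map_pow]; exact Subgroup.mem_map_of_mem _ hk⟩
  · rw [hC']; linarith
end

end Piece9

section Piece10
open scoped Classical commutatorElement

section
variable {p : ℕ} {Γ : Type} [Group Γ]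

def Gs (D : ℕ → Subgroup Γ) (K : Subgroup Γ) (s : ℝ) : Prop :=
  ∃ (ι : Type) (_ : Fintype ι) (h : ι → Γ) (d : ι → ℕ), (∀ i, 1 ≤ d i) ∧ (∀ i, h i ∈ D (d i)) ∧
    Subgroup.closure (Set.range h) = K ∧ ∑ i, (3 / 4 : ℝ) ^ d i = s

theorem Sch.vpow {V V' : Subgroup Γ} {J : ℕ → Submodule (ZMod p) (GA p Γ)} {u : Γ} {a : ℕ}
    (hS : Sch p V V' J u a) {g : Γ} (hg : g ∈ V) : g ^ p ∈ V' := by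
  have := hS.nor
  obtain ⟨v, hv, c, rfl⟩ := hS.cos g hg
  refine (QuotientGroup.eq_one_iff _).1 (?_ : QuotientGroup.mk' V' _ = 1)
  have h1 : QuotientGroup.mk' V' v = 1 := (QuotientGroup.eq_one_iff _).2 hv
  have h2 : QuotientGroup.mk' V' (u ^ p) = 1 := (QuotientGroup.eq_one_iff _).2 hS.upow
  rw [map_pow, map_mul, h1, one_mul, ← map_pow, ← pow_mul, mul_comm, pow_mul, map_pow, h2, one_pow]

theorem Sch.cos2 [hp : Fact p.Prime] {V V' : Subgroup Γ} {J : ℕ → Submodule (ZMod p) (GA p Γ)} {u : Γ} {a : ℕ}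
    (hS : Sch p V V' J u a) {h g : Γ} (hh : h ∈ V) (hh' : h ∉ V') (hg : g ∈ V) :
    ∃ c : ℕ, g * h ^ c ∈ V' := by
  have := hS.nor
  obtain ⟨v, hv, c, rfl⟩ := hS.cos h hh
  obtain ⟨w, hw, d, rfl⟩ := hS.cos g hg
  have h1 : QuotientGroup.mk' V' v = 1 := (QuotientGroup.eq_one_iff _).2 hv
  have h1' : QuotientGroup.mk' V' w = 1 := (QuotientGroup.eq_one_iff _).2 hw
  have h2 : QuotientGroup.mk' V' (u ^ p) = 1 := (QuotientGroup.eq_one_iff _).2 hS.upow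
  have hc : (c : ZMod p) ≠ 0 := by
    intro h0
    rw [ZMod.natCast_eq_zero_iff] at h0
    obtain ⟨k, rfl⟩ := h0
    apply hh'
    refine V'.mul_mem hv ?_
    rw [pow_mul]; exact V'.pow_mem hS.upow k
  let m : ℕ := (-(d : ZMod p) / c).val
  have hm : p ∣ d + c * m := by
    rw [← ZMod.natCast_eq_zero_iff]
    push_cast
    have : ((m : ℕ) : ZMod p) = -(d : ZMod p) / c := ZMod.natCast_zmod_val _
    rw [this]
    field_simp
    ring
  refine ⟨m, ?_⟩
  refine (QuotientGroup.eq_one_iff _).1 (?_ : QuotientGroup.mk' V' _ = 1)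
  obtain ⟨k, hk⟩ := hm
  rw [map_mul, map_mul, map_pow _ (v * u ^ c), map_mul, h1, h1', one_mul, one_mul, ← map_pow, ← map_mul,
    ← pow_mul, ← pow_add, hk, pow_mul, map_pow, h2, one_pow]

/-- iterated commutators -/
def adI (h x : Γ) : ℕ → Γ
  | 0 => x
  | n + 1 => ⁅h, adI h x n⁆

theorem schreier_gen [hp : Fact p.Prime] {V' : Subgroup Γ} [hn : V'.Normal] {ι : Type} {K : Subgroup Γ} (h0 : Γ)
    (h0K : h0 ∈ K) (h0V : h0 ∉ V') (h0p : h0 ^ p ∈ V') (x : ι → Γ) (hx : ∀ i, x i ∈ V')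
    (hK : K = Subgroup.closure (insert h0 (Set.range x))) :
    K ⊓ V' = Subgroup.closure (insert (h0 ^ p) (Set.range fun ij : ι × Fin p => adI h0 (x ij.1) ij.2)) := by
  set W := Subgroup.closure (insert (h0 ^ p) (Set.range fun ij : ι × Fin p => adI h0 (x ij.1) ij.2)) with hW
  have hpos := hp.out.pos
  have hxK : ∀ i, x i ∈ K := fun i => by
    rw [hK]; exact Subgroup.subset_closure (Set.mem_insert_of_mem _ ⟨i, rfl⟩)
  have had : ∀ i j, adI h0 (x i) j ∈ K ⊓ V' := by
    intro i j
    induction j with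
    | zero => exact ⟨hxK i, hx i⟩
    | succ j ih =>
      rw [adI, commutatorElement_def]
      exact ⟨K.mul_mem (K.mul_mem (K.mul_mem h0K ih.1) (K.inv_mem h0K)) (K.inv_mem ih.1),
        V'.mul_mem (hn.conj_mem _ ih.2 _) (V'.inv_mem ih.2)⟩
  have hWle : W ≤ K ⊓ V' := by
    rw [hW, Subgroup.closure_le]
    rintro _ (rfl | ⟨⟨i, j⟩, rfl⟩)
    · exact ⟨K.pow_mem h0K _, h0p⟩
    · exact had i j
  have h0W : h0 ^ p ∈ W := Subgroup.subset_closure (Set.mem_insert _ _)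
  have hadW : ∀ i j, j < p → adI h0 (x i) j ∈ W := fun i j hj =>
    Subgroup.subset_closure (Set.mem_insert_of_mem _ ⟨(i, ⟨j, hj⟩), rfl⟩)
  let W1 := Subgroup.closure (insert (h0 ^ p) (Set.range fun ij : ι × Fin p =>
    h0 ^ (ij.2 : ℕ) * x ij.1 * (h0 ^ (ij.2 : ℕ))⁻¹))
  have h0W1 : h0 ^ p ∈ W1 := Subgroup.subset_closure (Set.mem_insert _ _)
  have hyW1 : ∀ i j, j < p → h0 ^ j * x i * (h0 ^ j)⁻¹ ∈ W1 := fun i j hj =>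
    Subgroup.subset_closure (Set.mem_insert_of_mem _ ⟨(i, ⟨j, hj⟩), rfl⟩)
  have hW1W : W1 ≤ W := by
    have key : ∀ i j m, j + m < p → h0 ^ j * adI h0 (x i) m * (h0 ^ j)⁻¹ ∈ W := by
      intro i j
      induction j with
      | zero => intro m hm; simpa using hadW i m (by omega)
      | succ j ih =>
        intro m hm
        have e1 : h0 ^ (j + 1) * adI h0 (x i) m * (h0 ^ (j + 1))⁻¹ =
            (h0 ^ j * adI h0 (x i) (m + 1) * (h0 ^ j)⁻¹) * (h0 ^ j * adI h0 (x i) m * (h0 ^ j)⁻¹) := by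
          rw [adI, commutatorElement_def, pow_succ]; group
        rw [e1]
        exact W.mul_mem (ih _ (by omega)) (ih _ (by omega))
    rw [Subgroup.closure_le]
    rintro _ (rfl | ⟨⟨i, j⟩, rfl⟩)
    · exact h0W
    · exact key i j 0 (by simp)
  have hconj : ∀ w ∈ W1, h0 * w * h0⁻¹ ∈ W1 := by
    intro w hw
    have : W1 ≤ W1.comap (MulAut.conj h0).toMonoidHom := by
      rw [Subgroup.closure_le]
      rintro _ (rfl | ⟨⟨i, j⟩, rfl⟩)
      · change h0 * h0 ^ p * h0⁻¹ ∈ W1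
        rw [← pow_succ', pow_succ, mul_inv_cancel_right]; exact h0W1
      · change h0 * (h0 ^ (j : ℕ) * x i * (h0 ^ (j : ℕ))⁻¹) * h0⁻¹ ∈ W1
        have e1 : h0 * (h0 ^ (j : ℕ) * x i * (h0 ^ (j : ℕ))⁻¹) * h0⁻¹ =
            h0 ^ (j + 1 : ℕ) * x i * (h0 ^ (j + 1 : ℕ))⁻¹ := by rw [pow_succ']; group
        rw [e1]
        by_cases hj : (j : ℕ) + 1 < p
        · exact hyW1 i _ hj
        · have : (j : ℕ) + 1 = p := by have := j.2; omega
          rw [this]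
          refine W1.mul_mem (W1.mul_mem h0W1 ?_) (W1.inv_mem h0W1)
          simpa using hyW1 i 0 hpos
    exact this hw
  have hconjn : ∀ (c : ℕ), ∀ w ∈ W1, h0 ^ c * w * (h0 ^ c)⁻¹ ∈ W1 := by
    intro c
    induction c with
    | zero => intro w hw; simpa using hw
    | succ c ih =>
      intro w hw
      have e1 : h0 ^ (c + 1) * w * (h0 ^ (c + 1))⁻¹ = h0 * (h0 ^ c * w * (h0 ^ c)⁻¹) * h0⁻¹ := by
        rw [pow_succ']; group
      rw [e1]; exact hconj _ (ih w hw)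
  let P : Subgroup Γ :=
    { carrier := {g | ∃ w ∈ W1, ∃ c : ℕ, g = w * h0 ^ c}
      one_mem' := ⟨1, W1.one_mem, 0, by simp⟩
      mul_mem' := by
        rintro _ _ ⟨w, hw, c, rfl⟩ ⟨w', hw', c', rfl⟩
        refine ⟨w * (h0 ^ c * w' * (h0 ^ c)⁻¹), W1.mul_mem hw (hconjn c _ hw'), c + c', ?_⟩
        rw [pow_add]; group
      inv_mem' := by
        rintro _ ⟨w, hw, c, rfl⟩
        have h1 : ((h0 ^ p) ^ c)⁻¹ * w⁻¹ ∈ W1 := W1.mul_mem (W1.inv_mem (W1.pow_mem h0W1 _)) (W1.inv_mem hw)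
        refine ⟨_, hconjn (c * (p - 1)) _ h1, c * (p - 1), ?_⟩
        have e2 : h0 ^ (c * (p - 1)) * ((h0 ^ p) ^ c)⁻¹ = (h0 ^ c)⁻¹ := by
          rw [mul_inv_eq_iff_eq_mul, eq_inv_mul_iff_mul_eq, ← pow_add, ← pow_mul]
          congr 1
          obtain ⟨q, rfl⟩ : ∃ q, p = q + 1 := ⟨p - 1, by omega⟩
          simp only [Nat.add_sub_cancel]; ring
        rw [inv_mul_cancel_right, ← mul_assoc, e2]; group }
  have hKP : K ≤ P := by
    rw [hK, Subgroup.closure_le]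
    rintro _ (rfl | ⟨i, rfl⟩)
    · exact ⟨1, W1.one_mem, 1, by simp⟩
    · exact ⟨x i, by simpa using hyW1 i 0 hpos, 0, by simp⟩
  refine le_antisymm ?_ hWle
  rintro g ⟨hgK, hgV⟩
  obtain ⟨w, hw, c, rfl⟩ := hKP hgK
  have hwV : w ∈ V' := (hWle (hW1W hw)).2
  have hcV : h0 ^ c ∈ V' := (V'.mul_mem_cancel_left hwV).1 hgV
  have hord : orderOf (QuotientGroup.mk' V' h0) = p := by
    refine orderOf_eq_prime ?_ ?_
    · rw [← map_pow]; exact (QuotientGroup.eq_one_iff _).2 h0p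
    · intro h1; exact h0V ((QuotientGroup.eq_one_iff _).1 h1)
  have hdvd : p ∣ c := by
    rw [← hord, orderOf_dvd_iff_pow_eq_one, ← map_pow]
    exact (QuotientGroup.eq_one_iff _).2 hcV
  obtain ⟨k, rfl⟩ := hdvd
  rw [pow_mul]
  exact W.mul_mem (hW1W hw) (W.pow_mem h0W _)

theorem track [hp : Fact p.Prime] {V V' : Subgroup Γ} [hn : V'.Normal] {D : ℕ → Subgroup Γ} (Danti : Antitone D)
    (Dcomm : ∀ {m n g h}, g ∈ D m → h ∈ D n → ⁅g, h⁆ ∈ D (m + n))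
    (Dpow : ∀ {n g}, g ∈ D n → g ^ p ∈ D (p * n)) {a : ℕ} (ha : 1 ≤ a) (hVa : V ≤ D a)
    (hD : ∀ g ∈ V, g ∈ D (a + 1) → g ∈ V') (hpow : ∀ g ∈ V, g ^ p ∈ V')
    (hcos : ∀ h ∈ V, h ∉ V' → ∀ g ∈ V, ∃ c : ℕ, g * h ^ c ∈ V')
    {K : Subgroup Γ} (hKV : K ≤ V) (hKV' : ¬ K ≤ V') {s : ℝ} (hs : Gs D K s) :
    ∃ s', s' ≤ 1 + (s - 1) * TT p a ∧ Gs D (K ⊓ V') s' := by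
  obtain ⟨ι, _, h, d, hd1, hd2, hcl, rfl⟩ := hs
  have hhK : ∀ i, h i ∈ K := fun i => by rw [← hcl]; exact Subgroup.subset_closure ⟨i, rfl⟩
  let d' : ι → ℕ := fun i => max (d i) a
  have hd' : ∀ i, h i ∈ D (d' i) := by
    intro i
    rcases le_total (d i) a with h1 | h1
    · simp only [d', max_eq_right h1]; exact hVa (hKV (hhK i))
    · simp only [d', max_eq_left h1]; exact hd2 i
  obtain ⟨i0, hi0⟩ : ∃ i, h i ∉ V' := by
    by_contra! hcon
    apply hKV'
    rw [← hcl, Subgroup.closure_le]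
    rintro _ ⟨i, rfl⟩; exact hcon i
  have hd0 : d' i0 = a := by
    by_contra hne
    have : a + 1 ≤ d' i0 := by
      have : a ≤ d' i0 := le_max_right _ _
      omega
    exact hi0 (hD _ (hKV (hhK _)) (Danti this (hd' i0)))
  have hx : ∀ i, ∃ c : ℕ, h i * h i0 ^ c ∈ V' ∧ h i * h i0 ^ c ∈ D (d' i) := by
    intro i
    by_cases h1 : d' i = a
    · obtain ⟨c, hc⟩ := hcos _ (hKV (hhK i0)) hi0 _ (hKV (hhK i))
      refine ⟨c, hc, ?_⟩
      rw [h1]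
      exact hVa (hKV (K.mul_mem (hhK i) (K.pow_mem (hhK i0) c)))
    · refine ⟨0, ?_, by simpa using hd' i⟩
      have : a + 1 ≤ d' i := by
        have : a ≤ d' i := le_max_right _ _
        omega
      simpa using hD _ (hKV (hhK _)) (Danti this (hd' i))
  choose c hc1 hc2 using hx
  let x : {i // i ≠ i0} → Γ := fun i => h i * h i0 ^ c i
  have hK : K = Subgroup.closure (insert (h i0) (Set.range x)) := by
    refine le_antisymm ?_ ?_
    · rw [← hcl, Subgroup.closure_le]
      have h0 : h i0 ∈ Subgroup.closure (insert (h i0) (Set.range x)) :=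
        Subgroup.subset_closure (Set.mem_insert _ _)
      rintro _ ⟨i, rfl⟩
      by_cases hi : i = i0
      · rw [hi]; exact h0
      · have h1 : x ⟨i, hi⟩ ∈ Subgroup.closure (insert (h i0) (Set.range x)) :=
          Subgroup.subset_closure (Set.mem_insert_of_mem _ ⟨_, rfl⟩)
        have h2 : h i = x ⟨i, hi⟩ * (h i0 ^ c i)⁻¹ := by simp [x]
        rw [h2]
        exact Subgroup.mul_mem _ h1 (Subgroup.inv_mem _ (Subgroup.pow_mem _ h0 _))
    · rw [Subgroup.closure_le]
      rintro _ (rfl | ⟨i, rfl⟩)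
      · exact hhK _
      · exact K.mul_mem (hhK _) (K.pow_mem (hhK _) _)
  have hgen := schreier_gen (h i0) (hhK i0) hi0 (hpow _ (hKV (hhK _))) x (fun i => hc1 i) hK
  have hadD : ∀ (i : {i // i ≠ i0}) (j : ℕ), adI (h i0) (x i) j ∈ D (d' i + j * a) := by
    intro i j
    induction j with
    | zero => rw [zero_mul, add_zero]; exact hc2 i
    | succ j ih =>
      have h1 := Dcomm (hd0 ▸ hd' i0) ih
      rw [adI]
      convert h1 using 2; ring
  have h0a : h i0 ∈ D a := hVa (hKV (hhK _))
  refine ⟨_, ?_, Option ({i // i ≠ i0} × Fin p), inferInstance,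
    fun o => o.elim (h i0 ^ p) (fun ij => adI (h i0) (x ij.1) ij.2),
    fun o => o.elim (p * a) (fun ij => d' ij.1 + ij.2 * a), ?_, ?_, ?_, rfl⟩
  · rw [Fintype.sum_option]
    simp only [Option.elim]
    have e1 : ∑ x : {i // i ≠ i0} × Fin p, (3 / 4 : ℝ) ^ (d' x.1 + x.2 * a) =
        (∑ i : {i // i ≠ i0}, (3 / 4 : ℝ) ^ d' i) * TT p a := by
      rw [Fintype.sum_prod_type, TT, Finset.sum_mul_sum]
      simp only [pow_add]
    rw [e1]
    have e2 : ∑ i, (3 / 4 : ℝ) ^ d' i = (3 / 4 : ℝ) ^ a + ∑ i : {i // i ≠ i0}, (3 / 4 : ℝ) ^ d' i := by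
      rw [Fintype.sum_eq_add_sum_subtype_ne _ i0, hd0]
    have e3 : ∑ i, (3 / 4 : ℝ) ^ d' i ≤ ∑ i, (3 / 4 : ℝ) ^ d i :=
      Finset.sum_le_sum fun i _ => pow_le_pow_of_le_one (by norm_num) (by norm_num) (le_max_left _ _)
    have e4 : TT p a * (3 / 4 : ℝ) ^ a = TT p a - 1 + (3 / 4 : ℝ) ^ (p * a) := by
      have h1 : TT p a = ∑ j ∈ Finset.range p, ((3 / 4 : ℝ) ^ a) ^ j := by
        rw [TT, Finset.sum_range]
        refine Finset.sum_congr rfl fun j _ => ?_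
        rw [← pow_mul, mul_comm]
      have h2 := geom_sum_mul ((3 / 4 : ℝ) ^ a) p
      rw [← h1, ← pow_mul, mul_comm a p] at h2
      linarith
    have hT := TT_one hp.out.two_le a
    have e5 : (∑ i : {i // i ≠ i0}, (3 / 4 : ℝ) ^ d' i) * TT p a ≤
        (∑ i, (3 / 4 : ℝ) ^ d i - (3 / 4 : ℝ) ^ a) * TT p a :=
      mul_le_mul_of_nonneg_right (by linarith) (by linarith)
    nlinarith
  · rintro (_ | ⟨i, j⟩)
    · exact Nat.mul_pos hp.out.pos ha
    · exact (ha.trans (le_max_right _ _)).trans (Nat.le_add_right _ _)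
  · rintro (_ | ⟨i, j⟩)
    · exact Dpow h0a
    · exact hadD i j
  · rw [hgen]
    congr 1
    ext g
    constructor
    · rintro ⟨_ | ij, rfl⟩
      · exact Set.mem_insert _ _
      · exact Set.mem_insert_of_mem _ ⟨ij, rfl⟩
    · rintro (rfl | ⟨ij, rfl⟩)
      · exact ⟨none, rfl⟩
      · exact ⟨some ij, rfl⟩
end

end Piece10

section Piece11
open scoped Classical commutatorElement

section
variable {p : ℕ} {Γ : Type} [Group Γ]

def dsr {G : Type*} [Group G] : Subgroup G → ℕ → Subgroup G
  | K, 0 => K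
  | K, n + 1 => dsr ⁅K, K⁆ n

theorem dsr_succ {G : Type*} [Group G] (K : Subgroup G) (n : ℕ) : dsr K (n + 1) = ⁅dsr K n, dsr K n⁆ := by
  induction n generalizing K with
  | zero => rfl
  | succ n ih => rw [dsr, ih, ← dsr]

theorem dsr_mono {G : Type*} [Group G] {K L : Subgroup G} (h : K ≤ L) (n : ℕ) : dsr K n ≤ dsr L n := by
  induction n generalizing K L with
  | zero => exact h
  | succ n ih => exact ih (Subgroup.commutator_mono h h)

theorem dsr_map {G G' : Type*} [Group G] [Group G'] (f : G →* G') (K : Subgroup G) (n : ℕ) :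
    (dsr K n).map f = dsr (K.map f) n := by
  induction n generalizing K with
  | zero => rfl
  | succ n ih => rw [dsr, dsr, ih, Subgroup.map_commutator]

theorem dsr_top {G : Type*} [Group G] (n : ℕ) : dsr (⊤ : Subgroup G) n = derivedSeries G n := by
  induction n with
  | zero => rfl
  | succ n ih => rw [dsr_succ, ih, derivedSeries_succ]

theorem lcs_step {G : Type} [Group G] {ι κ : Type} (g : ι → G) (hg : Subgroup.closure (Set.range g) = ⊤)
    (s : κ → G) : ⁅Subgroup.normalClosure (Set.range s), (⊤ : Subgroup G)⁆ ≤
      Subgroup.normalClosure (Set.range fun x : κ × ι => ⁅s x.1, g x.2⁆) := by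
  set M := Subgroup.normalClosure (Set.range fun x : κ × ι => ⁅s x.1, g x.2⁆)
  have h1 : Subgroup.normalClosure (Set.range s) ≤ (Subgroup.center (G ⧸ M)).comap (QuotientGroup.mk' M) := by
    refine Subgroup.normalClosure_le_normal ?_
    rintro _ ⟨k, rfl⟩
    refine Subgroup.mem_center_iff.2 fun y => ?_
    obtain ⟨y, rfl⟩ := QuotientGroup.mk'_surjective _ y
    have h2 : (⊤ : Subgroup G) ≤ (Subgroup.centralizer {QuotientGroup.mk' M (s k)}).comap (QuotientGroup.mk' M) := by
      rw [← hg, Subgroup.closure_le]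
      rintro _ ⟨i, rfl⟩
      have h3 : QuotientGroup.mk' M ⁅s k, g i⁆ = 1 :=
        (QuotientGroup.eq_one_iff _).2 (Subgroup.subset_normalClosure ⟨(k, i), rfl⟩)
      rw [map_commutatorElement, commutatorElement_eq_one_iff_mul_comm] at h3
      refine Subgroup.mem_centralizer_singleton_iff.2 ?_
      exact h3.symm
    have h4 := Subgroup.mem_centralizer_singleton_iff.1 (h2 (Subgroup.mem_top y))
    exact h4
  rw [Subgroup.commutator_le]
  intro x hx y _
  refine (QuotientGroup.eq_one_iff _).1 (?_ : QuotientGroup.mk' M _ = 1)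
  rw [map_commutatorElement, commutatorElement_eq_one_iff_mul_comm]
  exact (Subgroup.mem_center_iff.1 (h1 hx) _).symm

theorem nil_fam {G : Type} [Group G] (φ : G →* Γ) (D : ℕ → Subgroup Γ)
    (Dcomm : ∀ {m n g h}, g ∈ D m → h ∈ D n → ⁅g, h⁆ ∈ D (m + n))
    {ι : Type} [Fintype ι] (g : ι → G) (hg : Subgroup.closure (Set.range g) = ⊤) (d : ι → ℕ)
    (hd : ∀ i, 1 ≤ d i) (hgd : ∀ i, φ (g i) ∈ D (d i)) (n : ℕ) :
    ∃ (κ : Type) (_ : Fintype κ) (s : κ → G) (d' : κ → ℕ), (∀ i, 1 ≤ d' i) ∧ (∀ i, φ (s i) ∈ D (d' i)) ∧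
      ∑ i, (3 / 4 : ℝ) ^ d' i = (∑ i, (3 / 4 : ℝ) ^ d i) ^ (n + 1) ∧
      derivedSeries G n ≤ Subgroup.normalClosure (Set.range s) := by
  induction n with
  | zero =>
    refine ⟨ι, inferInstance, g, d, hd, hgd, by simp, ?_⟩
    have h : (⊤ : Subgroup G) ≤ Subgroup.normalClosure (Set.range g) := by
      rw [← hg]; exact Subgroup.closure_le_normalClosure
    exact le_trans le_top h
  | succ n ih =>
    obtain ⟨κ, _, s, d', h1, h2, h3, h4⟩ := ih
    refine ⟨κ × ι, inferInstance, fun x => ⁅s x.1, g x.2⁆, fun x => d' x.1 + d x.2, ?_, ?_, ?_, ?_⟩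
    · intro x; exact le_add_right (h1 x.1)
    · intro x; rw [map_commutatorElement]; exact Dcomm (h2 _) (hgd _)
    · rw [pow_succ _ (n + 1), ← h3, Fintype.sum_prod_type, Finset.sum_mul_sum]
      simp only [pow_add]
    · exact le_trans (Subgroup.commutator_mono h4 le_top) (lcs_step g hg s)

theorem nil_case [Fact p.Prime] (S : Stg p Γ) {K : Subgroup Γ} {s : ℝ} (hs : Gs S.fil.D K s) (k : ℕ)
    (h1 : 1 < (3 / 4 : ℝ) ^ k * (1 + S.C.df)) (h2 : (3 / 4 : ℝ) ^ k * s < 1) :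
    ∃ M : Subgroup Γ, ∃ _ : M.Normal, Nonempty (Stg p (Γ ⧸ M)) ∧ ∃ n, dsr K n ≤ M := by
  obtain ⟨ι, _, h, d, hd1, hd2, hcl, rfl⟩ := hs
  obtain ⟨J', hJ', hle, C', hC'⟩ := scale S.fil S.C k
  have hhK : ∀ i, h i ∈ K := fun i => by rw [← hcl]; exact Subgroup.subset_closure ⟨i, rfl⟩
  let g : ι → K := fun i => ⟨h i, hhK i⟩
  have hg : Subgroup.closure (Set.range g) = ⊤ := by
    apply Subgroup.map_injective K.subtype_injective
    rw [MonoidHom.map_closure, ← Set.range_comp, ← MonoidHom.range_eq_map, Subgroup.range_subtype]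
    exact hcl
  have hσ : (∑ i, (3 / 4 : ℝ) ^ (d i + k)) < 1 := by
    simp only [pow_add]
    rw [← Finset.sum_mul, mul_comm]; exact h2
  have hσ0 : 0 ≤ (∑ i, (3 / 4 : ℝ) ^ (d i + k)) := by positivity
  have hdf : 0 < C'.df := by rw [hC']; linarith
  have hV : (0 : ℝ) < S.V.index := by
    have := S.fin.index_ne_zero
    positivity
  obtain ⟨n, hn⟩ := exists_pow_lt_of_lt_one (div_pos hdf hV) hσ
  obtain ⟨κ, _, s, d', e1, e2, e3, e4⟩ := nil_fam K.subtype hJ'.D (fun a b => hJ'.D_comm a b) g hg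
    (fun i => d i + k) (fun i => by have := hd1 i; omega) (fun i => ⟨(hd2 i).1, hle _ (hd1 i) (hd2 i).2⟩) n
  refine ⟨Subgroup.normalClosure (Set.range fun i => (s i : Γ)), inferInstance,
    mkStg S.pq hJ' C' (fun i => (s i : Γ)) d' e1 e2 ?_, n, ?_⟩
  · rw [e3]
    have : (∑ i, (3 / 4 : ℝ) ^ (d i + k)) ^ (n + 1) ≤ (∑ i, (3 / 4 : ℝ) ^ (d i + k)) ^ n :=
      pow_le_pow_of_le_one hσ0 hσ.le (by omega)
    rw [lt_div_iff₀ hV] at hn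
    nlinarith
  · have f1 : dsr K n = (derivedSeries K n).map K.subtype := by
      rw [← dsr_top, dsr_map, ← MonoidHom.range_eq_map, Subgroup.range_subtype]
    rw [f1, Subgroup.map_le_iff_le_comap]
    refine e4.trans ?_
    refine Subgroup.normalClosure_le_normal ?_
    rintro _ ⟨i, rfl⟩
    exact Subgroup.subset_normalClosure ⟨i, rfl⟩
end

end Piece11

section Piece12
open scoped Classical commutatorElement

section
variable {p : ℕ} {Γ : Type} [Group Γ]

def Ctd (S : ℕ → Stg p Γ) (H : Subgroup Γ) (i : ℕ) : Prop := H ⊓ (S i).V ≤ (S (i + 1)).V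

noncomputable def Nk (S : ℕ → Stg p Γ) (a : ℕ → ℕ) (H : Subgroup Γ) (k : ℕ) : ℝ :=
  ∏ i ∈ Finset.range k, if Ctd S H i then 1 else TT p (a i)

noncomputable def Rk (S : ℕ → Stg p Γ) (a : ℕ → ℕ) (H : Subgroup Γ) (k : ℕ) : ℝ :=
  ∏ i ∈ Finset.range k, if Ctd S H i then TT p (a i) else 1

variable {S : ℕ → Stg p Γ} {u : ℕ → Γ} {a : ℕ → ℕ} (hc : Chn S u a)
include hc

omit hc in
theorem Nk_mul_Rk (H : Subgroup Γ) (k) : Nk S a H k * Rk S a H k = ∏ i ∈ Finset.range k, TT p (a i) := by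
  rw [Nk, Rk, ← Finset.prod_mul_distrib]
  refine Finset.prod_congr rfl fun i _ => ?_
  split_ifs <;> simp

omit hc in
theorem Nk_one [hp : Fact p.Prime] (H : Subgroup Γ) (k) : 1 ≤ Nk S a H k := by
  induction k with
  | zero => simp [Nk]
  | succ k ih =>
    rw [Nk, Finset.prod_range_succ, ← Nk]
    split_ifs
    · simpa using ih
    · nlinarith [TT_one hp.out.two_le (a k)]

theorem track_all [hp : Fact p.Prime] {H : Subgroup Γ} (hH : H ≤ (S 0).V) {s0 : ℝ} (hs0 : 0 ≤ s0)
    (hs : Gs (S 0).fil.D H s0) (k : ℕ) :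
    ∃ s, s ≤ 1 + s0 * Nk S a H k ∧ Gs (S 0).fil.D (H ⊓ (S k).V) s := by
  induction k with
  | zero => exact ⟨s0, by simp [Nk], by rwa [inf_eq_left.2 hH]⟩
  | succ k ih =>
    obtain ⟨s, h1, h2⟩ := ih
    have hN : Nk S a H (k + 1) = Nk S a H k * if Ctd S H k then 1 else TT p (a k) := by
      rw [Nk, Finset.prod_range_succ, ← Nk]
    have hle : (S (k + 1)).V ≤ (S k).V := hc.anti (Nat.le_succ k)
    by_cases h : Ctd S H k
    · refine ⟨s, by rw [hN, if_pos h, mul_one]; exact h1, ?_⟩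
      have : H ⊓ (S (k + 1)).V = H ⊓ (S k).V :=
        le_antisymm (inf_le_inf_left _ hle) (le_inf inf_le_left h)
      rwa [this]
    · obtain ⟨s', h3, h4⟩ := track (S 0).fil.D_anti (fun a b => (S 0).fil.D_comm a b)
        (fun hg => by simpa using (S 0).fil.D_pow hg 1) (hc.l k).sch.a1 (fun g hg => hc.D_a hg)
        (fun g hg hg' => hc.D_succ hg hg') (fun g hg => (hc.l k).sch.vpow hg)
        (fun h hh hh' g hg => (hc.l k).sch.cos2 hh hh' hg) inf_le_right h h2
      refine ⟨s', ?_, ?_⟩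
      · rw [hN, if_neg h]
        have hT := TT_one hp.out.two_le (a k)
        have : (s - 1) * TT p (a k) ≤ (s0 * Nk S a H k) * TT p (a k) :=
          mul_le_mul_of_nonneg_right (by linarith) (by linarith)
        linarith
      · rwa [inf_assoc, inf_eq_right.2 hle] at h4

theorem unb_case [hp : Fact p.Prime] {H : Subgroup Γ} (hH : H ≤ (S 0).V) {s0 : ℝ} (hs0 : 0 ≤ s0)
    (hs : Gs (S 0).fil.D H s0) (k : ℕ) (hk : (1 + s0) < (3 / 4) * (S 0).C.df * Rk S a H k) :
    ∃ M : Subgroup Γ, ∃ _ : M.Normal, Nonempty (Stg p (Γ ⧸ M)) ∧ ∃ n, dsr (H ⊓ (S k).V) n ≤ M := by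
  obtain ⟨s, h1, h2⟩ := track_all hc hH hs0 hs k
  have hdf := hc.df_eq k
  rw [← Nk_mul_Rk H] at hdf
  have hpos := (S k).hC
  have hex : ∃ m : ℕ, (3 / 4 : ℝ) ^ m * (1 + (S k).C.df) ≤ 1 := by
    obtain ⟨m, hm⟩ := exists_pow_lt_of_lt_one (show (0 : ℝ) < 1 / (1 + (S k).C.df) by positivity)
      (show (3 / 4 : ℝ) < 1 by norm_num)
    refine ⟨m, ?_⟩
    rw [lt_div_iff₀ (by positivity)] at hm
    exact hm.le
  have hf := Nat.find_spec hex
  have hmin := fun m => Nat.find_min hex (m := m)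
  rcases hm : Nat.find hex with _ | m
  · rw [hm] at hf; simp at hf; linarith
  · rw [hm] at hf
    have h3 := hmin m (by omega)
    push Not at h3
    have hN := Nk_one (S := S) (a := a) H k
    refine nil_case (S k) (s := s) ?_ m h3 ?_
    · obtain ⟨ι, fi, h, d, hd1, hd2, hcl, hsum⟩ := h2
      refine ⟨ι, fi, h, d, hd1, fun i => ?_, hcl, hsum⟩
      have : h i ∈ (S k).V := by
        have : h i ∈ H ⊓ (S k).V := by rw [← hcl]; exact Subgroup.subset_closure ⟨i, rfl⟩
        exact this.2
      exact ⟨this, (hc.D_iff this).2 (hd2 i).2⟩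
    · have h4 : s < (3 / 4) * (1 + (S k).C.df) := by
        rw [hdf]
        nlinarith
      rw [pow_succ, mul_assoc] at hf
      have : (0 : ℝ) < (3 / 4) ^ m := by positivity
      nlinarith

theorem V_le [hp : Fact p.Prime] {H Q : Subgroup Γ} (hQ : H ≤ Q) (K L : ℕ) (hKL : K ≤ L)
    (hu : ∀ i, K ≤ i → i < L → Ctd S H i → u i ∈ Q) : (S K).V ≤ (S L).V ⊔ Q := by
  induction L, hKL using Nat.le_induction with
  | base => exact le_sup_left
  | succ L hL ih =>
    refine (ih fun i h1 h2 => hu i h1 (by omega)).trans (sup_le ?_ le_sup_right)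
    intro g hg
    by_cases h : Ctd S H L
    · obtain ⟨g', hg', c, rfl⟩ := (hc.l L).sch.cos g hg
      exact Subgroup.mul_mem_sup hg' (Q.pow_mem (hu L hL (by omega) h) _)
    · obtain ⟨x, hx, hx'⟩ := Set.not_subset.1 h
      obtain ⟨c, h1⟩ := (hc.l L).sch.cos2 hx.2 hx' hg
      have : g = g * x ^ c * (x ^ c)⁻¹ := by simp
      rw [this]
      exact Subgroup.mul_mem_sup h1 (Q.inv_mem (Q.pow_mem (hQ hx.1) _))

theorem bdd_case [hp : Fact p.Prime] [Group.FG Γ] (H : Subgroup Γ) (B : ℝ)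
    (hB : ∀ k, Rk S a H k ≤ B) :
    ∃ M : Subgroup Γ, ∃ _ : M.Normal, Nonempty (Stg p (Γ ⧸ M)) ∧ (H ⊔ M).FiniteIndex := by
  let f : ℕ → ℝ := fun i => if Ctd S H i then (3 / 4 : ℝ) ^ a i else 0
  have f0 : ∀ i, 0 ≤ f i := fun i => by dsimp only [f]; split_ifs <;> positivity
  have hR : ∀ k, 1 + ∑ i ∈ Finset.range k, f i ≤ Rk S a H k := by
    intro k
    induction k with
    | zero => simp [Rk]
    | succ k ih =>
      have h1 : Rk S a H (k + 1) = Rk S a H k * if Ctd S H k then TT p (a k) else 1 := by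
        rw [Rk, Finset.prod_range_succ, ← Rk]
      have h2 : 0 ≤ ∑ i ∈ Finset.range k, f i := Finset.sum_nonneg fun i _ => f0 i
      rw [h1, Finset.sum_range_succ]
      have h3 := f0 k
      dsimp only [f] at h3 ⊢
      split_ifs with h
      · rw [if_pos h] at h3
        have := TT_ge hp.out.two_le (a k)
        dsimp only [f] at h2 ih
        nlinarith
      · simpa using ih
  have hsum : Summable f := summable_of_sum_range_le f0 fun n => (by linarith [hR n, hB n] :
    ∑ i ∈ Finset.range n, f i ≤ B)
  have hdf := (S 0).hC
  have hV : (0 : ℝ) < (S 0).V.index := by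
    have := (S 0).fin.index_ne_zero
    positivity
  set ε := (S 0).C.df / 2 / (S 0).V.index with hε
  have ε0 : 0 < ε := by positivity
  obtain ⟨K, hK⟩ := ((hsum.hasSum.tendsto_sum_nat).eventually_const_lt
    (show ∑' i, f i - ε < ∑' i, f i by linarith)).exists
  have hfg : (S K).V.FG := (Group.fg_iff_subgroup_fg _).1 inferInstance
  obtain ⟨T, hT⟩ := hfg
  have hL : ∃ L, K ≤ L ∧ T.card * (3 / 4 : ℝ) ^ a L < ε := by
    obtain ⟨m, hm⟩ := exists_pow_lt_of_lt_one (show (0 : ℝ) < ε / (T.card + 1) by positivity)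
      (show (3 / 4 : ℝ) < 1 by norm_num)
    obtain ⟨i, hi⟩ := hc.a_unb m
    refine ⟨max K i, le_max_left _ _, ?_⟩
    have h1 : (3 / 4 : ℝ) ^ a (max K i) ≤ (3 / 4 : ℝ) ^ m :=
      pow_le_pow_of_le_one (by norm_num) (by norm_num) (hi.le.trans (hc.a_mono (le_max_right _ _)))
    rw [lt_div_iff₀ (by positivity)] at hm
    have : (0 : ℝ) < (3 / 4) ^ m := by positivity
    have h2 : T.card * (3 / 4 : ℝ) ^ a (max K i) ≤ T.card * (3 / 4 : ℝ) ^ m :=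
      mul_le_mul_of_nonneg_left h1 (by positivity)
    linarith
  obtain ⟨L, hKL, hL⟩ := hL
  let F := (Finset.Ico K L).filter (Ctd S H)
  let Q := H ⊔ Subgroup.closure (Set.range fun i : F => u i)
  have hVQ : (S K).V ≤ (S L).V ⊔ Q := V_le hc le_sup_left K L hKL fun i h1 h2 h3 =>
    (le_sup_right : _ ≤ Q) (Subgroup.subset_closure
      ⟨⟨i, Finset.mem_filter.2 ⟨Finset.mem_Ico.2 ⟨h1, h2⟩, h3⟩⟩, rfl⟩)
  have hz : ∀ v : T, ∃ z ∈ (S L).V, ∃ w ∈ Q, z * w = v := fun v => by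
    have : (v : Γ) ∈ (S K).V := by rw [← hT]; exact Subgroup.subset_closure v.2
    exact Subgroup.mem_sup_of_normal_left.1 (hVQ this)
  choose z hz w hw hzw using hz
  let s : F ⊕ T → Γ := Sum.elim (fun i => u i) z
  let d : F ⊕ T → ℕ := Sum.elim (fun i => a i) (fun _ => a L)
  refine ⟨Subgroup.normalClosure (Set.range s), inferInstance,
    mkStg (S 0).pq (S 0).fil (S 0).C s d ?_ ?_ ?_, ?_⟩
  · rintro (i | i)
    · exact (hc.l i).sch.a1
    · exact (hc.l L).sch.a1
  · rintro (i | i)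
    · exact hc.D_a (hc.u_mem i)
    · exact hc.D_a (hz i)
  · rw [Fintype.sum_sum_type]
    have e1 : ∑ i : F, (3 / 4 : ℝ) ^ d (Sum.inl i) = ∑ i ∈ Finset.Ico K L, f i := by
      rw [← Finset.sum_filter]
      exact Finset.sum_coe_sort F fun i => (3 / 4 : ℝ) ^ a i
    have e2 : ∑ i : T, (3 / 4 : ℝ) ^ d (Sum.inr i) = T.card * (3 / 4 : ℝ) ^ a L := by
      simp [d]
    rw [e1, e2, Finset.sum_Ico_eq_sub _ hKL]
    have e3 : ∑ i ∈ Finset.range L, f i ≤ ∑' i, f i := hsum.sum_le_tsum _ fun i _ => f0 i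
    have e4 : (S 0).V.index * (2 * ε) = (S 0).C.df := by rw [hε]; field_simp
    rw [← e4]
    exact mul_lt_mul_of_pos_left (by linarith) hV
  · refine Subgroup.finiteIndex_of_le (H := (S K).V) ?_
    set M := Subgroup.normalClosure (Set.range s)
    have hs : ∀ x, s x ∈ M := fun x => Subgroup.subset_normalClosure ⟨x, rfl⟩
    have hQM : Q ≤ H ⊔ M := by
      refine sup_le le_sup_left (le_trans ?_ le_sup_right)
      rw [Subgroup.closure_le]
      rintro _ ⟨i, rfl⟩
      exact hs (Sum.inl i)
    rw [← hT, Subgroup.closure_le]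
    intro v hv
    have := hzw ⟨v, hv⟩
    dsimp only at this
    rw [← this]
    exact Subgroup.mul_mem _ ((le_sup_right : M ≤ _) (hs (Sum.inr _))) (hQM (hw _))
omit hc

theorem fg_map {G G' : Type*} [Group G] [Group G'] (f : G →* G') {K : Subgroup G} (h : K.FG) : (K.map f).FG := by
  obtain ⟨T, rfl⟩ := h
  refine ⟨T.image f, ?_⟩
  rw [MonoidHom.map_closure, Finset.coe_image]

theorem taskH [hp : Fact p.Prime] [Group.FG Γ] (S0 : Stg p Γ) (H : Subgroup Γ) (hH : H.FG) :
    ∃ M : Subgroup Γ, ∃ _ : M.Normal, Nonempty (Stg p (Γ ⧸ M)) ∧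
      ((∃ W : Subgroup Γ, W.FiniteIndex ∧ ∃ n, dsr (H ⊓ W) n ≤ M) ∨ (H ⊔ M).FiniteIndex) := by
  obtain ⟨S, u, a, rfl, hc⟩ := exists_chain S0
  replace hc : Chn S u a := ⟨hc⟩
  have hfg : (H ⊓ (S 0).V).FG := by
    have h1 : Group.FG H := (Group.fg_iff_subgroup_fg _).2 hH
    have h2 : Group.FG ((S 0).V.subgroupOf H) := inferInstance
    have h3 := (Group.fg_iff_subgroup_fg _).1 h2
    have := fg_map H.subtype h3
    rwa [Subgroup.subgroupOf_map_subtype, inf_comm] at this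
  obtain ⟨T, hT⟩ := hfg
  have hs : Gs (S 0).fil.D (H ⊓ (S 0).V) (∑ _i : T, (3 / 4 : ℝ) ^ 1) := by
    refine ⟨T, inferInstance, fun i => i, fun _ => 1, fun _ => le_rfl, fun i => ?_, ?_, rfl⟩
    · rw [Fil.D_one]
      have : (i : Γ) ∈ H ⊓ (S 0).V := by rw [← hT]; exact Subgroup.subset_closure i.2
      exact this.2
    · rw [← hT]; congr 1; ext; simp
  have hs0 : (0 : ℝ) ≤ ∑ _i : T, (3 / 4 : ℝ) ^ 1 := by positivity
  set s0 := ∑ _i : T, (3 / 4 : ℝ) ^ 1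
  by_cases h : ∃ k, (1 + s0) < (3 / 4) * (S 0).C.df * Rk S a (H ⊓ (S 0).V) k
  · obtain ⟨k, hk⟩ := h
    obtain ⟨M, hM, h1, n, h2⟩ := unb_case hc inf_le_right hs0 hs k hk
    refine ⟨M, hM, h1, Or.inl ⟨(S 0).V ⊓ (S k).V, inferInstance, n, ?_⟩⟩
    rwa [← inf_assoc]
  · push Not at h
    have hdf := (S 0).hC
    obtain ⟨M, hM, h1, h2⟩ := bdd_case hc (H ⊓ (S 0).V) ((1 + s0) / ((3 / 4) * (S 0).C.df)) fun k => by
      rw [le_div_iff₀ (by positivity), mul_comm]; exact h k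
    exact ⟨M, hM, h1, Or.inr (Subgroup.finiteIndex_of_le (H := H ⊓ (S 0).V ⊔ M) (sup_le_sup_right inf_le_left M))⟩

theorem taskT [hp : Fact p.Prime] (S0 : Stg p Γ) (g : Γ) :
    ∃ M : Subgroup Γ, ∃ _ : M.Normal, Nonempty (Stg p (Γ ⧸ M)) ∧ ∃ n, g ^ p ^ n ∈ M := by
  obtain ⟨m, hm⟩ := S0.pq g
  have hV : (0 : ℝ) < S0.V.index := by
    have := S0.fin.index_ne_zero
    positivity
  obtain ⟨l, hl⟩ := exists_pow_lt_of_lt_one (div_pos S0.hC hV) (show (3 / 4 : ℝ) < 1 by norm_num)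
  have h1 := S0.fil.D_pow (by rwa [S0.fil.D_one] : g ^ p ^ m ∈ S0.fil.D 1) l
  refine ⟨Subgroup.normalClosure (Set.range fun _ : Unit => (g ^ p ^ m) ^ p ^ l), inferInstance,
    mkStg S0.pq S0.fil S0.C _ (fun _ => p ^ l * 1) ?_ (fun _ => h1) ?_, m + l, ?_⟩
  · intro _; have := pow_pos hp.out.pos l; omega
  · have h2 : l ≤ p ^ l * 1 := by rw [mul_one]; exact (Nat.lt_pow_self hp.out.one_lt).le
    have h3 : (3 / 4 : ℝ) ^ (p ^ l * 1) ≤ (3 / 4 : ℝ) ^ l := pow_le_pow_of_le_one (by norm_num) (by norm_num) h2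
    rw [lt_div_iff₀ hV] at hl
    simp only [Finset.univ_unique, Finset.sum_const, Finset.card_singleton, one_smul]
    nlinarith
  · refine Subgroup.subset_normalClosure ⟨(), ?_⟩
    rw [← pow_mul, ← pow_add]
end

end Piece12

section Piece13
open scoped Classical commutatorElement

abbrev F2 := FreeGroup (Fin 2)

section
variable {p : ℕ}

theorem down_one [hp : Fact p.Prime] {G : Type} [Group G] (X : Subgroup G) [X.Normal] {k : ℕ}
    (h : X.index = p ^ (k + 1)) : ∃ Y : Subgroup G, Y.Normal ∧ X ≤ Y ∧ Y.index = p ^ k := by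
  have hcard : Nat.card (G ⧸ X) = p ^ (k + 1) := h
  have hfin : Finite (G ⧸ X) := Nat.finite_of_card_ne_zero (by rw [hcard]; exact (pow_pos hp.out.pos _).ne')
  have hG : IsPGroup p (G ⧸ X) := IsPGroup.of_card hcard
  have : Nontrivial (G ⧸ X) := by
    rw [← Finite.one_lt_card_iff_nontrivial, hcard]
    exact Nat.one_lt_pow (by omega) hp.out.one_lt
  have hZ := hG.center_nontrivial
  have hZp : IsPGroup p (Subgroup.center (G ⧸ X)) := hG.to_subgroup _
  obtain ⟨n, hn⟩ := IsPGroup.iff_card.1 hZp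
  have hn0 : n ≠ 0 := by
    rintro rfl
    have := Finite.one_lt_card_iff_nontrivial.2 hZ
    rw [hn] at this; simp at this
  obtain ⟨z, hz⟩ := exists_prime_orderOf_dvd_card' p (G := Subgroup.center (G ⧸ X)) (by rw [hn]; exact dvd_pow_self p hn0)
  let Z := Subgroup.zpowers (z : G ⧸ X)
  have hZn : Z.Normal := ⟨by
    intro n hn g
    have : n ∈ Subgroup.center (G ⧸ X) := (Subgroup.zpowers_le.2 z.2) hn
    rw [Subgroup.mem_center_iff.1 this g, mul_inv_cancel_right]
    exact hn⟩
  refine ⟨Z.comap (QuotientGroup.mk' X), inferInstance, ?_, ?_⟩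
  · intro x hx
    rw [Subgroup.mem_comap, show QuotientGroup.mk' X x = 1 from (QuotientGroup.eq_one_iff _).2 hx]
    exact Z.one_mem
  · rw [Subgroup.index_comap_of_surjective _ (QuotientGroup.mk'_surjective _)]
    have h1 := Subgroup.card_mul_index Z
    rw [hcard, Nat.card_zpowers, Subgroup.orderOf_coe, hz, pow_succ, mul_comm] at h1
    exact Nat.eq_of_mul_eq_mul_right hp.out.pos h1

theorem down [hp : Fact p.Prime] {G : Type} [Group G] {n m : ℕ} (hmn : m ≤ n) (X : Subgroup G) (hX : X.Normal)
    (h : X.index = p ^ n) : ∃ Y : Subgroup G, Y.Normal ∧ X ≤ Y ∧ Y.index = p ^ m := by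
  induction n, hmn using Nat.le_induction generalizing X with
  | base => exact ⟨X, hX, le_rfl, h⟩
  | succ n hn ih =>
    obtain ⟨Y, h1, h2, h3⟩ := down_one X h
    obtain ⟨Z, h4, h5, h6⟩ := ih Y h1 h3
    exact ⟨Z, h4, h2.trans h5, h6⟩

theorem finite_index_set (n : ℕ) (hn : n ≠ 0) : {Y : Subgroup F2 | Y.index = n}.Finite := by
  let T : ((Fin 2 → Equiv.Perm (Fin n)) × Fin n) → Subgroup F2 := fun x =>
    (MulAction.stabilizer (Equiv.Perm (Fin n)) x.2).comap (FreeGroup.lift x.1)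
  refine (Set.finite_range T).subset ?_
  intro Y hY
  have hY : Nat.card (F2 ⧸ Y) = n := hY
  have hfin : Finite (F2 ⧸ Y) := Nat.finite_of_card_ne_zero (by rw [hY]; exact hn)
  let eqv : (F2 ⧸ Y) ≃ Fin n := Finite.equivFinOfCardEq hY
  let φ : F2 →* Equiv.Perm (Fin n) := (Equiv.permCongrHom eqv).toMonoidHom.comp (MulAction.toPermHom F2 (F2 ⧸ Y))
  refine ⟨(fun i => φ (FreeGroup.of i), eqv ((1 : F2) : F2 ⧸ Y)), ?_⟩
  have hφ : FreeGroup.lift (fun i => φ (FreeGroup.of i)) = φ := by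
    ext i : 1; simp
  ext g
  simp only [T, Subgroup.mem_comap, hφ, MulAction.mem_stabilizer_iff]
  have : φ g • eqv ((1 : F2) : F2 ⧸ Y) = eqv (g : F2 ⧸ Y) := by
    simp [φ, Equiv.permCongrHom, Equiv.permCongr_apply]
  rw [this, eqv.injective.eq_iff, QuotientGroup.eq, mul_one, Subgroup.inv_mem_iff]

variable (p) in
def PP (N : Subgroup F2) : Prop := ∀ m, ∃ X : Subgroup F2, X.Normal ∧ N ≤ X ∧ X.index = p ^ m

theorem PP_chain [hp : Fact p.Prime] (c : Set (Subgroup F2)) (hc : IsChain (· ≤ ·) c) (hne : c.Nonempty)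
    (h : ∀ N ∈ c, PP p N) : PP p (sSup c) := by
  intro m
  by_contra hcon
  push Not at hcon
  have hfin := finite_index_set (p ^ m) (pow_pos hp.out.pos _).ne'
  have h1 : ∀ Y ∈ {Y : Subgroup F2 | Y.index = p ^ m}, ∃ N ∈ c, ¬ (Y.Normal ∧ N ≤ Y) := by
    intro Y hY
    by_contra h2
    push Not at h2
    obtain ⟨N, hN⟩ := hne
    exact hcon Y (h2 N hN).1 (sSup_le fun N hN => (h2 N hN).2) hY
  choose! f hf hf' using h1
  have : ∃ N ∈ c, ∀ Y ∈ {Y : Subgroup F2 | Y.index = p ^ m}, f Y ≤ N := by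
    refine hfin.induction_on_subset (motive := fun s _ => ∃ N ∈ c, ∀ Y ∈ s, f Y ≤ N) _ ?_ ?_
    · exact ⟨_, hne.some_mem, by simp⟩
    · rintro Y s hY hs _ ⟨N, hN, hN'⟩
      rcases hc.total hN (hf Y hY) with h3 | h3
      · refine ⟨f Y, hf Y hY, ?_⟩
        rintro Z (rfl | hZ)
        · exact le_rfl
        · exact (hN' Z hZ).trans h3
      · refine ⟨N, hN, ?_⟩
        rintro Z (rfl | hZ)
        · exact h3
        · exact hN' Z hZ
  obtain ⟨N, hN, hN'⟩ := this
  obtain ⟨X, hX1, hX2, hX3⟩ := h N hN m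
  exact hf' X hX3 ⟨hX1, (hN' X hX3).trans hX2⟩

/-- compactness -/
theorem compact_fg [hp : Fact p.Prime] {N K : Subgroup F2} (hK : K.Normal) (hKP : ¬ PP p K) :
    ∃ m, ∃ T : Finset F2, (T : Set F2) ⊆ K ∧ ∀ (n : ℕ) (X : Subgroup F2), X.Normal → N ≤ X → X.index = p ^ n →
      (Subgroup.closure (T : Set F2) ⊔ X).index < p ^ m := by
  obtain ⟨m, hm⟩ := not_forall.1 hKP
  refine ⟨m, ?_⟩
  have hfin := finite_index_set (p ^ m) (pow_pos hp.out.pos _).ne'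
  set A := {Y : Subgroup F2 | Y.index = p ^ m}
  have h1 : ∀ Y ∈ A, (∃ (n : ℕ) (X : Subgroup F2), X.Normal ∧ X ≤ Y ∧ X.index = p ^ n) → ∃ y ∈ K, y ∉ Y := by
    rintro Y hY ⟨n, X, hX, hXY, hXi⟩
    by_contra hcon
    push Not at hcon
    have hcK : K ≤ Y.normalCore := Subgroup.normal_le_normalCore.2 hcon
    have hcX : X ≤ Y.normalCore := Subgroup.normal_le_normalCore.2 hXY
    have h2 := Subgroup.index_dvd_of_le hcX
    rw [hXi, Nat.dvd_prime_pow hp.out] at h2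
    obtain ⟨l, -, hl⟩ := h2
    have h3 := Subgroup.index_dvd_of_le (Subgroup.normalCore_le Y)
    have hY' : Y.index = p ^ m := hY
    rw [hl, hY', Nat.pow_dvd_pow_iff_le_right hp.out.one_lt] at h3
    obtain ⟨Z, h4, h5, h6⟩ := down h3 _ inferInstance hl
    exact hm ⟨Z, h4, hcK.trans h5, h6⟩
  have h1' : ∀ Y : Subgroup F2, ∃ y ∈ K, Y ∈ A → (∃ (n : ℕ) (X : Subgroup F2), X.Normal ∧ X ≤ Y ∧ X.index = p ^ n) →
      y ∉ Y := by
    intro Y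
    by_cases h : Y ∈ A ∧ (∃ (n : ℕ) (X : Subgroup F2), X.Normal ∧ X ≤ Y ∧ X.index = p ^ n)
    · obtain ⟨y, hy, hy'⟩ := h1 Y h.1 h.2
      exact ⟨y, hy, fun _ _ => hy'⟩
    · exact ⟨1, K.one_mem, fun h2 h3 => (h ⟨h2, h3⟩).elim⟩
  choose y hyK hy using h1'
  refine ⟨hfin.toFinset.image y, ?_, ?_⟩
  · intro x hx
    simp only [Finset.coe_image, Set.mem_image] at hx
    obtain ⟨Y, -, rfl⟩ := hx
    exact hyK Y
  · intro n X hX _ hXi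
    by_contra hcon
    push Not at hcon
    set H := Subgroup.closure ((hfin.toFinset.image y : Finset F2) : Set F2)
    have hcard : Nat.card (F2 ⧸ X) = p ^ n := hXi
    have hf : Finite (F2 ⧸ X) := Nat.finite_of_card_ne_zero (by rw [hcard]; exact (pow_pos hp.out.pos _).ne')
    have hG : IsPGroup p (F2 ⧸ X) := IsPGroup.of_card hcard
    obtain ⟨r, hr⟩ := IsPGroup.iff_card.1 (hG.to_subgroup (H.map (QuotientGroup.mk' X)))
    have hidx : (H.map (QuotientGroup.mk' X)).index = (H ⊔ X).index := by
      rw [Subgroup.index_map, QuotientGroup.ker_mk', (MonoidHom.range_eq_top.2 (QuotientGroup.mk'_surjective _)),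
        Subgroup.index_top, mul_one]
    have h2 := Subgroup.card_mul_index (H.map (QuotientGroup.mk' X))
    rw [hr, hidx, hcard] at h2
    have h3 : p ^ r * p ^ m ≤ p ^ n := by rw [← h2]; exact Nat.mul_le_mul_left _ hcon
    rw [← pow_add, Nat.pow_le_pow_iff_right hp.out.one_lt] at h3
    obtain ⟨Z, hZ1, hZ2⟩ := Sylow.exists_subgroup_card_pow_prime_le (n := r) (m := n - m) p
      (by rw [hcard]; exact pow_dvd_pow _ (by omega)) _ hr (by omega)
    have hZi : Z.index = p ^ m := by
      have := Subgroup.card_mul_index Z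
      rw [hZ1, hcard] at this
      have h5 : p ^ n = p ^ (n - m) * p ^ m := by rw [← pow_add]; congr 1; omega
      rw [h5] at this
      exact Nat.eq_of_mul_eq_mul_left (pow_pos hp.out.pos _) this
    let Y := Z.comap (QuotientGroup.mk' X)
    have hYA : Y ∈ A := by
      change Y.index = p ^ m
      rw [Subgroup.index_comap_of_surjective _ (QuotientGroup.mk'_surjective _), hZi]
    have hHY : H ≤ Y := Subgroup.map_le_iff_le_comap.1 hZ2
    refine hy Y hYA ⟨n, X, hX, ?_, hXi⟩ (hHY (Subgroup.subset_closure ?_))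
    · intro x hx
      change QuotientGroup.mk' X x ∈ Z
      rw [show QuotientGroup.mk' X x = 1 from (QuotientGroup.eq_one_iff _).2 hx]
      exact Z.one_mem
    · rw [Finset.coe_image]
      exact ⟨Y, by simpa using hYA, rfl⟩
end

end Piece13

section Piece14
open scoped Classical commutatorElement

section
variable {p : ℕ}

variable (p) in
def Cl (N : Subgroup F2) : Prop := ∃ (Q : Type) (_ : Group Q) (f : F2 →* Q),
  Function.Surjective f ∧ f.ker = N ∧ Nonempty (Stg p Q)

def Good {G : Type*} [Group G] (H N : Subgroup G) : Prop :=
  (∃ W : Subgroup G, W.FiniteIndex ∧ ∃ n, dsr (H ⊓ W) n ≤ N) ∨ (H ⊔ N).FiniteIndex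

theorem Good.mono {G : Type*} [Group G] {H N N' : Subgroup G} (h : Good H N) (hN : N ≤ N') : Good H N' := by
  rcases h with ⟨W, hW, n, hn⟩ | h
  · exact Or.inl ⟨W, hW, n, hn.trans hN⟩
  · exact Or.inr (Subgroup.finiteIndex_of_le (H := H ⊔ N) (sup_le_sup_left hN H))

theorem Cl_bot [Fact p.Prime] : Cl p ⊥ := by
  obtain ⟨J, hJ, C, hC⟩ := base_exists p
  refine ⟨F2, inferInstance, MonoidHom.id _, Function.surjective_id, ?_, ⟨⟨⊤, J, inferInstance, inferInstance,
    fun g => ⟨0, trivial⟩, hJ, C, hC⟩⟩⟩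
  exact (MonoidHom.ker_eq_bot_iff _).2 Function.injective_id

theorem Cl.normal {N : Subgroup F2} (h : Cl p N) : N.Normal := by
  obtain ⟨Q, _, f, hf, rfl, -⟩ := h
  infer_instance

theorem Cl.PP [hp : Fact p.Prime] {N : Subgroup F2} (h : Cl p N) : PP p N := by
  obtain ⟨Q, _, f, hf, rfl, ⟨S⟩⟩ := h
  intro m
  obtain ⟨h1, h2⟩ := S.fil.gs S.C S.hC
  obtain ⟨n, hn⟩ := h2 (p ^ m)
  have hnor : (S.fil.D n).Normal := S.fil.D_normal n
  have hrel : (S.fil.D n).index = (S.fil.D n).relIndex S.V * S.V.index :=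
    (Subgroup.relIndex_mul_index (S.fil.D_le n)).symm
  have hne : (S.fil.D n).index ≠ 0 := by
    rw [hrel]; exact mul_ne_zero (h1 n) S.fin.index_ne_zero
  have hfin : Finite (Q ⧸ S.fil.D n) := Nat.finite_of_card_ne_zero hne
  have hG : IsPGroup p (Q ⧸ S.fil.D n) := by
    intro g
    obtain ⟨g, rfl⟩ := QuotientGroup.mk_surjective g
    obtain ⟨k, hk⟩ := S.pq g
    have h3 := S.fil.D_pow (by rwa [S.fil.D_one] : g ^ p ^ k ∈ S.fil.D 1) n
    refine ⟨k + n, ?_⟩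
    rw [← QuotientGroup.mk_pow, QuotientGroup.eq_one_iff, pow_add, pow_mul]
    refine S.fil.D_anti ?_ h3
    rw [mul_one]; exact (Nat.lt_pow_self hp.out.one_lt).le
  obtain ⟨r, hr⟩ := IsPGroup.iff_card.1 hG
  have hr' : (S.fil.D n).index = p ^ r := hr
  have hmr : m ≤ r := by
    have : p ^ m < p ^ r := by
      rw [← hr', hrel]
      exact lt_of_lt_of_le hn (Nat.le_mul_of_pos_right _ (Nat.pos_of_ne_zero S.fin.index_ne_zero))
    exact ((Nat.pow_lt_pow_iff_right hp.out.one_lt).1 this).le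
  obtain ⟨Y, h4, h5, h6⟩ := down hmr _ hnor hr'
  refine ⟨Y.comap f, inferInstance, fun x hx => ?_, ?_⟩
  · rw [Subgroup.mem_comap, (MonoidHom.mem_ker).1 hx]; exact Y.one_mem
  · rw [Subgroup.index_comap_of_surjective _ hf, h6]

theorem Cl_of_quot {Q : Type} [Group Q] {f : F2 →* Q} (hf : Function.Surjective f) (M : Subgroup Q) [M.Normal]
    (h : Nonempty (Stg p (Q ⧸ M))) : f.ker ≤ M.comap f ∧ Cl p (M.comap f) := by
  refine ⟨fun x hx => ?_, Q ⧸ M, inferInstance, (QuotientGroup.mk' M).comp f,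
    (QuotientGroup.mk'_surjective M).comp hf, ?_, h⟩
  · rw [Subgroup.mem_comap, (MonoidHom.mem_ker).1 hx]; exact M.one_mem
  · rw [← MonoidHom.comap_ker, QuotientGroup.ker_mk']

theorem Cl.taskT [hp : Fact p.Prime] {N : Subgroup F2} (h : Cl p N) (g : F2) :
    ∃ N', N ≤ N' ∧ Cl p N' ∧ ∃ n, g ^ p ^ n ∈ N' := by
  obtain ⟨Q, _, f, hf, rfl, ⟨S⟩⟩ := h
  obtain ⟨M, hM, h1, n, h2⟩ := _root_.taskT S (f g)
  obtain ⟨h3, h4⟩ := Cl_of_quot hf M h1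
  exact ⟨_, h3, h4, n, by rwa [Subgroup.mem_comap, map_pow]⟩

theorem Cl.taskH [hp : Fact p.Prime] {N : Subgroup F2} (h : Cl p N) (H : Subgroup F2) (hH : H.FG) :
    ∃ N', N ≤ N' ∧ Cl p N' ∧ Good H N' := by
  obtain ⟨Q, _, f, hf, rfl, ⟨S⟩⟩ := h
  have : Group.FG Q := Group.fg_of_surjective hf
  obtain ⟨M, hM, h1, h2⟩ := _root_.taskH S (H.map f) (fg_map f hH)
  obtain ⟨h3, h4⟩ := Cl_of_quot hf M h1
  refine ⟨_, h3, h4, ?_⟩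
  rcases h2 with ⟨W, hW, n, hn⟩ | h2
  · refine Or.inl ⟨W.comap f, ⟨?_⟩, n, ?_⟩
    · rw [Subgroup.index_comap_of_surjective _ hf]; exact hW.index_ne_zero
    · rw [← Subgroup.map_le_iff_le_comap, dsr_map]
      refine (dsr_mono ?_ n).trans hn
      exact (Subgroup.map_inf_le _ _ f).trans (inf_le_inf_left _ (Subgroup.map_comap_le f W))
  · refine Or.inr ?_
    have h5 : H ⊔ M.comap f = (H.map f ⊔ M).comap f := by
      have h6 : (H ⊔ M.comap f).map f = H.map f ⊔ M := by
        rw [Subgroup.map_sup, Subgroup.map_comap_eq_self_of_surjective hf]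
      rw [← h6, Subgroup.comap_map_eq, eq_comm, sup_eq_left]
      exact h3.trans le_sup_right
    rw [h5]
    exact ⟨by rw [Subgroup.index_comap_of_surjective _ hf]; exact h2.index_ne_zero⟩

theorem exists_N (p : ℕ) [hp : Fact p.Prime] : ∃ N : Subgroup F2, N.Normal ∧ PP p N ∧ (∀ g, ∃ n, g ^ p ^ n ∈ N) ∧
    (∀ H : Subgroup F2, H.FG → Good H N) ∧ ∀ K : Subgroup F2, K.Normal → N < K → ¬ PP p K := by
  have hcnt : Countable F2 := inferInstanceAs (Countable (Quot _))
  obtain ⟨t, ht⟩ := exists_surjective_nat (F2 × Finset F2)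
  have step : ∀ (N : {N : Subgroup F2 // Cl p N}) (x : F2 × Finset F2), ∃ N' : {N : Subgroup F2 // Cl p N},
      N.1 ≤ N'.1 ∧ (∃ n, x.1 ^ p ^ n ∈ N'.1) ∧ Good (Subgroup.closure (x.2 : Set F2)) N'.1 := by
    rintro ⟨N, hN⟩ ⟨g, T⟩
    obtain ⟨N1, h1, h2, n, h3⟩ := hN.taskT g
    obtain ⟨N2, h4, h5, h6⟩ := h2.taskH (Subgroup.closure (T : Set F2)) ⟨T, rfl⟩
    exact ⟨⟨N2, h5⟩, h1.trans h4, ⟨n, h4 h3⟩, h6⟩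
  choose nx hnx1 hnx2 hnx3 using step
  let s : ℕ → {N : Subgroup F2 // Cl p N} := fun k => Nat.rec ⟨⊥, Cl_bot⟩ (fun i N => nx N (t i)) k
  have hs : ∀ k, s (k + 1) = nx (s k) (t k) := fun k => rfl
  have hmono : Monotone (fun k => (s k).1) := monotone_nat_of_le_succ fun k => by rw [hs]; exact hnx1 _ _
  let c0 : Set (Subgroup F2) := Set.range fun k => (s k).1
  have hc0 : IsChain (· ≤ ·) c0 := hmono.isChain_range
  have hsup : ∀ k, (s k).1 ≤ sSup c0 := fun k => le_sSup ⟨k, rfl⟩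
  have norm_sup : ∀ c : Set (Subgroup F2), (∀ N ∈ c, N.Normal) → (sSup c).Normal := by
    intro c hc
    rw [sSup_eq_iSup']
    have : ∀ i : c, (i : Subgroup F2).Normal := fun i => hc i i.2
    exact Subgroup.iSup_normal _
  have h0n : (sSup c0).Normal := norm_sup _ (by rintro _ ⟨k, rfl⟩; exact (s k).2.normal)
  have h0P : PP p (sSup c0) := PP_chain c0 hc0 ⟨_, 0, rfl⟩ (by rintro _ ⟨k, rfl⟩; exact (s k).2.PP)
  obtain ⟨N, hN0, hN⟩ := zorn_le_nonempty₀ {N : Subgroup F2 | N.Normal ∧ PP p N} (by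
    intro c hc hch y hy
    exact ⟨sSup c, ⟨norm_sup c fun N hN => (hc hN).1, PP_chain c hch ⟨y, hy⟩ fun N hN => (hc hN).2⟩,
      fun z hz => le_sSup hz⟩) (sSup c0) ⟨h0n, h0P⟩
  refine ⟨N, hN.prop.1, hN.prop.2, ?_, ?_, ?_⟩
  · intro g
    obtain ⟨k, hk⟩ := ht (g, ∅)
    obtain ⟨n, hn⟩ := hnx2 (s k) (t k)
    rw [hk, ← hk, ← hs] at hn
    refine ⟨n, hN0 (hsup (k + 1) ?_)⟩
    rw [hk] at hn; exact hn
  · rintro H ⟨T, rfl⟩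
    obtain ⟨k, hk⟩ := ht (1, T)
    have hn := hnx3 (s k) (t k)
    rw [← hs, hk] at hn
    exact hn.mono ((hsup (k + 1)).trans hN0)
  · intro K hK hlt hP
    exact hlt.not_ge (hN.le_of_ge ⟨hK, hP⟩ hlt.le)
end

end Piece14

section Piece15
open scoped Classical commutatorElement

section
variable {G : Type} [Group G]

theorem fin_of_rel {H W : Subgroup G} (h : W.relIndex H ≠ 0) (hf : Finite ↥(H ⊓ W)) : Finite H := by
  have h1 : (W.subgroupOf H).FiniteIndex := ⟨h⟩
  have h2 : Finite (W.subgroupOf H) := by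
    refine Finite.of_injective (fun x => (⟨x.1.1, x.1.2, x.2⟩ : ↥(H ⊓ W))) ?_
    intro x y hxy
    exact Subtype.ext (Subtype.ext (congrArg (fun z : ↥(H ⊓ W) => (z : G)) hxy))
  have h3 := Subgroup.card_mul_index (W.subgroupOf H)
  refine Nat.finite_of_card_ne_zero ?_
  rw [← h3]
  exact mul_ne_zero (Nat.card_pos).ne' h

theorem fg_of_rel {H W : Subgroup G} (hH : H.FG) (h : W.relIndex H ≠ 0) : (H ⊓ W).FG := by
  have h1 : (W.subgroupOf H).FiniteIndex := ⟨h⟩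
  have h2 : Group.FG H := (Group.fg_iff_subgroup_fg _).2 hH
  have h3 : Group.FG (W.subgroupOf H) := inferInstance
  have := fg_map H.subtype ((Group.fg_iff_subgroup_fg _).1 h3)
  rwa [Subgroup.subgroupOf_map_subtype, inf_comm] at this

theorem fin_of_fi [hfi : Infinite G] {H : Subgroup G} (h : H.FiniteIndex) (hf : Finite H) : False := by
  have h1 := Subgroup.card_mul_index H
  rw [Nat.card_eq_zero_of_infinite (α := G)] at h1
  exact mul_ne_zero (Nat.card_pos).ne' h.index_ne_zero h1

theorem dsr_finite (ht : ∀ g : G, IsOfFinOrder g) (n : ℕ) (K : Subgroup G) (hK : K.FG) (h : dsr K n = ⊥) :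
    Finite K := by
  induction n generalizing K with
  | zero =>
    have : K = ⊥ := h
    rw [this]; infer_instance
  | succ n ih =>
    have h2 : Group.FG K := (Group.fg_iff_subgroup_fg _).2 hK
    have h3 : Group.FG (Abelianization K) := Group.fg_of_surjective (f := Abelianization.of) QuotientGroup.mk_surjective
    have h4 : Finite (Abelianization K) := CommGroup.finite_of_fg_isMulTorsion _ (by
      have h5 : IsMulTorsion K := IsMulTorsion.subgroup ht K
      exact h5.of_surjective (f := Abelianization.of) QuotientGroup.mk_surjective)
    have h5 : (commutator K).FiniteIndex := 
      haveI : Finite (K ⧸ commutator K) := h4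
      Subgroup.finiteIndex_of_finite_quotient (H := commutator K)
    have h6 : (⁅K, K⁆ : Subgroup G) ≤ K := by
      rw [← Subgroup.map_subtype_commutator]; exact Subgroup.map_subtype_le _
    have h7 : (⁅K, K⁆ : Subgroup G).relIndex K ≠ 0 := by
      have : (⁅K, K⁆ : Subgroup G).subgroupOf K = commutator K := by
        rw [← Subgroup.map_subtype_commutator]
        exact Subgroup.comap_map_eq_self_of_injective K.subtype_injective _
      rw [Subgroup.relIndex, this]; exact h5.index_ne_zero
    have h8 := fg_of_rel hK h7
    rw [inf_eq_right.2 h6] at h8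
    have h9 := ih _ h8 h
    refine fin_of_rel h7 ?_
    rw [inf_eq_right.2 h6]; exact h9

def LFn (A : Subgroup G) : Prop := ∀ H ≤ A, H.FG → Finite H

theorem LFn_sup {A B : Subgroup G} [B.Normal] (hA : LFn A) (hB : LFn B) : LFn (A ⊔ B) := by
  intro H hH hfg
  have h1 : Finite (H.map (QuotientGroup.mk' B)) := by
    obtain ⟨T, rfl⟩ := hfg
    have h2 : ∀ t : T, ∃ x ∈ A, QuotientGroup.mk' B x = QuotientGroup.mk' B t := by
      intro t
      obtain ⟨y, hy, z, hz, h⟩ := Subgroup.mem_sup_of_normal_right.1 (hH (Subgroup.subset_closure t.2))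
      refine ⟨y, hy, ?_⟩
      rw [← h, map_mul, show QuotientGroup.mk' B z = 1 from (QuotientGroup.eq_one_iff _).2 hz, mul_one]
    choose x hx hx' using h2
    have h3 : Finite (Subgroup.closure (Set.range x)) := hA _ (by
      rw [Subgroup.closure_le]; rintro _ ⟨t, rfl⟩; exact hx t) ⟨Finset.univ.image x, by simp⟩
    have h4 : (Subgroup.closure (T : Set G)).map (QuotientGroup.mk' B) =
        (Subgroup.closure (Set.range x)).map (QuotientGroup.mk' B) := by
      rw [MonoidHom.map_closure, MonoidHom.map_closure, ← Set.range_comp]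
      congr 1
      ext y
      constructor
      · rintro ⟨t, ht, rfl⟩; exact ⟨⟨t, ht⟩, hx' ⟨t, ht⟩⟩
      · rintro ⟨t, rfl⟩; exact ⟨t, t.2, (hx' t).symm⟩
    rw [h4]
    exact Set.Finite.image _ (Set.toFinite _)
  have h5 : B.relIndex H ≠ 0 := by
    have := Subgroup.relIndex_ker (K := H) (QuotientGroup.mk' B)
    rw [QuotientGroup.ker_mk'] at this
    rw [this]
    exact (Nat.card_pos).ne'
  exact fin_of_rel h5 (hB _ inf_le_right (fg_of_rel hfg h5))

theorem LFn_sSup {c : Set (Subgroup G)} (hc : c.Finite) (hn : ∀ A ∈ c, A.Normal) (hL : ∀ A ∈ c, LFn A) :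
    LFn (sSup c) := by
  have : LFn (sSup c) ∧ (sSup c).Normal := by
    refine hc.induction_on_subset (motive := fun s _ => LFn (sSup s) ∧ (sSup s).Normal) _ ?_ ?_
    · rw [sSup_empty]
      refine ⟨fun H hH _ => ?_, inferInstance⟩
      rw [le_bot_iff.1 hH]; infer_instance
    · rintro A s hA _ _ ⟨h1, h2⟩
      rw [sSup_insert]
      have := hn A hA
      exact ⟨LFn_sup (hL A hA) h1, inferInstance⟩
  exact this.1

theorem LFn_map {G' : Type} [Group G'] (f : G →* G') {A : Subgroup G} (hA : LFn A) : LFn (A.map f) := by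
  rintro H hH ⟨T, rfl⟩
  have h2 : ∀ t : T, ∃ x ∈ A, f x = t := fun t => hH (Subgroup.subset_closure t.2)
  choose x hx hx' using h2
  have h3 : Finite (Subgroup.closure (Set.range x)) := hA _ (by
    rw [Subgroup.closure_le]; rintro _ ⟨t, rfl⟩; exact hx t) ⟨Finset.univ.image x, by simp⟩
  have h4 : Subgroup.closure (T : Set G') = (Subgroup.closure (Set.range x)).map f := by
    rw [MonoidHom.map_closure, ← Set.range_comp]
    congr 1
    ext y
    constructor
    · intro hy; exact ⟨⟨y, hy⟩, hx' _⟩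
    · rintro ⟨t, rfl⟩; rw [Function.comp, hx']; exact t.2
  rw [h4]
  exact Set.Finite.image _ (Set.toFinite _)

theorem her [Group.FG G] [Infinite G] (ht : ∀ g : G, IsOfFinOrder g)
    (hd : ∀ H : Subgroup G, H.FG → Finite H ∨ H.FiniteIndex)
    (hj : ∀ N : Subgroup G, N.Normal → N ≠ ⊥ → N.FiniteIndex)
    (U : Subgroup G) [hU : U.FiniteIndex] (A : Subgroup G) (hA1 : A ≠ ⊥)
    (hAn : ∀ u ∈ U, ∀ x ∈ A, u * x * u⁻¹ ∈ A) : A.FiniteIndex := by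
  by_contra hfi
  have hL : LFn A := fun H hH hfg => (hd H hfg).resolve_right fun h =>
    hfi (Subgroup.finiteIndex_of_le hH)
  let L := U.normalCore
  have hLU : L ≤ U := Subgroup.normalCore_le U
  by_cases h0 : A ⊓ L = ⊥
  · -- centralizer
    let C := Subgroup.centralizer (L : Set G)
    have hAC : A ≤ C := by
      intro x hx
      refine Subgroup.mem_centralizer_iff.2 fun y hy => ?_
      have h1 : y * x * y⁻¹ * x⁻¹ ∈ A ⊓ L := by
        refine ⟨A.mul_mem (hAn y (hLU hy) x hx) (A.inv_mem hx), ?_⟩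
        have : y * x * y⁻¹ * x⁻¹ = y * (x * y⁻¹ * x⁻¹) := by simp only [mul_assoc]
        rw [this]
        exact L.mul_mem hy (Subgroup.Normal.conj_mem inferInstance _ (L.inv_mem hy) x)
      rw [h0, Subgroup.mem_bot] at h1
      have h2 := mul_inv_eq_one.1 h1
      exact mul_inv_eq_iff_eq_mul.1 h2
    have hC : C.FiniteIndex := hj C inferInstance (fun h => hA1 (le_bot_iff.1 (h ▸ hAC)))
    have hCL : (C ⊓ L).FiniteIndex := inferInstance
    have hfg : (C ⊓ L).FG := (Group.fg_iff_subgroup_fg _).1 inferInstance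
    refine fin_of_fi hCL (dsr_finite ht 1 _ hfg ?_)
    change ⁅C ⊓ L, C ⊓ L⁆ = ⊥
    rw [Subgroup.commutator_eq_bot_iff_le_centralizer]
    refine inf_le_left.trans (Subgroup.centralizer_le ?_)
    exact fun x hx => hx.2
  · let A0 : Subgroup L := A.subgroupOf L
    let cj : G → Subgroup L := fun g => A0.map (MulAut.conjNormal g : MulAut L).toMonoidHom
    have hA0 : LFn A0 := by
      intro H hH hfg
      have h1 := hL (H.map L.subtype) (by
        rw [Subgroup.map_le_iff_le_comap]; exact hH) (fg_map _ hfg)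
      exact Finite.of_equiv _ (H.equivMapOfInjective L.subtype L.subtype_injective).symm.toEquiv
    have hmem : ∀ g x, x ∈ cj g ↔ g⁻¹ * (x : G) * g ∈ A := by
      intro g x
      constructor
      · rintro ⟨y, hy, rfl⟩
        have : (y : G) ∈ A := hy
        simpa [MulAut.conjNormal_apply, mul_assoc] using this
      · intro hx
        have hxL : g⁻¹ * (x : G) * g ∈ L := by
          have : L.Normal := inferInstance
          simpa using this.conj_mem _ x.2 g⁻¹
        refine ⟨⟨_, hxL⟩, hx, ?_⟩
        ext
        simp [MulAut.conjNormal_apply, mul_assoc]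
    have hcjn : ∀ g, (cj g).Normal := by
      intro g
      refine ⟨fun x hx y => ?_⟩
      rw [hmem] at hx ⊢
      have hy : g⁻¹ * (y : G) * g ∈ U := hLU (by
        have : L.Normal := inferInstance
        simpa using this.conj_mem _ y.2 g⁻¹)
      have := hAn _ hy _ hx
      simpa [mul_assoc] using this
    have hcju : ∀ g, ∀ u ∈ U, cj (g * u) = cj g := by
      intro g u hu
      ext x
      rw [hmem, hmem]
      constructor
      · intro h
        have := hAn u hu _ h
        simpa [mul_assoc] using this
      · intro h
        have := hAn u⁻¹ (U.inv_mem hu) _ h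
        simpa [mul_assoc] using this
    have hfin : (Set.range cj).Finite := by
      refine (Set.finite_range fun q : G ⧸ U => cj q.out).subset ?_
      rintro _ ⟨g, rfl⟩
      obtain ⟨u, hu⟩ := QuotientGroup.mk_out_eq_mul U g
      exact ⟨(g : G ⧸ U), by dsimp only; rw [hu, hcju _ _ u.2]⟩
    have hLF : LFn (sSup (Set.range cj)) := LFn_sSup hfin (by rintro _ ⟨g, rfl⟩; exact hcjn g)
      (by rintro _ ⟨g, rfl⟩; exact LFn_map _ hA0)
    let B : Subgroup G := (⨆ g, cj g).map L.subtype
    have hB : LFn B := LFn_map _ hLF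
    have hBn : B.Normal := by
      refine ⟨?_⟩
      rintro _ ⟨x, hx, rfl⟩ g
      refine ⟨MulAut.conjNormal g x, ?_, by simp [MulAut.conjNormal_apply]⟩
      have h1 : (⨆ g, cj g) ≤ (⨆ g, cj g).comap (MulAut.conjNormal g : MulAut L).toMonoidHom := by
        refine iSup_le fun h y hy => ?_
        refine (le_iSup cj (g * h) : _) ?_
        rw [hmem] at hy ⊢
        simpa [MulAut.conjNormal_apply, mul_assoc] using hy
      exact h1 hx
    have hB1 : B ≠ ⊥ := by
      intro h
      refine h0 (le_bot_iff.1 (le_trans ?_ h.le))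
      intro x hx
      refine ⟨⟨x, hx.2⟩, (le_iSup cj 1 : _) ?_, rfl⟩
      rw [hmem]; simpa using hx.1
    have hBf := hj B hBn hB1
    exact fin_of_fi hBf (hB B le_rfl ((Group.fg_iff_subgroup_fg _).1 inferInstance))
end

end Piece15

/-- For every prime `p` there exists a finitely generated hereditarily just-infinite
`p`-torsion group. -/
theorem exists_fg_hereditarily_just_infinite_p_torsion (p : ℕ) (hp : p.Prime) :
    ∃ (Δ : Type) (_ : Group Δ),
      Group.FG Δ ∧ (∀ g : Δ, ∃ k : ℕ, orderOf g = p ^ k) ∧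
      HereditarilyJustInfinite Δ := by
  haveI : Fact p.Prime := ⟨hp⟩
  obtain ⟨N, hN, hP, htor, hgood, hmax⟩ := exists_N p
  let π : F2 →* F2 ⧸ N := QuotientGroup.mk' N
  have hπ : Function.Surjective π := QuotientGroup.mk'_surjective N
  have hker : π.ker = N := QuotientGroup.ker_mk' N
  have hfg : Group.FG (F2 ⧸ N) := Group.fg_of_surjective hπ
  have htor' : ∀ g : F2 ⧸ N, ∃ n, g ^ p ^ n = 1 := by
    intro g
    obtain ⟨g, rfl⟩ := hπ g
    obtain ⟨n, hn⟩ := htor g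
    exact ⟨n, by rw [← map_pow]; exact (QuotientGroup.eq_one_iff _).2 hn⟩
  have hfo : ∀ g : F2 ⧸ N, IsOfFinOrder g := by
    intro g
    obtain ⟨n, hn⟩ := htor' g
    exact isOfFinOrder_iff_pow_eq_one.2 ⟨_, pow_pos hp.pos n, hn⟩
  have hinf : Infinite (F2 ⧸ N) := by
    by_contra h
    rw [not_infinite_iff_finite] at h
    have h0 : N.index ≠ 0 := Nat.card_pos.ne'
    obtain ⟨X, h1, h2, h3⟩ := hP N.index
    have h4 := Nat.le_of_dvd (Nat.pos_of_ne_zero h0) (Subgroup.index_dvd_of_le h2)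
    rw [h3] at h4
    exact absurd (Nat.lt_pow_self hp.one_lt (n := N.index)) (by omega)
  have hrf : ResiduallyFinite (F2 ⧸ N) := by
    let c : Set (Subgroup F2) := {X | X.Normal ∧ N ≤ X ∧ ∃ m, X.index = p ^ m}
    have hR1 : (sInf c).Normal := by
      refine ⟨fun x hx g => ?_⟩
      rw [Subgroup.mem_sInf] at hx ⊢
      intro X hX
      exact hX.1.conj_mem _ (hx X hX) g
    have hR2 : N ≤ sInf c := le_sInf fun X hX => hX.2.1
    have hR3 : PP p (sInf c) := by
      intro m
      obtain ⟨X, h1, h2, h3⟩ := hP m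
      exact ⟨X, h1, sInf_le ⟨h1, h2, m, h3⟩, h3⟩
    have hR4 : N = sInf c := by
      by_contra h
      exact hmax _ hR1 (lt_of_le_of_ne hR2 h) hR3
    intro g hg
    obtain ⟨g, rfl⟩ := hπ g
    have hgN : g ∉ sInf c := by
      rw [← hR4]; exact fun h => hg ((QuotientGroup.eq_one_iff _).2 h)
    rw [Subgroup.mem_sInf] at hgN
    push Not at hgN
    obtain ⟨X, ⟨h1, h2, m, h3⟩, h4⟩ := hgN
    have h5 : (X.map π).comap π = X := by
      rw [Subgroup.comap_map_eq, hker, sup_eq_left.2 h2]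
    refine ⟨X.map π, h1.map _ hπ, ⟨?_⟩, fun h => h4 ?_⟩
    · rw [← Subgroup.index_comap_of_surjective _ hπ, h5, h3]; exact (pow_pos hp.pos _).ne'
    · rw [← h5]; exact h
  have hd : ∀ H : Subgroup (F2 ⧸ N), H.FG → Finite H ∨ H.FiniteIndex := by
    rintro H ⟨T, rfl⟩
    choose σ hσ using hπ
    have hH : Subgroup.closure (T : Set (F2 ⧸ N)) =
        (Subgroup.closure ((T.image σ : Finset F2) : Set F2)).map π := by
      rw [MonoidHom.map_closure, Finset.coe_image, ← Set.image_comp]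
      congr 1
      ext x; simp [hσ]
    rw [hH]
    have hH'fg : (Subgroup.closure ((T.image σ : Finset F2) : Set F2)).FG := ⟨_, rfl⟩
    set H' := Subgroup.closure ((T.image σ : Finset F2) : Set F2)
    rcases hgood H' hH'fg with ⟨W, hW, n, hn⟩ | h
    · left
      have hWr : W.relIndex H' ≠ 0 :=
        (inferInstance : (W.subgroupOf H').FiniteIndex).index_ne_zero
      have h1 : (H' ⊓ W).FG := fg_of_rel hH'fg hWr
      have h2 : Finite ((H' ⊓ W).map π) := by
        refine dsr_finite hfo n _ (fg_map π h1) ?_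
        rw [← dsr_map, eq_bot_iff, Subgroup.map_le_iff_le_comap]
        exact hn.trans (le_of_eq hker.symm)
      have h3 : ((H' ⊓ W).map π).relIndex (H'.map π) ≠ 0 := by
        rw [← Subgroup.relIndex_comap]
        intro h0
        have h4 : (H' ⊓ W).relIndex H' = 0 :=
          Subgroup.relIndex_eq_zero_of_le_left (Subgroup.le_comap_map π (H' ⊓ W)) h0
        rw [Subgroup.inf_relIndex_left] at h4
        exact hWr h4
      refine fin_of_rel h3 ?_
      rw [inf_eq_right.2 (Subgroup.map_mono inf_le_left)]
      exact h2
    · right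
      refine ⟨?_⟩
      have h1 := Subgroup.index_map H' π
      rw [hker, MonoidHom.range_eq_top.2 (QuotientGroup.mk'_surjective N), Subgroup.index_top, mul_one] at h1
      rw [h1]; exact h.index_ne_zero
  have hj : ∀ K : Subgroup (F2 ⧸ N), K.Normal → K ≠ ⊥ → K.FiniteIndex := by
    intro K hK hK1
    have hNK : N ≤ K.comap π := (le_of_eq hker.symm).trans (Subgroup.ker_le_comap π K)
    have hlt : N < K.comap π := by
      refine lt_of_le_of_ne hNK fun h => hK1 ?_
      have := Subgroup.map_comap_eq_self_of_surjective hπ K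
      rw [← this, ← h, eq_bot_iff, Subgroup.map_le_iff_le_comap]
      exact le_of_eq hker.symm
    obtain ⟨m, T, hT, hX⟩ := compact_fg (N := N) (inferInstance : (K.comap π).Normal) (hmax _ inferInstance hlt)
    have hHK : Subgroup.closure (T : Set F2) ≤ K.comap π := (Subgroup.closure_le _).2 hT
    have hHfg : (Subgroup.closure (T : Set F2)).FG := ⟨T, rfl⟩
    set H := Subgroup.closure (T : Set F2)
    rcases hd (H.map π) (fg_map π hHfg) with h | h
    · exfalso
      have h1 : N.relIndex H = Nat.card (H.map π) := by rw [← Subgroup.relIndex_ker, hker]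
      set s := Nat.card (H.map π)
      have hs : s ≠ 0 := Nat.card_pos.ne'
      obtain ⟨X, h2, h3, h4⟩ := hP (m + s)
      have h5 := hX _ X h2 h3 h4
      have h6 : X.relIndex (H ⊔ X) * (H ⊔ X).index = X.index := Subgroup.relIndex_mul_index le_sup_right
      rw [Subgroup.relIndex_sup_right, h4, pow_add] at h6
      have h7 : X.relIndex H ≤ s := by
        rw [← h1]; exact Subgroup.relIndex_le_of_le_left h3 (by rw [h1]; exact hs)
      have h8 : s < p ^ s := Nat.lt_pow_self hp.one_lt
      have h9 : X.relIndex H * (H ⊔ X).index ≤ s * p ^ m := Nat.mul_le_mul h7 h5.le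
      rw [h6] at h9
      have h10 := pow_pos hp.pos m
      nlinarith
    · exact Subgroup.finiteIndex_of_le (H := H.map π) (Subgroup.map_le_iff_le_comap.2 hHK)
  refine ⟨F2 ⧸ N, inferInstance, hfg, ?_, hrf, ?_⟩
  · intro g
    obtain ⟨n, hn⟩ := htor' g
    obtain ⟨k, -, hk⟩ := (Nat.dvd_prime_pow hp).1 (orderOf_dvd_of_pow_eq_one hn)
    exact ⟨k, hk⟩
  · intro U hU
    refine ⟨?_, ?_⟩
    · by_contra h
      rw [not_infinite_iff_finite] at h
      exact fin_of_fi hU h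
    · intro A hA hA1
      have h1 : (A.map U.subtype).FiniteIndex := by
        refine her hfo hd hj U _ ?_ ?_
        · intro h
          exact hA1 ((Subgroup.map_eq_bot_iff_of_injective _ U.subtype_injective).1 h)
        · rintro u hu _ ⟨x, hx, rfl⟩
          exact ⟨⟨u, hu⟩ * x * ⟨u, hu⟩⁻¹, hA.conj_mem _ hx _, rfl⟩
      have h2 : (A.map U.subtype).subgroupOf U = A :=
        Subgroup.comap_map_eq_self_of_injective U.subtype_injective A
      rw [← h2]
      infer_instance
end

section
/- Fix a prime p. Let Γ be a finitely generated group which is weakly p-LERF (p-WLERF), and let φ : Γ → Γ' be a surjective group homomorphism. Then Γ' is weakly p-LERF. -/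
/-- A subgroup is open in the pro-`p` topology if it contains a normal subgroup of
finite `p`-power index. -/
def ProPOpen (p : ℕ) {Γ : Type*} [Group Γ] (H : Subgroup Γ) : Prop :=
  ∃ N : Subgroup Γ, N.Normal ∧ N ≤ H ∧ ∃ k : ℕ, N.index = p ^ k

/-- The pro-`p` closure of a subgroup: the intersection of all pro-`p`-open
subgroups containing it. -/
def ProPClosure (p : ℕ) {Γ : Type*} [Group Γ] (Λ : Subgroup Γ) : Subgroup Γ :=
  ⨅ (H : Subgroup Γ) (_ : ProPOpen p H) (_ : Λ ≤ H), H

/-- A group is `p`-LERF if every finitely generated subgroup equals its pro-`p`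
closure. -/
def PLERF (p : ℕ) (Γ : Type*) [Group Γ] : Prop :=
  ∀ H : Subgroup Γ, H.FG → ProPClosure p H = H

/-- A group is weakly `p`-LERF if the pro-`p` closure of every infinite-index
subgroup still has infinite index. -/
def WeaklyPLERF (p : ℕ) (Γ : Type*) [Group Γ] : Prop :=
  ∀ Λ : Subgroup Γ, ¬Λ.FiniteIndex → ¬(ProPClosure p Λ).FiniteIndex

/-- Weak `p`-LERF is inherited by quotients. -/
theorem weaklyPLERF_of_surjective (p : ℕ) (hp : p.Prime)
    (Γ : Type*) [Group Γ] (hfg : Group.FG Γ) (hw : WeaklyPLERF p Γ)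
    (Γ' : Type*) [Group Γ'] (φ : Γ →* Γ') (hφ : Function.Surjective φ) :
    WeaklyPLERF p Γ' := by
  intro Λ hΛ hcl
  apply hw (Λ.comap φ)
  · intro h
    apply hΛ
    have h1 := h.index_ne_zero
    rw [Subgroup.index_comap_of_surjective _ hφ] at h1
    exact ⟨h1⟩
  · have hle : (ProPClosure p Λ).comap φ ≤ ProPClosure p (Λ.comap φ) := by
      refine le_iInf fun H => le_iInf fun hH => le_iInf fun hΛH => ?_
      obtain ⟨N, hN, hNH, k, hk⟩ := hH
      have hker : φ.ker ≤ H := (φ.ker_le_comap Λ).trans hΛH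
      have hopen : ProPOpen p (H.map φ) := by
        refine ⟨N.map φ, hN.map φ hφ, Subgroup.map_mono hNH, ?_⟩
        have hd : (N.map φ).index ∣ p ^ k := hk ▸ Subgroup.index_map_dvd N hφ
        obtain ⟨j, _, hj⟩ := (Nat.dvd_prime_pow hp).1 hd
        exact ⟨j, hj⟩
      have hΛ' : Λ ≤ H.map φ := by
        rw [← Subgroup.map_comap_eq_self_of_surjective hφ Λ]
        exact Subgroup.map_mono hΛH
      have h2 : ProPClosure p Λ ≤ H.map φ :=
        iInf_le_of_le _ (iInf_le_of_le hopen (iInf_le _ hΛ'))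
      calc (ProPClosure p Λ).comap φ ≤ (H.map φ).comap φ := Subgroup.comap_mono h2
        _ = H := Subgroup.comap_map_eq_self hker
    have hfin : ((ProPClosure p Λ).comap φ).FiniteIndex := by
      constructor
      rw [Subgroup.index_comap_of_surjective _ hφ]
      exact hcl.index_ne_zero
    exact Subgroup.finiteIndex_of_le hle
end
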